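/- arXiv:1809.07918 — 2 statements merged into one kernel-verified Lean document; each statement's English description precedes it below -/
import Mathlib

section
/- Let Ω be a properly convex quasi-homogeneous affine domain in ℝ⁴ whose asymptotic cone AC(Ω) is 2-dimensional (its linear span has dimension 2). Then Ω is affinely equivalent to one of the following: (i) the product of a paraboloid and a half-line, {(x₁,x₂,x₃,x₄) ∈ ℝ⁴ | x₃ > x₁² + x₂² and x₄ > 0}; (ii) the product of two parabolas, {(x₁,x₂,x₃,x₄) ∈ ℝ⁴ | x₂ > x₁² and x₄ > x₃²}. -/
open Matrix Set Filter Topology Pointwise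

noncomputable section

/-- The affine action on ℝⁿ of an (n+1)×(n+1) invertible matrix in affine form
(ℝⁿ is identified with the hyperplane x_{n+1} = 1). -/
def affAct (n : ℕ) (g : GL (Fin (n + 1)) ℝ) (x : Fin n → ℝ) : Fin n → ℝ :=
  fun i => (∑ j : Fin n, g.val i.castSucc j.castSucc * x j) + g.val i.castSucc (Fin.last n)

/-- A matrix in GL(n+1,ℝ) has affine form if its last row is (0, …, 0, 1). -/
def IsAffineForm (n : ℕ) (g : GL (Fin (n + 1)) ℝ) : Prop :=
  (∀ j : Fin n, g.val (Fin.last n) j.castSucc = 0) ∧ g.val (Fin.last n) (Fin.last n) = 1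

/-- Aut(Ω): the group (here: set) of affine transformations of ℝⁿ preserving Ω,
realized as affine-form matrices in GL(n+1,ℝ). -/
def AutSet (n : ℕ) (Ω : Set (Fin n → ℝ)) : Set (GL (Fin (n + 1)) ℝ) :=
  {g | IsAffineForm n g ∧ affAct n g '' Ω = Ω}

/-- Aut⁰(Ω): the identity component of Aut(Ω). -/
def AutIdComp (n : ℕ) (Ω : Set (Fin n → ℝ)) : Set (GL (Fin (n + 1)) ℝ) :=
  connectedComponentIn (AutSet n Ω) 1

/-- The limit set Λ_G of a subset G of Aut(Ω). -/
def limitSet (n : ℕ) (Ω : Set (Fin n → ℝ)) (G : Set (GL (Fin (n + 1)) ℝ)) :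
    Set (Fin n → ℝ) :=
  {ξ | ξ ∈ frontier Ω ∧ ∃ x ∈ Ω, ∃ u : ℕ → GL (Fin (n + 1)) ℝ,
    (∀ k, u k ∈ G) ∧ Filter.Tendsto (fun k => affAct n (u k) x) Filter.atTop (nhds ξ)}

/-- Ω is a convex affine domain: a nonempty open convex subset of ℝⁿ. -/
def IsConvexDomain (n : ℕ) (Ω : Set (Fin n → ℝ)) : Prop :=
  Ω.Nonempty ∧ IsOpen Ω ∧ Convex ℝ Ω

/-- Ω contains no complete affine line. -/
def HasNoLine (n : ℕ) (Ω : Set (Fin n → ℝ)) : Prop :=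
  ¬ ∃ x ∈ Ω, ∃ v : Fin n → ℝ, v ≠ 0 ∧ ∀ t : ℝ, x + t • v ∈ Ω

/-- Ω is a properly convex affine domain. -/
def IsProperlyConvexDomain (n : ℕ) (Ω : Set (Fin n → ℝ)) : Prop :=
  IsConvexDomain n Ω ∧ HasNoLine n Ω

/-- Ω is quasi-homogeneous: some compact K ⊆ Ω has ⋃_{g ∈ Aut(Ω)} g(K) = Ω. -/
def IsQuasiHomogeneous (n : ℕ) (Ω : Set (Fin n → ℝ)) : Prop :=
  ∃ K : Set (Fin n → ℝ), IsCompact K ∧ K ⊆ Ω ∧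
    (⋃ g ∈ AutSet n Ω, affAct n g '' K) = Ω

/-- Aut(Ω) is irreducible: it preserves no nonempty proper affine subspace of ℝⁿ. -/
def IsIrreducibleAut (n : ℕ) (Ω : Set (Fin n → ℝ)) : Prop :=
  ¬ ∃ S : AffineSubspace ℝ (Fin n → ℝ), (S : Set (Fin n → ℝ)).Nonempty ∧
      (S : Set (Fin n → ℝ)) ≠ Set.univ ∧
      ∀ g ∈ AutSet n Ω, affAct n g '' (S : Set (Fin n → ℝ)) = (S : Set (Fin n → ℝ))

/-- The asymptotic cone AC(Ω). -/
def asympCone (n : ℕ) (Ω : Set (Fin n → ℝ)) : Set (Fin n → ℝ) :=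
  {u | ∀ x ∈ Ω, ∀ t : ℝ, 0 ≤ t → x + t • u ∈ Ω}

/-- Ω is a cone with some vertex v. -/
def IsCone (n : ℕ) (Ω : Set (Fin n → ℝ)) : Prop :=
  ∃ v : Fin n → ℝ, ∀ x ∈ Ω, ∀ t : ℝ, 0 < t → v + t • (x - v) ∈ Ω

/-- Two subsets of ℝⁿ are affinely equivalent. -/
def AffinelyEquivalent (n : ℕ) (Ω Ω' : Set (Fin n → ℝ)) : Prop :=
  ∃ e : (Fin n → ℝ) ≃ᵃ[ℝ] (Fin n → ℝ), e '' Ω = Ω'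

/-- Γ acts freely on Ω. -/
def ActsFreely (n : ℕ) (Ω : Set (Fin n → ℝ)) (Γ : Set (GL (Fin (n + 1)) ℝ)) : Prop :=
  ∀ γ ∈ Γ, γ ≠ 1 → ∀ x ∈ Ω, affAct n γ x ≠ x

/-- Γ acts properly discontinuously on Ω. -/
def ActsProperlyDiscontinuously (n : ℕ) (Ω : Set (Fin n → ℝ))
    (Γ : Set (GL (Fin (n + 1)) ℝ)) : Prop :=
  ∀ K L : Set (Fin n → ℝ), K ⊆ Ω → L ⊆ Ω → IsCompact K → IsCompact L →
    {γ ∈ Γ | (affAct n γ '' K ∩ L).Nonempty}.Finite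

/-- Γ acts cocompactly on Ω. -/
def ActsCocompactly (n : ℕ) (Ω : Set (Fin n → ℝ)) (Γ : Set (GL (Fin (n + 1)) ℝ)) : Prop :=
  ∃ K : Set (Fin n → ℝ), IsCompact K ∧ K ⊆ Ω ∧ (⋃ γ ∈ Γ, affAct n γ '' K) = Ω

/-- The linear part of an affine-form matrix has determinant one. -/
def LinearPartDetOne (n : ℕ) (g : GL (Fin (n + 1)) ℝ) : Prop :=
  (Matrix.of fun i j : Fin n => g.val i.castSucc j.castSucc).det = 1

section ConvexPair

variable {W : Type*} [NormedAddCommGroup W] [NormedSpace ℝ W]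

theorem affineEquiv_add (A : W ≃ᵃ[ℝ] W) (w u : W) : A (w + u) = A w + A.linear u := by
  have := A.map_vadd w u
  simp only [vadd_eq_add] at this
  rw [add_comm w u, this, add_comm]

theorem affineEquiv_sub (A : W ≃ᵃ[ℝ] W) (w u : W) : A (w - u) = A w - A.linear u := by
  rw [sub_eq_add_neg, affineEquiv_add, map_neg, ← sub_eq_add_neg]

theorem norm_inv_norm_smul {v : W} (hv : v ≠ 0) : ‖‖v‖⁻¹ • v‖ = 1 := by
  rw [norm_smul, norm_inv, norm_norm, inv_mul_cancel₀ (norm_ne_zero_iff.2 hv)]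

theorem affineMap_add_sub (m : W →ᵃ[ℝ] ℝ) (w u : W) : m (w + u) + m (w - u) = 2 * m w := by
  have h1 := m.map_vadd w u
  have h2 := m.map_vadd w (-u)
  simp only [vadd_eq_add, map_neg] at h1 h2
  rw [add_comm w u, h1, sub_eq_add_neg, add_comm w (-u), h2]
  ring

/-- The symmetric second difference of a function at `w` in direction `u`. -/
def secondDiff (φ : W → ℝ) (w u : W) : ℝ := φ (w + u) + φ (w - u) - 2 * φ w

/-- `A` preserves `U` and rescales `α` and `β` by `a` and `b`, up to affine functions. -/
structure IsSym (U : Set W) (α β : W → ℝ) (A : W ≃ᵃ[ℝ] W) (a b : ℝ) : Prop where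
  left_pos : 0 < a
  right_pos : 0 < b
  map_mem : ∀ w, A w ∈ U ↔ w ∈ U
  map_left : ∃ m : W →ᵃ[ℝ] ℝ, ∀ w ∈ U, α (A w) = a * α w + m w
  map_right : ∃ m : W →ᵃ[ℝ] ℝ, ∀ w ∈ U, β (A w) = b * β w + m w

/-- Every point of `U` and every pair of scales can be brought to a compact range
by a symmetry of the pair `(α, β)`. -/
def CocompactSym (U : Set W) (α β : W → ℝ) (K : Set W) (c c' : ℝ) : Prop :=
  ∀ w ∈ U, ∀ p q : ℝ, 0 < p → 0 < q → ∃ (A : W ≃ᵃ[ℝ] W) (a b : ℝ),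
    IsSym U α β A a b ∧ A w ∈ K ∧ a * p ∈ Icc c c' ∧ b * q ∈ Icc c c'

/-- A pair of convex functions on an open convex set, jointly superlinear, with a cocompact
group of symmetries. -/
structure ConvexPair (U : Set W) (α β : W → ℝ) (K : Set W) (c c' : ℝ) : Prop where
  isOpen : IsOpen U
  nonempty : U.Nonempty
  convex_left : ConvexOn ℝ U α
  convex_right : ConvexOn ℝ U β
  superlinear : ∀ C : ℝ, ∃ R : ℝ, ∀ w ∈ U, R ≤ ‖w‖ → C * ‖w‖ < max (α w) (β w)
  isCompact : IsCompact K
  subset : K ⊆ U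
  pos : 0 < c
  cocompact : CocompactSym U α β K c c'

theorem IsSym.secondDiff_left {U : Set W} {α β : W → ℝ} {A : W ≃ᵃ[ℝ] W} {a b : ℝ}
    (h : IsSym U α β A a b) {w u : W} (hw : w ∈ U) (h1 : w + u ∈ U) (h2 : w - u ∈ U) :
    secondDiff α (A w) (A.linear u) = a * secondDiff α w u := by
  obtain ⟨m, hm⟩ := h.map_left
  unfold secondDiff
  rw [← affineEquiv_add, ← affineEquiv_sub, hm _ hw, hm _ h1, hm _ h2]
  linear_combination affineMap_add_sub m w u

theorem IsSym.symm_pair {U : Set W} {α β : W → ℝ} {A : W ≃ᵃ[ℝ] W} {a b : ℝ}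
    (h : IsSym U α β A a b) : IsSym U β α A b a :=
  ⟨h.right_pos, h.left_pos, h.map_mem, h.map_right, h.map_left⟩

theorem ConvexPair.symm {U : Set W} {α β : W → ℝ} {K : Set W} {c c' : ℝ}
    (h : ConvexPair U α β K c c') : ConvexPair U β α K c c' where
  isOpen := h.isOpen
  nonempty := h.nonempty
  convex_left := h.convex_right
  convex_right := h.convex_left
  superlinear := fun C => by simpa only [max_comm] using h.superlinear C
  isCompact := h.isCompact
  subset := h.subset
  pos := h.pos
  cocompact := fun w hw p q hp hq => by
    obtain ⟨A, a, b, hA, hK, ha, hb⟩ := h.cocompact w hw q p hq hp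
    exact ⟨A, b, a, hA.symm_pair, hK, hb, ha⟩

/-- `φ` is midpoint affine along the intersection of a line with `U`. -/
def MidAffine (U : Set W) (φ : W → ℝ) (w u : W) : Prop :=
  ∀ s t : ℝ, w + s • u ∈ U → w + t • u ∈ U →
    φ (w + s • u) + φ (w + t • u) = 2 * φ (w + ((s + t) / 2) • u)

theorem MidAffine.reparam {U : Set W} {φ : W → ℝ} {w u : W} (h : MidAffine U φ w u) (s k : ℝ) :
    MidAffine U φ (w + s • u) (k • u) := by
  intro x y hx hy
  have e : ∀ x : ℝ, w + s • u + x • k • u = w + (s + x * k) • u := by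
    intro x; module
  rw [e] at hx hy ⊢
  rw [e, e, h _ _ hx hy]
  congr 4
  ring

theorem MidAffine.map {U : Set W} {α β : W → ℝ} {A : W ≃ᵃ[ℝ] W} {a b : ℝ}
    (hU : Convex ℝ U)
    (hA : IsSym U α β A a b) {w u : W} (h : MidAffine U α w u) :
    MidAffine U α (A w) (A.linear u) := by
  intro s t hs ht
  have e : ∀ s : ℝ, A w + s • A.linear u = A (w + s • u) := by
    intro s; rw [affineEquiv_add, map_smul]
  rw [e, hA.map_mem] at hs ht
  have e1 : w + ((s + t) / 2) • u + ((s - t) / 2) • u = w + s • u := by module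
  have e2 : w + ((s + t) / 2) • u - ((s - t) / 2) • u = w + t • u := by module
  have hm : w + ((s + t) / 2) • u ∈ U := by
    have := hU hs ht (a := 1 / 2) (b := 1 / 2) (by norm_num) (by norm_num) (by norm_num)
    convert this using 1
    module
  have := hA.secondDiff_left (u := ((s - t) / 2) • u) hm (by rwa [e1]) (by rwa [e2])
  unfold secondDiff at this
  rw [← affineEquiv_add, ← affineEquiv_sub, e1, e2, h s t hs ht, sub_self, mul_zero] at this
  rw [e, e, e]
  linarith

theorem MidAffine.linear_bound {U : Set W} {φ : W → ℝ} (hU : Convex ℝ U) {y d : W} {r M : ℝ}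
    (hr : 0 < r) (hd : ‖d‖ = 1)
    (hb : ∀ z : W, ‖z‖ ≤ r → y + z ∈ U ∧ |φ (y + z)| ≤ M)
    (h : MidAffine U φ y d) (T : ℝ) (hT : 0 ≤ T) (hTU : y + T • d ∈ U) :
    φ (y + T • d) ≤ M + (2 * M / r) * T := by
  have hM : 0 ≤ M := (abs_nonneg _).trans (hb 0 (by simpa using hr.le)).2
  have key : ∀ j : ℕ, ∀ T : ℝ, 0 ≤ T → T ≤ 2 ^ j * r → y + T • d ∈ U →
      φ (y + T • d) ≤ M + (2 * M / r) * T := by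
    intro j
    induction j with
    | zero =>
      intro T h0 h1 _
      have := (hb (T • d) (by rw [norm_smul, hd, Real.norm_of_nonneg h0]; simpa using h1)).2
      have h2 : 0 ≤ (2 * M / r) * T := by positivity
      linarith [le_abs_self (φ (y + T • d))]
    | succ j ih =>
      intro T h0 h1 hTU
      by_cases hTr : T ≤ r
      · have := (hb (T • d) (by rw [norm_smul, hd, Real.norm_of_nonneg h0]; simpa using hTr)).2
        have h2 : 0 ≤ (2 * M / r) * T := by positivity
        linarith [le_abs_self (φ (y + T • d))]
      · push Not at hTr
        have hneg := hb ((-r) • d) (by rw [norm_smul, hd, norm_neg, Real.norm_of_nonneg hr.le]; simp)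
        have hmid := h T (-r) hTU hneg.1
        have hmU : y + ((T + -r) / 2) • d ∈ U := by
          have := hU hTU hneg.1 (a := 1 / 2) (b := 1 / 2) (by norm_num) (by norm_num) (by norm_num)
          convert this using 1
          module
        have := ih ((T + -r) / 2) (by linarith) (by rw [pow_succ] at h1; linarith) hmU
        have h3 := neg_abs_le (φ (y + (-r) • d))
        have h4 : (2 * M / r) * ((T + -r) / 2) = (2 * M / r) * T / 2 - M := by
          field_simp; ring
        rw [h4] at this
        linarith [hneg.2]
  obtain ⟨j, hj⟩ := pow_unbounded_of_one_lt (T / r) (one_lt_two)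
  exact key j T hT (by rw [div_lt_iff₀ hr] at hj; exact hj.le) hTU

variable [FiniteDimensional ℝ W]

theorem exists_uniform_bound {U K : Set W} {α : W → ℝ} (hU : IsOpen U) (hα : ConvexOn ℝ U α)
    (hK : IsCompact K) (hKU : K ⊆ U) :
    ∃ r > 0, ∃ M : ℝ, 0 ≤ M ∧ ∀ y ∈ K, ∀ z : W, ‖z‖ ≤ r → y + z ∈ U ∧ |α (y + z)| ≤ M := by
  obtain ⟨r, hr, hrU⟩ := hK.exists_cthickening_subset_open hU hKU
  have hc : IsCompact (Metric.cthickening r K) := hK.cthickening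
  obtain ⟨M, hM⟩ := hc.exists_bound_of_continuousOn ((hα.continuousOn hU).mono hrU)
  refine ⟨r, hr, max M 0, le_max_right _ _, fun y hy z hz => ?_⟩
  have hmem : y + z ∈ Metric.cthickening r K :=
    Metric.mem_cthickening_of_dist_le _ _ _ _ hy (by simpa [dist_eq_norm] using hz)
  exact ⟨hrU hmem, (hM _ hmem).trans (le_max_left _ _)⟩

theorem ConvexPair.exists_bounds {U : Set W} {α β : W → ℝ} {K : Set W} {c c' : ℝ}
    (h : ConvexPair U α β K c c') :
    ∃ r > 0, ∃ M : ℝ, 0 ≤ M ∧ ∀ y ∈ K, ∀ z : W, ‖z‖ ≤ r →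
      y + z ∈ U ∧ |α (y + z)| ≤ M ∧ |β (y + z)| ≤ M := by
  obtain ⟨r, hr, M, hM, h1⟩ := exists_uniform_bound h.isOpen h.convex_left h.isCompact h.subset
  obtain ⟨r', hr', M', hM', h2⟩ :=
    exists_uniform_bound h.isOpen h.convex_right h.isCompact h.subset
  refine ⟨min r r', lt_min hr hr', max M M', hM.trans (le_max_left _ _), fun y hy z hz => ?_⟩
  obtain ⟨a1, a2⟩ := h1 y hy z (hz.trans (min_le_left _ _))
  obtain ⟨b1, b2⟩ := h2 y hy z (hz.trans (min_le_right _ _))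
  exact ⟨a1, a2.trans (le_max_left _ _), b2.trans (le_max_right _ _)⟩

theorem ConvexPair.midAffine_length_bounded {U : Set W} {α β : W → ℝ} {K : Set W} {c c' : ℝ}
    (h : ConvexPair U α β K c c') :
    ∃ T₀ : ℝ, ∀ y ∈ K, ∀ d : W, ‖d‖ = 1 → MidAffine U α y d → MidAffine U β y d →
      ∀ T, 0 ≤ T → y + T • d ∈ U → T < T₀ := by
  obtain ⟨r, hr, M, hM, hb⟩ := h.exists_bounds
  obtain ⟨N, hN⟩ := h.isCompact.exists_bound_of_continuousOn continuousOn_id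
  obtain ⟨R, hR⟩ := h.superlinear (2 * M + 4 * M / r)
  refine ⟨max (max 2 (2 * N)) (R + N), fun y hy d hd hα hβ T hT hTU => ?_⟩
  by_contra! hlt
  simp only [max_le_iff] at hlt
  obtain ⟨⟨hT2, hTN⟩, hTR⟩ := hlt
  have hcv := h.convex_left.1
  have bα := hα.linear_bound hcv hr hd (fun z hz => ⟨(hb y hy z hz).1, (hb y hy z hz).2.1⟩) T hT hTU
  have bβ := hβ.linear_bound hcv hr hd (fun z hz => ⟨(hb y hy z hz).1, (hb y hy z hz).2.2⟩) T hT hTU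
  have hyN : ‖y‖ ≤ N := hN y hy
  have hn : T - N ≤ ‖y + T • d‖ := by
    have h1 : ‖T • d‖ = T := by rw [norm_smul, hd, Real.norm_of_nonneg hT, mul_one]
    have h2 : ‖T • d‖ ≤ ‖y + T • d‖ + ‖y‖ := by
      calc ‖T • d‖ = ‖(y + T • d) - y‖ := by congr 1; abel
        _ ≤ _ := norm_sub_le _ _
    linarith
  have hlt := hR _ hTU (by linarith)
  have hmax : max (α (y + T • d)) (β (y + T • d)) ≤ M + (2 * M / r) * T := max_le bα bβ
  have hT' : T / 2 ≤ ‖y + T • d‖ := by linarith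
  have : M + (2 * M / r) * T ≤ (2 * M + 4 * M / r) * ‖y + T • d‖ := by
    calc M + (2 * M / r) * T ≤ (2 * M + 4 * M / r) * (T / 2) := by
          have : M * 2 ≤ M * T := mul_le_mul_of_nonneg_left hT2 hM
          have e : (2 * M + 4 * M / r) * (T / 2) = M * T + (2 * M / r) * T := by ring
          rw [e]; linarith
      _ ≤ _ := by gcongr
  linarith

theorem ConvexPair.not_midAffine {U : Set W} {α β : W → ℝ} {K : Set W} {c c' : ℝ}
    (h : ConvexPair U α β K c c') {w u : W} (hw : w ∈ U) (hu : u ≠ 0)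
    (hα : MidAffine U α w u) (hβ : MidAffine U β w u) : False := by
  obtain ⟨T₀, hT₀⟩ := h.midAffine_length_bounded
  obtain ⟨r, hr, M, hM, hb⟩ := h.exists_bounds
  have hcv := h.convex_left.1
  by_cases hray : ∀ s : ℝ, 0 ≤ s → w + s • u ∈ U
  · obtain ⟨A, a, b, hA, hAK, -, -⟩ := h.cocompact w hw 1 1 one_pos one_pos
    have hLu : A.linear u ≠ 0 := by simpa using hu
    have hn : 0 < ‖A.linear u‖ := norm_pos_iff.2 hLu
    have h1 := (MidAffine.map hcv hA hα).reparam 0 (‖A.linear u‖⁻¹)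
    have h2 := (MidAffine.map hcv hA.symm_pair hβ).reparam 0 (‖A.linear u‖⁻¹)
    rw [zero_smul, add_zero] at h1 h2
    have h3 := hT₀ (A w) hAK _ (norm_inv_norm_smul hLu) h1 h2 (max T₀ 0) (le_max_right _ _) (by
      rw [← map_smul, ← map_smul, ← affineEquiv_add, hA.map_mem, smul_smul]
      exact hray _ (by positivity))
    exact absurd h3 (not_lt.2 (le_max_left _ _))
  · push Not at hray
    obtain ⟨s₁, hs₁, hs₁U⟩ := hray
    set S : Set ℝ := {s | 0 ≤ s ∧ w + s • u ∉ U}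
    have hSc : IsClosed S := by
      have : S = Ici 0 ∩ (fun s : ℝ => w + s • u) ⁻¹' Uᶜ := rfl
      rw [this]
      exact isClosed_Ici.inter (h.isOpen.isClosed_compl.preimage (by fun_prop))
    have hSb : BddBelow S := ⟨0, fun s hs => hs.1⟩
    have hmem : sInf S ∈ S := hSc.csInf_mem ⟨s₁, hs₁, hs₁U⟩ hSb
    set σ := sInf S
    have hσ : 0 < σ := by
      rcases hmem.1.lt_or_eq with h0 | h0
      · exact h0
      · exfalso; apply hmem.2; rw [← h0]; simpa using hw
    have hlt : ∀ s, 0 ≤ s → s < σ → w + s • u ∈ U := by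
      intro s h0 h1
      by_contra hc
      exact absurd (csInf_le hSb ⟨h0, hc⟩) (not_le.2 h1)
    -- move a point close to the end of the segment into the compact set
    obtain ⟨ε, hε, hε1, hεT⟩ : ∃ ε : ℝ, 0 < ε ∧ ε ≤ 1 / 2 ∧ T₀ ≤ r / (2 * ε) := by
      refine ⟨min (1 / 2) (r / (2 * (|T₀| + 1))), by positivity, min_le_left _ _, ?_⟩
      rw [le_div_iff₀ (by positivity)]
      have : min (1 / 2) (r / (2 * (|T₀| + 1))) ≤ r / (2 * (|T₀| + 1)) := min_le_right _ _
      have h0 : (0 : ℝ) < min (1 / 2) (r / (2 * (|T₀| + 1))) := by positivity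
      calc T₀ * (2 * min (1 / 2) (r / (2 * (|T₀| + 1))))
          ≤ (|T₀| + 1) * (2 * (r / (2 * (|T₀| + 1)))) := by
            gcongr
            linarith [le_abs_self T₀]
        _ = r := by field_simp
    set s := (1 - ε) * σ with hs
    have hs0 : 0 ≤ s := mul_nonneg (by linarith) hσ.le
    have hsσ : s < σ := by rw [hs]; nlinarith
    obtain ⟨A, a, b, hA, hAK, -, -⟩ := h.cocompact _ (hlt s hs0 hsσ) 1 1 one_pos one_pos
    have hLu : A.linear u ≠ 0 := by simpa using hu
    have hn : 0 < ‖A.linear u‖ := norm_pos_iff.2 hLu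
    have hlong : r < ε * σ * ‖A.linear u‖ := by
      by_contra! hle
      have := (hb _ hAK ((ε * σ) • A.linear u) (by
        rw [norm_smul, Real.norm_of_nonneg (by positivity)]; exact hle)).1
      rw [← map_smul, ← affineEquiv_add, hA.map_mem] at this
      apply hmem.2
      convert this using 1
      rw [hs]; module
    have e : ∀ s : ℝ, A w + s • A.linear u = A (w + s • u) := by
      intro s; rw [affineEquiv_add, map_smul]
    have h1 := (MidAffine.map hcv hA hα).reparam s (-‖A.linear u‖⁻¹)
    have h2 := (MidAffine.map hcv hA.symm_pair hβ).reparam s (-‖A.linear u‖⁻¹)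
    rw [e] at h1 h2
    have hd : ‖(-‖A.linear u‖⁻¹) • A.linear u‖ = 1 := by
      rw [neg_smul, norm_neg]; exact norm_inv_norm_smul hLu
    have h3 := hT₀ _ hAK _ hd h1 h2 (s * ‖A.linear u‖) (by positivity) (by
      rw [← e, smul_smul]
      have : s * ‖A.linear u‖ * -‖A.linear u‖⁻¹ = -s := by field_simp
      rw [this]
      have h4 := (hA.map_mem w).2 hw
      convert h4 using 1
      module)
    have h5 : s * ‖A.linear u‖ ≥ (1 / 2) * (r / ε) := by
      have : r / ε ≤ σ * ‖A.linear u‖ := by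
        rw [div_le_iff₀ hε]; linarith
      calc s * ‖A.linear u‖ = (1 - ε) * (σ * ‖A.linear u‖) := by rw [hs]; ring
        _ ≥ (1 / 2) * (r / ε) := by
          exact mul_le_mul (by linarith) this (by positivity) (by linarith)
    have h6 : r / (2 * ε) = (1 / 2) * (r / ε) := by field_simp
    linarith

end ConvexPair

section Contraction

variable {W : Type*} [NormedAddCommGroup W] [NormedSpace ℝ W]

theorem mem_of_extend_mem_closure {U : Set W} (hU : IsOpen U) (hc : Convex ℝ U) {w u : W}
    (hw : w ∈ U) {s η : ℝ} (hη : 0 < η) (h : w + ((1 + η) * s) • u ∈ closure U) :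
    w + s • u ∈ U := by
  have := hc.combo_interior_closure_mem_interior (a := η / (1 + η)) (b := 1 / (1 + η))
    (hU.interior_eq.symm ▸ hw) h (by positivity) (by positivity) (by field_simp; ring)
  rw [hU.interior_eq] at this
  convert this using 1
  rw [smul_add, ← add_assoc, ← add_smul, smul_smul]
  congr 1
  · rw [show η / (1 + η) + 1 / (1 + η) = 1 by field_simp; ring, one_smul]
  · congr 1; field_simp

variable [FiniteDimensional ℝ W] in
theorem midAffine_of_rescaling_limit {U : Set W} {α β : W → ℝ} (hU : IsOpen U)
    (hα : ConvexOn ℝ U α) {w y d u : W} (hw : w ∈ U) {A : ℕ → W ≃ᵃ[ℝ] W} {a b : ℕ → ℝ}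
    {v : ℕ → W} (hA : ∀ n, IsSym U α β (A n) (a n) (b n)) (ha : Tendsto a atTop (𝓝 0))
    (hy : Tendsto (fun n => A n w) atTop (𝓝 y))
    (hd : Tendsto (fun n => (A n).linear (v n)) atTop (𝓝 d)) (hv : Tendsto v atTop (𝓝 u)) :
    MidAffine U α y d := by
  have hcv := hα.1
  have hlim : ∀ x : ℝ, Tendsto (fun n => A n w + x • (A n).linear (v n)) atTop (𝓝 (y + x • d)) :=
    fun x => hy.add (hd.const_smul x)
  have hlim' : ∀ x : ℝ, Tendsto (fun n => w + x • v n) atTop (𝓝 (w + x • u)) :=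
    fun x => tendsto_const_nhds.add (hv.const_smul x)
  have e : ∀ n (x : ℝ), A n w + x • (A n).linear (v n) = A n (w + x • v n) := by
    intro n x; rw [affineEquiv_add, map_smul]
  have hmemA : ∀ n (x : ℝ), A n w + x • (A n).linear (v n) ∈ U ↔ w + x • v n ∈ U := by
    intro n x; rw [e, (hA n).map_mem]
  have hpull : ∀ x : ℝ, y + x • d ∈ U → w + x • u ∈ U := by
    intro x hx
    -- a slightly longer segment also lies in `U`
    have hcont : Tendsto (fun η : ℝ => y + ((1 + η) * x) • d) (𝓝[>] 0) (𝓝 (y + x • d)) := by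
      have : Continuous (fun η : ℝ => y + ((1 + η) * x) • d) := by fun_prop
      have := this.tendsto 0
      simp only [add_zero, one_mul] at this
      exact this.mono_left nhdsWithin_le_nhds
    obtain ⟨η, hηU, hη⟩ :=
      ((hcont.eventually (hU.mem_nhds hx)).and self_mem_nhdsWithin).exists
    apply mem_of_extend_mem_closure hU hcv hw (mem_Ioi.1 hη)
    apply mem_closure_of_tendsto (hlim' ((1 + η) * x))
    filter_upwards [(hlim ((1 + η) * x)).eventually (hU.mem_nhds hηU)] with n hn
    exact (hmemA n _).1 hn
  intro s t hs ht
  have hmid : ∀ {z e : W}, z + s • e ∈ U → z + t • e ∈ U → z + ((s + t) / 2) • e ∈ U := by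
    intro z e h1 h2
    have := hcv h1 h2 (a := 1 / 2) (b := 1 / 2) (by norm_num) (by norm_num) (by norm_num)
    convert this using 1
    module
  have hcontα : ∀ {z : W}, z ∈ U → ContinuousAt α z := fun hz =>
    (hα.continuousOn hU).continuousAt (hU.mem_nhds hz)
  have lim1 : Tendsto (fun n => α (A n w + s • (A n).linear (v n)) +
      α (A n w + t • (A n).linear (v n)) - 2 * α (A n w + ((s + t) / 2) • (A n).linear (v n))) atTop
      (𝓝 (α (y + s • d) + α (y + t • d) - 2 * α (y + ((s + t) / 2) • d))) :=
    (((hcontα hs).tendsto.comp (hlim s)).add ((hcontα ht).tendsto.comp (hlim t))).sub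
      (((hcontα (hmid hs ht)).tendsto.comp (hlim _)).const_mul 2)
  have lim2 : Tendsto (fun n => a n * (α (w + s • v n) +
      α (w + t • v n) - 2 * α (w + ((s + t) / 2) • v n))) atTop
      (𝓝 (0 * (α (w + s • u) + α (w + t • u) - 2 * α (w + ((s + t) / 2) • u)))) :=
    ha.mul ((((hcontα (hpull s hs)).tendsto.comp (hlim' s)).add
      ((hcontα (hpull t ht)).tendsto.comp (hlim' t))).sub
      (((hcontα (hmid (hpull s hs) (hpull t ht))).tendsto.comp (hlim' _)).const_mul 2))
  have heq : ∀ᶠ n in atTop, a n * (α (w + s • v n) +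
      α (w + t • v n) - 2 * α (w + ((s + t) / 2) • v n)) = α (A n w + s • (A n).linear (v n)) +
      α (A n w + t • (A n).linear (v n)) -
        2 * α (A n w + ((s + t) / 2) • (A n).linear (v n)) := by
    filter_upwards [(hlim s).eventually (hU.mem_nhds hs), (hlim t).eventually (hU.mem_nhds ht)]
      with n h1 h2
    have h1 := (hmemA n s).1 h1
    have h2 := (hmemA n t).1 h2
    have e1 : w + ((s + t) / 2) • v n + ((s - t) / 2) • v n = w + s • v n := by module
    have e2 : w + ((s + t) / 2) • v n - ((s - t) / 2) • v n = w + t • v n := by module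
    have := (hA n).secondDiff_left (u := ((s - t) / 2) • v n) (hmid h1 h2)
      (by rwa [e1]) (by rwa [e2])
    unfold secondDiff at this
    rw [← affineEquiv_add, ← affineEquiv_sub, e1, e2] at this
    rw [e, e, e, this]
  have := tendsto_nhds_unique (lim2.congr' heq) lim1
  linarith

variable [FiniteDimensional ℝ W]

theorem ConvexPair.exists_contraction {U : Set W} {α β : W → ℝ} {K : Set W} {c c' : ℝ}
    (h : ConvexPair U α β K c c') {w : W} (hw : w ∈ U) {ε : ℝ} (hε : 0 < ε) :
    ∃ (A : W ≃ᵃ[ℝ] W) (a b : ℝ), IsSym U α β A a b ∧ A w ∈ K ∧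
      ∀ u, ‖A.linear u‖ ≤ ε * ‖u‖ := by
  by_contra! hcon
  have hseq : ∀ n : ℕ, ∃ (A : W ≃ᵃ[ℝ] W) (a b : ℝ) (v : W), IsSym U α β A a b ∧ A w ∈ K ∧
      a * (n + 1) ∈ Icc c c' ∧ b * (n + 1) ∈ Icc c c' ∧ ‖A.linear v‖ = 1 ∧ ‖v‖ ≤ ε⁻¹ := by
    intro n
    obtain ⟨A, a, b, hA, hAK, ha, hb⟩ :=
      h.cocompact w hw (n + 1) (n + 1) (by positivity) (by positivity)
    obtain ⟨u, hu⟩ := hcon A a b hA hAK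
    have hu0 : u ≠ 0 := by rintro rfl; simp at hu
    have hLu : A.linear u ≠ 0 := by simpa using hu0
    refine ⟨A, a, b, ‖A.linear u‖⁻¹ • u, hA, hAK, ha, hb, ?_, ?_⟩
    · rw [map_smul]; exact norm_inv_norm_smul hLu
    · rw [norm_smul, norm_inv, norm_norm, inv_mul_le_iff₀ (norm_pos_iff.2 hLu),
        ← div_eq_mul_inv, le_div_iff₀ hε]
      linarith
  choose A a b v hA hAK ha hb hdn hvn using hseq
  have hcomp : IsCompact (K ×ˢ (Metric.sphere (0 : W) 1 ×ˢ Metric.closedBall (0 : W) ε⁻¹)) :=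
    h.isCompact.prod ((isCompact_sphere _ _).prod (isCompact_closedBall _ _))
  obtain ⟨⟨y, d, u⟩, hmem, φ, hφ, hlim⟩ := hcomp.tendsto_subseq
    (x := fun n => (A n w, (A n).linear (v n), v n))
    (fun n => ⟨hAK n, by simp [hdn n], by simpa using hvn n⟩)
  obtain ⟨hyK, hd, -⟩ := hmem
  rw [Prod.tendsto_iff, Prod.tendsto_iff] at hlim
  obtain ⟨hy, hd', hv⟩ := hlim
  have hzero : ∀ x : ℕ → ℝ, (∀ n, x n * (n + 1) ∈ Icc c c') → Tendsto x atTop (𝓝 0) := by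
    intro x hx
    apply squeeze_zero (g := fun n : ℕ => c' * (1 / ((n : ℝ) + 1)))
    · intro n
      have := (hx n).1
      by_contra! hneg
      have h1 : (0 : ℝ) < n + 1 := by positivity
      nlinarith [h.pos]
    · intro n
      have h1 : (0 : ℝ) < n + 1 := by positivity
      rw [mul_one_div, le_div_iff₀ h1]
      exact (hx n).2
    · simpa using tendsto_one_div_add_atTop_nhds_zero_nat.const_mul c'
  have hd1 : d ≠ 0 := by
    rintro rfl; simp at hd
  exact h.not_midAffine (h.subset hyK) hd1
    (midAffine_of_rescaling_limit h.isOpen h.convex_left hw (fun n => hA (φ n))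
      ((hzero a ha).comp hφ.tendsto_atTop) hy hd' hv)
    (midAffine_of_rescaling_limit h.isOpen h.convex_right hw (fun n => (hA (φ n)).symm_pair)
      ((hzero b hb).comp hφ.tendsto_atTop) hy hd' hv)

theorem ConvexPair.eq_univ {U : Set W} {α β : W → ℝ} {K : Set W} {c c' : ℝ}
    (h : ConvexPair U α β K c c') : U = univ := by
  obtain ⟨w, hw⟩ := h.nonempty
  obtain ⟨r, hr, M, hM, hb⟩ := h.exists_bounds
  rw [eq_univ_iff_forall]
  intro z
  obtain ⟨A, a, b, hA, hAK, hL⟩ :=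
    h.exists_contraction hw (ε := r / (‖z - w‖ + 1)) (by positivity)
  have h1 : ‖A.linear (z - w)‖ ≤ r := by
    refine (hL _).trans ?_
    rw [div_mul_eq_mul_div, div_le_iff₀ (by positivity)]
    nlinarith [norm_nonneg (z - w)]
  have h2 := (hb _ hAK _ h1).1
  rw [← affineEquiv_add, hA.map_mem] at h2
  simpa using h2

end Contraction

section SymmetryGroup

variable {W : Type*} [NormedAddCommGroup W] [NormedSpace ℝ W] {α β : W → ℝ}

theorem affineEquiv_linear_mul (A B : W ≃ᵃ[ℝ] W) (u : W) :
    (A * B).linear u = A.linear (B.linear u) := rfl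

theorem IsSym.mul {A B : W ≃ᵃ[ℝ] W} {a b a' b' : ℝ}
    (hA : IsSym univ α β A a b) (hB : IsSym univ α β B a' b') :
    IsSym univ α β (A * B) (a * a') (b * b') where
  left_pos := mul_pos hA.left_pos hB.left_pos
  right_pos := mul_pos hA.right_pos hB.right_pos
  map_mem := by simp
  map_left := by
    obtain ⟨m, hm⟩ := hA.map_left
    obtain ⟨m', hm'⟩ := hB.map_left
    refine ⟨a • m' + m.comp B.toAffineMap, fun w _ => ?_⟩
    simp only [AffineEquiv.coe_mul, Function.comp, hm _ (mem_univ _), hm' _ (mem_univ _),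
      AffineMap.coe_add, Pi.add_apply, AffineMap.coe_smul, Pi.smul_apply, smul_eq_mul,
      AffineMap.coe_comp, AffineEquiv.coe_toAffineMap]
    ring
  map_right := by
    obtain ⟨m, hm⟩ := hA.map_right
    obtain ⟨m', hm'⟩ := hB.map_right
    refine ⟨b • m' + m.comp B.toAffineMap, fun w _ => ?_⟩
    simp only [AffineEquiv.coe_mul, Function.comp, hm _ (mem_univ _), hm' _ (mem_univ _),
      AffineMap.coe_add, Pi.add_apply, AffineMap.coe_smul, Pi.smul_apply, smul_eq_mul,
      AffineMap.coe_comp, AffineEquiv.coe_toAffineMap]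
    ring

theorem IsSym.inv {A : W ≃ᵃ[ℝ] W} {a b : ℝ} (hA : IsSym univ α β A a b) :
    IsSym univ α β A⁻¹ a⁻¹ b⁻¹ where
  left_pos := inv_pos.2 hA.left_pos
  right_pos := inv_pos.2 hA.right_pos
  map_mem := by simp
  map_left := by
    obtain ⟨m, hm⟩ := hA.map_left
    refine ⟨-(a⁻¹ • m.comp A⁻¹.toAffineMap), fun w _ => ?_⟩
    have h1 := hm (A⁻¹ w) (mem_univ _)
    have h2 : A (A⁻¹ w) = w := A.apply_symm_apply w
    have := hA.left_pos.ne'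
    rw [h2] at h1
    simp only [AffineMap.coe_neg, Pi.neg_apply, AffineMap.coe_smul, Pi.smul_apply, smul_eq_mul,
      AffineMap.coe_comp, AffineEquiv.coe_toAffineMap, Function.comp, h1]
    field_simp
    ring
  map_right := by
    obtain ⟨m, hm⟩ := hA.map_right
    refine ⟨-(b⁻¹ • m.comp A⁻¹.toAffineMap), fun w _ => ?_⟩
    have h1 := hm (A⁻¹ w) (mem_univ _)
    have h2 : A (A⁻¹ w) = w := A.apply_symm_apply w
    have := hA.right_pos.ne'
    rw [h2] at h1
    simp only [AffineMap.coe_neg, Pi.neg_apply, AffineMap.coe_smul, Pi.smul_apply, smul_eq_mul,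
      AffineMap.coe_comp, AffineEquiv.coe_toAffineMap, Function.comp, h1]
    field_simp
    ring

theorem IsSym.commutator {A B : W ≃ᵃ[ℝ] W} {a b a' b' : ℝ}
    (hA : IsSym univ α β A a b) (hB : IsSym univ α β B a' b') :
    IsSym univ α β (A * B * A⁻¹ * B⁻¹) 1 1 := by
  have := ((hA.mul hB).mul hA.inv).mul hB.inv
  have h1 := hA.left_pos.ne'
  have h2 := hA.right_pos.ne'
  have h3 := hB.left_pos.ne'
  have h4 := hB.right_pos.ne'
  convert this using 1 <;> field_simp

theorem IsSym.conj {A B : W ≃ᵃ[ℝ] W} {a b : ℝ}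
    (hA : IsSym univ α β A 1 1) (hB : IsSym univ α β B a b) :
    IsSym univ α β (B * A * B⁻¹) 1 1 := by
  have := (hB.mul hA).mul hB.inv
  have h3 := hB.left_pos.ne'
  have h4 := hB.right_pos.ne'
  convert this using 1 <;> field_simp

/-- The sum of the second differences of `α` and `β`. -/
def totalDiff (α β : W → ℝ) (w u : W) : ℝ := secondDiff α w u + secondDiff β w u

theorem IsSym.secondDiff_eq {A : W ≃ᵃ[ℝ] W} {a b : ℝ} (hA : IsSym univ α β A a b) (w u : W) :
    secondDiff α (A w) (A.linear u) = a * secondDiff α w u ∧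
      secondDiff β (A w) (A.linear u) = b * secondDiff β w u :=
  ⟨hA.secondDiff_left (mem_univ _) (mem_univ _) (mem_univ _),
    hA.symm_pair.secondDiff_left (mem_univ _) (mem_univ _) (mem_univ _)⟩

theorem IsSym.totalDiff_eq {A : W ≃ᵃ[ℝ] W} (hA : IsSym univ α β A 1 1) (w u : W) :
    totalDiff α β (A w) (A.linear u) = totalDiff α β w u := by
  obtain ⟨h1, h2⟩ := hA.secondDiff_eq w u
  simp only [totalDiff, h1, h2, one_mul]

theorem secondDiff_nonneg (hα : ConvexOn ℝ univ α) (w u : W) : 0 ≤ secondDiff α w u := by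
  obtain ⟨-, hα⟩ := hα
  have := hα (mem_univ (w + u)) (mem_univ (w - u)) (a := 1 / 2) (b := 1 / 2)
    (by norm_num) (by norm_num) (by norm_num)
  rw [show (1 / 2 : ℝ) • (w + u) + (1 / 2 : ℝ) • (w - u) = w by module] at this
  simp only [smul_eq_mul] at this
  unfold secondDiff
  linarith

theorem convexOn_lower_bound (hα : ConvexOn ℝ univ α) {w u : W} {M : ℝ} (hu : u ≠ 0)
    (hM : ∀ z : W, ‖z‖ ≤ 1 → |α (w + z)| ≤ M) : -(1 + 2 * ‖u‖) * M ≤ α (w - u) := by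
  have hn : 0 < ‖u‖ := norm_pos_iff.2 hu
  obtain ⟨-, hα⟩ := hα
  have h := hα (mem_univ (w - u)) (mem_univ (w + ‖u‖⁻¹ • u)) (a := 1 / (1 + ‖u‖))
    (b := ‖u‖ / (1 + ‖u‖)) (by positivity) (by positivity) (by field_simp)
  have e : (1 / (1 + ‖u‖)) • (w - u) + (‖u‖ / (1 + ‖u‖)) • (w + ‖u‖⁻¹ • u) = w := by
    have e1 : 1 / (1 + ‖u‖) + ‖u‖ / (1 + ‖u‖) = 1 := by field_simp
    have e2 : ‖u‖ / (1 + ‖u‖) * ‖u‖⁻¹ = 1 / (1 + ‖u‖) := by field_simp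
    rw [smul_add, smul_sub, smul_smul, e2]
    calc _ = (1 / (1 + ‖u‖) + ‖u‖ / (1 + ‖u‖)) • w := by module
      _ = w := by rw [e1, one_smul]
  rw [e, smul_eq_mul, smul_eq_mul] at h
  have h1 := neg_le_of_abs_le (hM 0 (by simp))
  rw [add_zero] at h1
  have h2 := le_of_abs_le (hM (‖u‖⁻¹ • u) (norm_inv_norm_smul hu).le)
  have h3 : (1 + ‖u‖) * α w ≤ α (w - u) + ‖u‖ * α (w + ‖u‖⁻¹ • u) := by
    calc _ ≤ (1 + ‖u‖) * (1 / (1 + ‖u‖) * α (w - u) +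
        ‖u‖ / (1 + ‖u‖) * α (w + ‖u‖⁻¹ • u)) := by gcongr
      _ = _ := by field_simp
  nlinarith

variable [FiniteDimensional ℝ W] {K : Set W} {c c' : ℝ}

theorem ConvexPair.norm_bound_of_totalDiff (h : ConvexPair univ α β K c c') (w : W) (C : ℝ) :
    ∃ R, ∀ u, totalDiff α β w u ≤ C → ‖u‖ ≤ R := by
  have hcα : Continuous α := continuousOn_univ.1 (h.convex_left.continuousOn isOpen_univ)
  have hcβ : Continuous β := continuousOn_univ.1 (h.convex_right.continuousOn isOpen_univ)
  obtain ⟨M₁, hM₁⟩ := (isCompact_closedBall (0 : W) 1).exists_bound_of_continuousOn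
    (f := fun z => α (w + z)) (by fun_prop)
  obtain ⟨M₂, hM₂⟩ := (isCompact_closedBall (0 : W) 1).exists_bound_of_continuousOn
    (f := fun z => β (w + z)) (by fun_prop)
  set M := max M₁ M₂ with hMdef
  have hMα : ∀ z : W, ‖z‖ ≤ 1 → |α (w + z)| ≤ M := fun z hz =>
    (hM₁ z (by simpa using hz)).trans (le_max_left _ _)
  have hMβ : ∀ z : W, ‖z‖ ≤ 1 → |β (w + z)| ≤ M := fun z hz =>
    (hM₂ z (by simpa using hz)).trans (le_max_right _ _)
  have hM0 : 0 ≤ M := (abs_nonneg _).trans (hMα 0 (by simp))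
  obtain ⟨R, hR⟩ := h.superlinear (2 * M + 1)
  refine ⟨max 0 (max (R + ‖w‖) (C + 3 * M + (2 * M + 1) * ‖w‖)), fun u hu => ?_⟩
  by_contra! hlt
  simp only [max_lt_iff] at hlt
  obtain ⟨hn, h1, h2⟩ := hlt
  have hu0 : u ≠ 0 := norm_pos_iff.1 hn
  have hnorm : ‖u‖ - ‖w‖ ≤ ‖w + u‖ := by
    have := norm_sub_norm_le u (-w)
    rwa [norm_neg, sub_neg_eq_add, add_comm u w] at this
  have key := hR (w + u) (mem_univ _) (by linarith)
  have l1 := convexOn_lower_bound h.convex_left hu0 hMα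
  have l2 := convexOn_lower_bound h.convex_right hu0 hMβ
  have p1 := secondDiff_nonneg h.convex_left w u
  have p2 := secondDiff_nonneg h.convex_right w u
  have q1 := le_of_abs_le (hMα 0 (by simp))
  have q2 := le_of_abs_le (hMβ 0 (by simp))
  rw [add_zero] at q1 q2
  have k2 : (2 * M + 1) * (‖u‖ - ‖w‖) ≤ (2 * M + 1) * ‖w + u‖ := by gcongr
  unfold totalDiff at hu
  unfold secondDiff at hu p1 p2
  rcases lt_max_iff.1 key with k | k <;> nlinarith

end SymmetryGroup

section Periods

variable {W : Type*} [NormedAddCommGroup W] [NormedSpace ℝ W]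

theorem exists_line_of_small [FiniteDimensional ℝ W] {S : AddSubgroup W}
    (hS : IsClosed (S : Set W)) {v : ℕ → W} (hv : ∀ n, v n ∈ S) (h0 : ∀ n, v n ≠ 0)
    (hlim : Tendsto v atTop (𝓝 0)) : ∃ e : W, e ≠ 0 ∧ ∀ s : ℝ, s • e ∈ S := by
  obtain ⟨e, he, φ, hφ, hconv⟩ := (isCompact_sphere (0 : W) 1).tendsto_subseq
    (x := fun n => ‖v n‖⁻¹ • v n) (fun n => by simpa using norm_inv_norm_smul (h0 n))
  refine ⟨e, by rintro rfl; simp at he, fun s => ?_⟩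
  have hn : Tendsto (fun n => ‖v (φ n)‖) atTop (𝓝 0) := by
    simpa using (hlim.comp hφ.tendsto_atTop).norm
  have hr : Tendsto (fun n => (round (s / ‖v (φ n)‖) : ℝ) * ‖v (φ n)‖) atTop (𝓝 s) := by
    rw [tendsto_iff_norm_sub_tendsto_zero]
    apply squeeze_zero (fun _ => norm_nonneg _) (g := fun n => 1 / 2 * ‖v (φ n)‖) _
      (by simpa only [mul_zero] using hn.const_mul (1 / 2))
    intro n
    have hp : 0 < ‖v (φ n)‖ := norm_pos_iff.2 (h0 _)
    have := abs_sub_round (s / ‖v (φ n)‖)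
    rw [Real.norm_eq_abs, abs_sub_comm]
    calc _ = |s / ‖v (φ n)‖ - round (s / ‖v (φ n)‖)| * ‖v (φ n)‖ := by
          rw [← abs_of_pos hp, ← abs_mul, abs_of_pos hp, sub_mul, div_mul_cancel₀ _ hp.ne']
      _ ≤ _ := by gcongr
  refine hS.mem_of_tendsto (hr.smul hconv) (Eventually.of_forall fun n => ?_)
  simp only [Function.comp]
  rw [smul_smul, mul_assoc, mul_inv_cancel₀ (norm_ne_zero_iff.2 (h0 _)), mul_one,
    Int.cast_smul_eq_zsmul]
  exact S.zsmul_mem (hv _) _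

/-- The largest linear subspace contained in an additive subgroup. -/
def lineality (S : AddSubgroup W) : Submodule ℝ W where
  carrier := {v | ∀ s : ℝ, s • v ∈ S}
  add_mem' := fun ha hb s => by rw [smul_add]; exact S.add_mem (ha s) (hb s)
  zero_mem' := fun s => by rw [smul_zero]; exact S.zero_mem
  smul_mem' := fun r v hv s => by rw [smul_smul]; exact hv _

theorem mem_lineality {S : AddSubgroup W} {v : W} : v ∈ lineality S ↔ ∀ s : ℝ, s • v ∈ S := Iff.rfl

theorem mem_of_mem_lineality {S : AddSubgroup W} {v : W} (hv : v ∈ lineality S) : v ∈ S := by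
  simpa using hv 1

theorem mem_lineality_of_contraction [FiniteDimensional ℝ W] {S : AddSubgroup W}
    (hS : IsClosed (S : Set W)) (L : W ≃ₗ[ℝ] W) (hL : ∀ v, L v ∈ S ↔ v ∈ S)
    (hc : ∀ v, ‖L v‖ ≤ 1 / 2 * ‖v‖) {v : W} (hv : v ∈ S) : v ∈ lineality S := by
  by_contra hcon
  have hL' : ∀ v, L v ∈ lineality S ↔ v ∈ lineality S := by
    intro v
    simp only [mem_lineality, ← map_smul, hL]
  obtain ⟨C, hC⟩ := (lineality S).exists_isCompl
  set π := C.projection (lineality S) hC.symm with hπ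
  have hsub : ∀ x, x - π x ∈ lineality S := fun x => Submodule.sub_projection_mem _ x
  let z : ℕ → W := fun n => n.rec v (fun _ x => L x)
  have hz : ∀ n, z n ∈ S ∧ z n ∉ lineality S ∧ ‖z n‖ ≤ (1 / 2) ^ n * ‖v‖ := by
    intro n
    induction n with
    | zero => exact ⟨hv, hcon, by simp [z]⟩
    | succ n ih =>
      refine ⟨(hL _).2 ih.1, fun h => ih.2.1 ((hL' _).1 h), ?_⟩
      calc _ ≤ 1 / 2 * ‖z n‖ := hc _
        _ ≤ 1 / 2 * ((1 / 2) ^ n * ‖v‖) := by gcongr; exact ih.2.2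
        _ = _ := by ring
  have hz0 : Tendsto z atTop (𝓝 0) := by
    apply squeeze_zero_norm (fun n => (hz n).2.2)
    simpa using (tendsto_pow_atTop_nhds_zero_of_lt_one (r := (1 / 2 : ℝ)) (by norm_num)
      (by norm_num)).mul_const ‖v‖
  have hπc : Continuous π := π.continuous_of_finiteDimensional
  let S' : AddSubgroup W := S ⊓ C.toAddSubgroup
  have hS' : IsClosed (S' : Set W) := hS.inter C.closed_of_finiteDimensional
  obtain ⟨e, he, hes⟩ := exists_line_of_small hS' (v := fun n => π (z n))
    (fun n => ⟨by
      have := S.sub_mem (hz n).1 (mem_of_mem_lineality (hsub (z n)))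
      simpa using this, Submodule.projection_apply_mem _ _⟩)
    (fun n h => (hz n).2.1 (by simpa [h] using hsub (z n)))
    (by simpa [Function.comp_def] using (hπc.tendsto 0).comp hz0)
  have h1 : e ∈ lineality S := fun s => (hes s).1
  have h2 : e ∈ C := by simpa using (hes 1).2
  exact he ((Submodule.disjoint_def.1 hC.disjoint) e h1 h2)

variable {α β : W → ℝ}

/-- The vectors along which both second differences are periodic. -/
def periodGroup (α β : W → ℝ) : AddSubgroup W where
  carrier := {v | ∀ w u, secondDiff α (w + v) u = secondDiff α w u ∧
    secondDiff β (w + v) u = secondDiff β w u}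
  add_mem' := fun {v v'} hv hv' w u => by
    rw [← add_assoc, (hv' _ u).1, (hv' _ u).2]
    exact hv w u
  zero_mem' := fun w u => by simp
  neg_mem' := fun {v} hv w u => by
    have := hv (w + -v) u
    rw [neg_add_cancel_right] at this
    exact ⟨this.1.symm, this.2.symm⟩

omit [NormedSpace ℝ W] in
theorem mem_periodGroup {v : W} : v ∈ periodGroup α β ↔
    ∀ w u, secondDiff α (w + v) u = secondDiff α w u ∧
      secondDiff β (w + v) u = secondDiff β w u := Iff.rfl

omit [NormedSpace ℝ W] in
theorem isClosed_periodGroup (hα : Continuous α) (hβ : Continuous β) :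
    IsClosed (periodGroup α β : Set W) := by
  have : (periodGroup α β : Set W) = ⋂ (w : W) (u : W), ({v | secondDiff α (w + v) u = secondDiff α w u} ∩
      {v | secondDiff β (w + v) u = secondDiff β w u}) := by
    ext v
    simp only [SetLike.mem_coe, mem_periodGroup, mem_iInter, mem_inter_iff, mem_ofPred_eq]
  rw [this]
  refine isClosed_iInter fun w => isClosed_iInter fun u => (isClosed_eq ?_ ?_).inter
    (isClosed_eq ?_ ?_) <;> unfold secondDiff <;> fun_prop

theorem IsSym.linear_mem_periodGroup {A : W ≃ᵃ[ℝ] W} {a b : ℝ} (hA : IsSym univ α β A a b)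
    {v : W} : A.linear v ∈ periodGroup α β ↔ v ∈ periodGroup α β := by
  have key : ∀ {A : W ≃ᵃ[ℝ] W} {a b : ℝ}, IsSym univ α β A a b → ∀ v ∈ periodGroup α β,
      A.linear v ∈ periodGroup α β := by
    intro A a b hA v hv w u
    have hw : A (A⁻¹ w) = w := A.apply_symm_apply w
    have hu : A.linear (A⁻¹.linear u) = u := A.linear.apply_symm_apply u
    have h1 := hA.secondDiff_eq (A⁻¹ w) (A⁻¹.linear u)
    have h2 := hA.secondDiff_eq (A⁻¹ w + v) (A⁻¹.linear u)
    rw [affineEquiv_add, (hv _ _).1, (hv _ _).2] at h2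
    rw [hw, hu] at h1 h2
    exact ⟨h2.1.trans h1.1.symm, h2.2.trans h1.2.symm⟩
  refine ⟨fun h => ?_, key hA v⟩
  have h2 : A⁻¹.linear (A.linear v) = v := A.linear.symm_apply_apply v
  simpa only [h2] using key hA.inv _ h

theorem IsSym.linear_mem_lineality {A : W ≃ᵃ[ℝ] W} {a b : ℝ} (hA : IsSym univ α β A a b)
    {v : W} : A.linear v ∈ lineality (periodGroup α β) ↔ v ∈ lineality (periodGroup α β) := by
  simp only [mem_lineality, ← map_smul, hA.linear_mem_periodGroup]

theorem IsSym.sub_mem_periodGroup {A : W ≃ᵃ[ℝ] W} (hA : IsSym univ α β A 1 1)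
    (hL : ∀ u, A.linear u = u) (w : W) : A w - w ∈ periodGroup α β := by
  intro w' u
  have h := hA.secondDiff_eq w' u
  have e : A w' = w' + (A w - w) := by
    have := affineEquiv_sub A w (w - w')
    rw [hL, sub_sub_cancel] at this
    rw [this]; abel
  rwa [hL, e, one_mul, one_mul] at h

variable [FiniteDimensional ℝ W] {K : Set W} {c c' : ℝ}

theorem ConvexPair.continuous_left (h : ConvexPair univ α β K c c') : Continuous α :=
  continuousOn_univ.1 (h.convex_left.continuousOn isOpen_univ)

theorem ConvexPair.continuous_right (h : ConvexPair univ α β K c c') : Continuous β :=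
  h.symm.continuous_left

theorem ConvexPair.mem_lineality (h : ConvexPair univ α β K c c') {v : W}
    (hv : v ∈ periodGroup α β) : v ∈ lineality (periodGroup α β) := by
  obtain ⟨A, a, b, hA, -, hL⟩ := h.exists_contraction (mem_univ 0) (ε := 1 / 2) (by norm_num)
  exact mem_lineality_of_contraction (isClosed_periodGroup h.continuous_left h.continuous_right)
    A.linear (fun v => hA.linear_mem_periodGroup) hL hv

theorem ConvexPair.lineality_eq_top (h : ConvexPair univ α β K c c') {w₀ : W}
    (hfix : ∀ (A : W ≃ᵃ[ℝ] W) (a b : ℝ), IsSym univ α β A a b →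
      A w₀ - w₀ ∈ lineality (periodGroup α β)) : lineality (periodGroup α β) = ⊤ := by
  rw [Submodule.eq_top_iff']
  intro u
  obtain ⟨M₁, hM₁⟩ := h.isCompact.exists_bound_of_continuousOn
    (f := fun z => secondDiff α w₀ (z - w₀))
    (by have := h.continuous_left; unfold secondDiff; fun_prop)
  obtain ⟨M₂, hM₂⟩ := h.isCompact.exists_bound_of_continuousOn
    (f := fun z => secondDiff β w₀ (z - w₀))
    (by have := h.continuous_right; unfold secondDiff; fun_prop)
  obtain ⟨R, hR⟩ := h.norm_bound_of_totalDiff w₀ (M₁ / c + M₂ / c)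
  have hx : ∀ n : ℕ, ∃ x ∈ lineality (periodGroup α β), ‖(n + 1 : ℝ) • u + x‖ ≤ R := by
    intro n
    obtain ⟨A, a, b, hA, hAK, ha, hb⟩ :=
      h.cocompact (w₀ + (n + 1 : ℝ) • u) (mem_univ _) 1 1 one_pos one_pos
    rw [mul_one] at ha hb
    have hx : A.linear (A.linear.symm (A w₀ - w₀)) = A w₀ - w₀ := A.linear.apply_symm_apply _
    refine ⟨A.linear.symm (A w₀ - w₀), ?_, hR _ ?_⟩
    · rw [← hA.linear_mem_lineality, hx]
      exact hfix A a b hA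
    · have hs := hA.secondDiff_eq w₀ ((n + 1 : ℝ) • u + A.linear.symm (A w₀ - w₀))
      have e1 : A.linear ((n + 1 : ℝ) • u + A.linear.symm (A w₀ - w₀)) =
          A (w₀ + (n + 1 : ℝ) • u) - w₀ := by
        rw [map_add, hx, affineEquiv_add]; abel
      have hp := fun u => mem_of_mem_lineality (hfix A a b hA) w₀ u
      rw [add_sub_cancel] at hp
      rw [e1, (hp _).1, (hp _).2] at hs
      have b1 := le_of_abs_le (hM₁ _ hAK)
      have b2 := le_of_abs_le (hM₂ _ hAK)
      have hc := h.pos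
      refine add_le_add ?_ ?_
      · rw [le_div_iff₀ hc]
        have := secondDiff_nonneg h.convex_left w₀
          ((n + 1 : ℝ) • u + A.linear.symm (A w₀ - w₀))
        nlinarith [ha.1]
      · rw [le_div_iff₀ hc]
        have := secondDiff_nonneg h.convex_right w₀
          ((n + 1 : ℝ) • u + A.linear.symm (A w₀ - w₀))
        nlinarith [hb.1]
  choose x hxm hxn using hx
  have hlim : Tendsto (fun n : ℕ => (-(1 / ((n : ℝ) + 1))) • x n) atTop (𝓝 u) := by
    rw [tendsto_iff_norm_sub_tendsto_zero]
    apply squeeze_zero (fun _ => norm_nonneg _) (g := fun n : ℕ => 1 / ((n : ℝ) + 1) * R) _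
      (by simpa using (tendsto_one_div_add_atTop_nhds_zero_nat (𝕜 := ℝ)).mul_const R)
    intro n
    have hn : (0 : ℝ) < n + 1 := by positivity
    have e : (-(1 / ((n : ℝ) + 1))) • x n - u = (-(1 / ((n : ℝ) + 1))) • ((n + 1 : ℝ) • u + x n) := by
      rw [smul_add, smul_smul, neg_mul, one_div_mul_cancel hn.ne']; module
    rw [e, norm_smul, norm_neg, Real.norm_of_nonneg (by positivity)]
    gcongr
    exact hxn n
  exact (lineality (periodGroup α β)).closed_of_finiteDimensional.mem_of_tendsto hlim
    (Eventually.of_forall fun n => Submodule.smul_mem _ _ (hxm n))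

end Periods

section Unipotent

variable {W : Type*} [NormedAddCommGroup W] [NormedSpace ℝ W] {α β : W → ℝ}

theorem affineMap_sub_eq (m : W →ᵃ[ℝ] ℝ) (x y : W) : m x - m y = m.linear (x - y) := by
  rw [← vsub_eq_sub x y, m.linearMap_vsub, vsub_eq_sub]

theorem parabolic_bound {A : W ≃ᵃ[ℝ] W} (hα : ConvexOn ℝ univ α) (hA : IsSym univ α β A 1 1)
    {v n : W} (hv : A 0 = v) (hn : A.linear v = v + n) (hnn : A.linear n = n) :
    ∃ κ : ℝ, ∀ j : ℕ, α (((j : ℝ) ^ 2 / 2) • n) ≤ α 0 + κ * (j : ℝ) ^ 2 := by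
  obtain ⟨m, hm⟩ := hA.map_left
  set x : ℝ → W := fun t => t • v + (t * (t - 1) / 2) • n with hx
  have hAx : ∀ t, A (x t) = x (t + 1) := by
    intro t
    have := affineEquiv_add A 0 (x t)
    rw [zero_add] at this
    rw [this, hv, hx]
    simp only [map_add, map_smul, hn, hnn]
    module
  have hstep : ∀ t, α (x (t + 1)) = α (x t) + m (x t) := by
    intro t; rw [← hAx, hm _ (mem_univ _), one_mul]
  have hsum : ∀ j : ℕ, α (x j) + α (x (-j)) = 2 * α 0 + m.linear (v - n) * (j : ℝ) ^ 2 := by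
    intro j
    induction j with
    | zero => simp [hx]; ring
    | succ j ih =>
      have h1 := hstep j
      have h2 := hstep (-(j + 1 : ℝ))
      have h3 := affineMap_sub_eq m (x j) (x (-(j + 1 : ℝ)))
      have e : x j - x (-(j + 1 : ℝ)) = (2 * j + 1 : ℝ) • (v - n) := by
        simp only [hx]; module
      rw [e, map_smul, smul_eq_mul] at h3
      rw [show -(j + 1 : ℝ) + 1 = -j by ring] at h2
      push_cast
      linarith
  refine ⟨m.linear (v - n) / 2, fun j => ?_⟩
  obtain ⟨-, hα⟩ := hα
  have := hα (mem_univ (x j)) (mem_univ (x (-j))) (a := 1 / 2) (b := 1 / 2)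
    (by norm_num) (by norm_num) (by norm_num)
  have e : (1 / 2 : ℝ) • x j + (1 / 2 : ℝ) • x (-j) = ((j : ℝ) ^ 2 / 2) • n := by
    simp only [hx]; module
  rw [e, smul_eq_mul, smul_eq_mul] at this
  linarith [hsum j]

theorem ConvexPair.not_parabolic {K : Set W} {c c' : ℝ} (h : ConvexPair univ α β K c c')
    {A : W ≃ᵃ[ℝ] W} (hA : IsSym univ α β A 1 1) {v n : W} (hv : A 0 = v)
    (hn : A.linear v = v + n) (hnn : A.linear n = n) : n = 0 := by
  by_contra hn0
  have hpos : 0 < ‖n‖ := norm_pos_iff.2 hn0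
  obtain ⟨κ, hκ⟩ := parabolic_bound h.convex_left hA hv hn hnn
  obtain ⟨κ', hκ'⟩ := parabolic_bound h.convex_right hA.symm_pair hv hn hnn
  obtain ⟨R, hR⟩ := h.superlinear ((|α 0| + |β 0| + |κ| + |κ'|) * 2 / ‖n‖)
  obtain ⟨j, hj⟩ := exists_nat_gt (max 1 (R * 2 / ‖n‖))
  obtain ⟨hj1, hjR⟩ := max_lt_iff.1 hj
  have hj2 : (j : ℝ) ≤ j ^ 2 := by nlinarith
  have hnorm : ‖((j : ℝ) ^ 2 / 2) • n‖ = (j : ℝ) ^ 2 / 2 * ‖n‖ := by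
    rw [norm_smul, Real.norm_of_nonneg (by positivity)]
  have key := hR (((j : ℝ) ^ 2 / 2) • n) (mem_univ _) (by
    rw [hnorm]
    rw [div_lt_iff₀ hpos] at hjR
    nlinarith)
  rw [hnorm, show (|α 0| + |β 0| + |κ| + |κ'|) * 2 / ‖n‖ * ((j : ℝ) ^ 2 / 2 * ‖n‖) =
    (|α 0| + |β 0| + |κ| + |κ'|) * (j : ℝ) ^ 2 by field_simp] at key
  have k1 := hκ j
  have k2 := hκ' j
  have hq : (1 : ℝ) ≤ (j : ℝ) ^ 2 := by linarith
  have a1 : |α 0| ≤ |α 0| * (j : ℝ) ^ 2 := le_mul_of_one_le_right (abs_nonneg _) hq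
  have a2 : |β 0| ≤ |β 0| * (j : ℝ) ^ 2 := le_mul_of_one_le_right (abs_nonneg _) hq
  have b1 : κ * (j : ℝ) ^ 2 ≤ |κ| * (j : ℝ) ^ 2 := by gcongr; exact le_abs_self _
  have b2 : κ' * (j : ℝ) ^ 2 ≤ |κ'| * (j : ℝ) ^ 2 := by gcongr; exact le_abs_self _
  have c1 : 0 ≤ |κ| * (j : ℝ) ^ 2 := by positivity
  have c2 : 0 ≤ |κ'| * (j : ℝ) ^ 2 := by positivity
  have d1 := le_abs_self (α 0)
  have d2 := le_abs_self (β 0)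
  have d3 := abs_nonneg (α 0)
  have d4 := abs_nonneg (β 0)
  rcases lt_max_iff.1 key with k | k <;> linarith

theorem IsSym.totalDiff_iterate {A : W ≃ᵃ[ℝ] W} (hA : IsSym univ α β A 1 1) {w₀ : W}
    (hw : A w₀ = w₀) {u : ℕ → W} (hu : ∀ j, u (j + 1) = A.linear (u j)) (j : ℕ) :
    totalDiff α β w₀ (u j) = totalDiff α β w₀ (u 0) := by
  induction j with
  | zero => rfl
  | succ j ih =>
    have := hA.totalDiff_eq w₀ (u j)
    rw [hw, ← hu] at this
    rw [this, ih]

theorem ConvexPair.orbit_bounded [FiniteDimensional ℝ W] {K : Set W} {c c' : ℝ}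
    (h : ConvexPair univ α β K c c')
    {A : W ≃ᵃ[ℝ] W} (hA : IsSym univ α β A 1 1) {w₀ : W}
    (hw : A w₀ = w₀) {u : ℕ → W} (hu : ∀ j, u (j + 1) = A.linear (u j)) :
    ∃ R, ∀ j, ‖u j‖ ≤ R := by
  obtain ⟨R, hR⟩ := h.norm_bound_of_totalDiff w₀ (totalDiff α β w₀ (u 0))
  exact ⟨R, fun j => hR _ (hA.totalDiff_iterate hw hu j).le⟩

theorem ConvexPair.eq_zero_of_unipotent [FiniteDimensional ℝ W] {K : Set W} {c c' : ℝ}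
    (h : ConvexPair univ α β K c c')
    {A : W ≃ᵃ[ℝ] W} (hA : IsSym univ α β A 1 1) {w₀ : W}
    (hw : A w₀ = w₀) {u n : W} (hu : A.linear u = u + n) (hn : A.linear n = n) : n = 0 := by
  by_contra hn0
  have hpos : 0 < ‖n‖ := norm_pos_iff.2 hn0
  obtain ⟨R, hR⟩ := h.orbit_bounded hA hw (u := fun j => u + (j : ℝ) • n) (fun j => by
    simp only [map_add, map_smul, hu, hn]; push_cast; module)
  obtain ⟨j, hj⟩ := exists_nat_gt ((R + ‖u‖) / ‖n‖)
  rw [div_lt_iff₀ hpos] at hj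
  have h1 := norm_sub_norm_le ((j : ℝ) • n) (-u)
  rw [norm_neg, norm_smul, Real.norm_natCast, sub_neg_eq_add, add_comm _ u] at h1
  linarith [hR j]

theorem ConvexPair.eigenvalue_le_one [FiniteDimensional ℝ W] {K : Set W} {c c' : ℝ}
    (h : ConvexPair univ α β K c c')
    {A : W ≃ᵃ[ℝ] W} (hA : IsSym univ α β A 1 1) {w₀ : W}
    (hw : A w₀ = w₀) {u : W} (hu0 : u ≠ 0) {t : ℝ} (hu : A.linear u = t • u) : t ≤ 1 := by
  by_contra! ht
  have hpos : 0 < ‖u‖ := norm_pos_iff.2 hu0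
  obtain ⟨R, hR⟩ := h.orbit_bounded hA hw (u := fun j => t ^ j • u) (fun j => by
    simp only [map_smul, hu, smul_smul]; rw [pow_succ])
  obtain ⟨j, hj⟩ := pow_unbounded_of_one_lt (R / ‖u‖) ht
  rw [div_lt_iff₀ hpos] at hj
  have := hR j
  rw [norm_smul, Real.norm_of_nonneg (by positivity)] at this
  linarith

end Unipotent

section Plane

variable {α β : (Fin 2 → ℝ) → ℝ} {K : Set (Fin 2 → ℝ)} {c c' : ℝ}

/-- The matrix of the linear part of an affine transformation of the plane. -/
def linMat (A : (Fin 2 → ℝ) ≃ᵃ[ℝ] (Fin 2 → ℝ)) : Matrix (Fin 2) (Fin 2) ℝ :=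
  LinearMap.toMatrix' A.linear.toLinearMap

theorem linMat_mulVec (A : (Fin 2 → ℝ) ≃ᵃ[ℝ] (Fin 2 → ℝ)) (u : Fin 2 → ℝ) :
    linMat A *ᵥ u = A.linear u := LinearMap.toMatrix'_mulVec _ u

theorem linMat_mul (A B : (Fin 2 → ℝ) ≃ᵃ[ℝ] (Fin 2 → ℝ)) :
    linMat (A * B) = linMat A * linMat B :=
  LinearMap.toMatrix'_comp A.linear.toLinearMap B.linear.toLinearMap

theorem linMat_mul_inv (A : (Fin 2 → ℝ) ≃ᵃ[ℝ] (Fin 2 → ℝ)) : linMat A * linMat A⁻¹ = 1 := by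
  rw [← linMat_mul, mul_inv_cancel]
  exact LinearMap.toMatrix'_one

theorem linMat_inv (A : (Fin 2 → ℝ) ≃ᵃ[ℝ] (Fin 2 → ℝ)) : linMat A⁻¹ = (linMat A)⁻¹ :=
  (Matrix.inv_eq_right_inv (linMat_mul_inv A)).symm

theorem det_linMat_ne_zero (A : (Fin 2 → ℝ) ≃ᵃ[ℝ] (Fin 2 → ℝ)) : (linMat A).det ≠ 0 := by
  have := congrArg Matrix.det (linMat_mul_inv A)
  rw [Matrix.det_mul, Matrix.det_one] at this
  exact left_ne_zero_of_mul_eq_one this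

theorem det_linMat_commutator (A B : (Fin 2 → ℝ) ≃ᵃ[ℝ] (Fin 2 → ℝ)) :
    (linMat (A * B * A⁻¹ * B⁻¹)).det = 1 := by
  have h1 := congrArg Matrix.det (linMat_mul_inv A)
  have h2 := congrArg Matrix.det (linMat_mul_inv B)
  rw [Matrix.det_mul, Matrix.det_one] at h1 h2
  simp only [linMat_mul, Matrix.det_mul]
  linear_combination (linMat B).det * (linMat B⁻¹).det * h1 + h2

theorem linear_eq_of_linMat_eq_one {A : (Fin 2 → ℝ) ≃ᵃ[ℝ] (Fin 2 → ℝ)} (h : linMat A = 1)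
    (u : Fin 2 → ℝ) : A.linear u = u := by
  rw [← linMat_mulVec, h, Matrix.one_mulVec]

theorem exists_unique_fixed {A : (Fin 2 → ℝ) ≃ᵃ[ℝ] (Fin 2 → ℝ)} (h : (linMat A - 1).det ≠ 0) :
    ∃ w₀, A w₀ = w₀ ∧ ∀ w, A w = w → w = w₀ := by
  have hA : ∀ w, A w = A 0 + linMat A *ᵥ w := by
    intro w
    rw [linMat_mulVec, ← affineEquiv_add, zero_add]
  refine ⟨(linMat A - 1)⁻¹ *ᵥ (-A 0), ?_, fun w hw => ?_⟩
  · have : (linMat A - 1) *ᵥ ((linMat A - 1)⁻¹ *ᵥ (-A 0)) = -A 0 := by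
      rw [Matrix.mulVec_mulVec, Matrix.mul_nonsing_inv _ (Ne.isUnit h), Matrix.one_mulVec]
    rw [hA]
    generalize (linMat A - 1)⁻¹ *ᵥ (-A 0) = x at this ⊢
    rw [Matrix.sub_mulVec, Matrix.one_mulVec] at this
    rw [sub_eq_iff_eq_add.1 this]; abel
  · have : (linMat A - 1) *ᵥ w = -A 0 := by
      rw [Matrix.sub_mulVec, Matrix.one_mulVec]
      nth_rewrite 2 [← hw]
      rw [hA w]; abel
    rw [← this, Matrix.mulVec_mulVec, Matrix.nonsing_inv_mul _ (Ne.isUnit h), Matrix.one_mulVec]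

theorem det_sub_one (M : Matrix (Fin 2) (Fin 2) ℝ) : (M - 1).det = M.det + 1 - M.trace := by
  simp [Matrix.det_fin_two, Matrix.trace_fin_two]; ring

theorem ConvexPair.trace_le_two (h : ConvexPair univ α β K c c')
    {A : (Fin 2 → ℝ) ≃ᵃ[ℝ] (Fin 2 → ℝ)} (hA : IsSym univ α β A 1 1)
    (hdet : (linMat A).det = 1) : (linMat A).trace ≤ 2 := by
  by_contra! ht
  obtain ⟨w₀, hw, -⟩ := exists_unique_fixed (A := A) (by rw [det_sub_one, hdet]; linarith)
  set t := (linMat A).trace with htdef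
  have hs : 0 ≤ t ^ 2 - 4 := by nlinarith
  set r := (t + √(t ^ 2 - 4)) / 2 with hr
  have hr2 : r ^ 2 - t * r + 1 = 0 := by
    have := Real.sq_sqrt hs
    rw [hr]; linear_combination this / 4
  have hdet' : (linMat A - r • (1 : Matrix (Fin 2) (Fin 2) ℝ)).det = 0 := by
    rw [Matrix.det_fin_two] at hdet ⊢
    rw [Matrix.trace_fin_two] at htdef
    simp
    rw [htdef] at hr2
    linear_combination hr2 + hdet
  obtain ⟨u, hu0, hu⟩ := Matrix.exists_mulVec_eq_zero_iff.2 hdet'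
  rw [Matrix.sub_mulVec, Matrix.smul_mulVec, Matrix.one_mulVec, linMat_mulVec, sub_eq_zero] at hu
  have := h.eigenvalue_le_one hA hw hu0 hu
  have := Real.sqrt_nonneg (t ^ 2 - 4)
  linarith

theorem exists_solution_of_nilpotent {p q r v₀ v₁ : ℝ}
    (h1 : p * v₀ + q * v₁ = 0) (h2 : r * v₀ - p * v₁ = 0) (hne : q ≠ 0 ∨ r ≠ 0) :
    ∃ s t, p * s + q * t = -v₀ ∧ r * s - p * t = -v₁ := by
  rcases hne with hq | hr
  · refine ⟨0, -v₀ / q, by field_simp; ring, ?_⟩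
    field_simp
    linear_combination h1
  · refine ⟨-v₁ / r, 0, ?_, by field_simp; ring⟩
    field_simp
    linear_combination h2

theorem ConvexPair.linMat_eq_one (h : ConvexPair univ α β K c c')
    {A : (Fin 2 → ℝ) ≃ᵃ[ℝ] (Fin 2 → ℝ)} (hA : IsSym univ α β A 1 1)
    (hdet : (linMat A).det = 1) (ht : 2 ≤ (linMat A).trace) : linMat A = 1 := by
  have ht := le_antisymm (h.trace_le_two hA hdet) ht
  have hN : (linMat A - 1) * (linMat A - 1) = 0 := by
    rw [Matrix.det_fin_two] at hdet
    rw [Matrix.trace_fin_two] at ht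
    ext i j
    fin_cases i <;> fin_cases j <;> simp [Matrix.mul_apply, Fin.sum_univ_two]
    · linear_combination linMat A 0 0 * ht - hdet
    · linear_combination linMat A 0 1 * ht
    · linear_combination linMat A 1 0 * ht
    · linear_combination linMat A 1 1 * ht - hdet
  set N := linMat A - 1 with hNdef
  have hlin : ∀ u, A.linear u = u + N *ᵥ u := by
    intro u
    rw [hNdef, Matrix.sub_mulVec, Matrix.one_mulVec, linMat_mulVec]; abel
  have hNN : ∀ u, A.linear (N *ᵥ u) = N *ᵥ u := by
    intro u
    rw [hlin, Matrix.mulVec_mulVec, hN, Matrix.zero_mulVec, add_zero]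
  have hv := h.not_parabolic hA rfl (hlin (A 0)) (hNN _)
  by_contra hne
  have hNtr : N 1 1 = -N 0 0 := by
    rw [Matrix.trace_fin_two] at ht
    simp [hNdef]; linarith
  have hNsq : N 0 0 ^ 2 + N 0 1 * N 1 0 = 0 := by
    have := congrFun (congrFun hN 0) 0
    rw [Matrix.mul_apply, Fin.sum_univ_two, Matrix.zero_apply] at this
    linear_combination this
  have hqr : N 0 1 ≠ 0 ∨ N 1 0 ≠ 0 := by
    by_contra! hcon
    apply hne
    rw [← sub_eq_zero, ← hNdef]
    have h00 : N 0 0 = 0 := by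
      rw [hcon.1] at hNsq; simpa using hNsq
    ext i j
    fin_cases i <;> fin_cases j <;> simp [hNtr, h00, hcon.1, hcon.2]
  have e0 := congrFun hv 0
  have e1 := congrFun hv 1
  simp only [Matrix.mulVec, dotProduct, Fin.sum_univ_two, Pi.zero_apply, hNtr] at e0 e1
  obtain ⟨s, t, hs, ht'⟩ := exists_solution_of_nilpotent e0 (by linarith) hqr
  have hw : A ![s, t] = ![s, t] := by
    have h1 := affineEquiv_add A 0 ![s, t]
    rw [zero_add] at h1
    rw [h1, hlin]
    ext i
    fin_cases i <;> simp [hNtr] <;> linarith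
  have hzero : ∀ u, N *ᵥ u = 0 := fun u => h.eq_zero_of_unipotent hA hw (hlin u) (hNN u)
  apply hne
  rw [← sub_eq_zero, ← hNdef]
  exact Matrix.ext_of_mulVec_single fun i => by rw [hzero, Matrix.zero_mulVec]

end Plane

section FixedPoint

theorem mem_of_contraction_sub_mem {W : Type*} [NormedAddCommGroup W] [NormedSpace ℝ W]
    [FiniteDimensional ℝ W] (S : Submodule ℝ W) (L : W ≃ₗ[ℝ] W) (hL : ∀ v, L v ∈ S ↔ v ∈ S)
    (hc : ∀ v, ‖L v‖ ≤ 1 / 2 * ‖v‖) {z : W} (hz : L z - z ∈ S) : z ∈ S := by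
  let x : ℕ → W := fun n => n.rec z (fun _ x => L x)
  have hx : ∀ n, L (x n) - x n ∈ S ∧ z - x n ∈ S ∧ ‖x n‖ ≤ (1 / 2) ^ n * ‖z‖ := by
    intro n
    induction n with
    | zero => exact ⟨hz, by simp [x], by simp [x]⟩
    | succ n ih =>
      refine ⟨by simpa [x] using (hL _).2 ih.1, ?_, ?_⟩
      · have := S.sub_mem ih.2.1 ih.1
        rwa [sub_sub_sub_cancel_right] at this
      · calc _ ≤ 1 / 2 * ‖x n‖ := hc _
          _ ≤ 1 / 2 * ((1 / 2) ^ n * ‖z‖) := by gcongr; exact ih.2.2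
          _ = _ := by ring
  have hx0 : Tendsto x atTop (𝓝 0) := by
    apply squeeze_zero_norm (fun n => (hx n).2.2)
    simpa using (tendsto_pow_atTop_nhds_zero_of_lt_one (r := (1 / 2 : ℝ)) (by norm_num)
      (by norm_num)).mul_const ‖z‖
  have hlim : Tendsto (fun n => z - x n) atTop (𝓝 z) := by
    simpa using (tendsto_const_nhds (x := z)).sub hx0
  exact S.closed_of_finiteDimensional.mem_of_tendsto hlim (Eventually.of_forall fun n => (hx n).2.1)

theorem inv_of_det_eq_one {M : Matrix (Fin 2) (Fin 2) ℝ} (h : M.det = 1) :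
    M⁻¹ = !![M 1 1, -M 0 1; -M 1 0, M 0 0] := by
  rw [Matrix.inv_def, h, Ring.inverse_one, one_smul, Matrix.adjugate_fin_two]

theorem two_le_trace_commutator {M N : Matrix (Fin 2) (Fin 2) ℝ} (hM : M.det = 1) (hN : N.det = 1)
    (ht : M.trace ^ 2 < 4) : 2 ≤ (M * N * M⁻¹ * N⁻¹).trace := by
  rw [inv_of_det_eq_one hM, inv_of_det_eq_one hN]
  rw [Matrix.det_fin_two] at hM hN
  rw [Matrix.trace_fin_two] at ht
  simp only [Matrix.trace_fin_two, Matrix.mul_apply, Fin.sum_univ_two, Matrix.of_apply,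
    Matrix.cons_val', Matrix.cons_val_zero, Matrix.cons_val_one, Matrix.cons_val_fin_one]
  set p := (M 0 0 - M 1 1) / 2 with hp
  set p' := (N 0 0 - N 1 1) / 2 with hp'
  set X := M 0 1 * N 1 0 - M 1 0 * N 0 1 with hX
  set Y := p * N 0 1 - M 0 1 * p' with hY
  set Z := M 1 0 * p' - p * N 1 0 with hZ
  have hneg : p ^ 2 + M 0 1 * M 1 0 < 0 := by
    have : p ^ 2 + M 0 1 * M 1 0 = (M 0 0 + M 1 1) ^ 2 / 4 - 1 := by
      rw [hp]; linear_combination -hM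
    linarith
  have hrel : p * X = -(M 0 1 * Z + M 1 0 * Y) := by
    rw [hX, hY, hZ]; ring
  have hnn : 0 ≤ X ^ 2 + 4 * (Y * Z) := by
    by_cases hYZ : 0 ≤ Y * Z
    · positivity
    · push Not at hYZ
      have hp0 : p ≠ 0 := by
        intro h0
        rw [h0] at hneg hrel
        have h1 : M 0 1 * Z = -(M 1 0 * Y) := by linarith
        have h2 : 0 ≤ (M 0 1 * M 1 0) * (Y * Z) := by nlinarith
        have h3 : (M 0 1 * M 1 0) * (Y * Z) = -(M 1 0 * Y) ^ 2 := by
          linear_combination (M 1 0 * Y) * h1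
        have h4 : (M 0 1 * M 1 0) * (Y * Z) = 0 := by nlinarith [sq_nonneg (M 1 0 * Y)]
        rcases mul_eq_zero.1 h4 with h5 | h5
        · rw [h5] at hneg; norm_num at hneg
        · exact hYZ.ne h5
      have hpp : 0 < p ^ 2 := by positivity
      have key : p ^ 2 * (X ^ 2 + 4 * (Y * Z)) = (M 0 1 * Z - M 1 0 * Y) ^ 2 +
          4 * ((p ^ 2 + M 0 1 * M 1 0) * (Y * Z)) := by
        linear_combination (p * X - (M 0 1 * Z + M 1 0 * Y)) * hrel
      have := mul_pos_of_neg_of_neg hneg hYZ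
      by_contra! hlt
      nlinarith [sq_nonneg (M 0 1 * Z - M 1 0 * Y)]
  have hform : ∀ a b c d e f g h : ℝ, a * d - b * c = 1 → e * h - f * g = 1 →
      ((a * e + b * g) * d + (a * f + b * h) * -c) * h +
        ((a * e + b * g) * -b + (a * f + b * h) * a) * -g +
      (((c * e + d * g) * d + (c * f + d * h) * -c) * -f +
        ((c * e + d * g) * -b + (c * f + d * h) * a) * e) - 2 =
      (b * g - c * f) ^ 2 + 4 * (((a - d) / 2 * f - b * ((e - h) / 2)) *
        (c * ((e - h) / 2) - (a - d) / 2 * g)) := by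
    intro a b c d e f g h h1 h2
    linear_combination (2 * (e * h - f * g)) * h1 + 2 * h2
  have := hform _ _ _ _ _ _ _ _ hM hN
  rw [hX, hY, hZ, hp, hp'] at hnn
  linarith

variable {α β : (Fin 2 → ℝ) → ℝ} {K : Set (Fin 2 → ℝ)} {c c' : ℝ}

theorem det_linMat_sub_one_eq_zero {A : (Fin 2 → ℝ) ≃ᵃ[ℝ] (Fin 2 → ℝ)} {u : Fin 2 → ℝ}
    (hu : u ≠ 0) (hA : A.linear u = u) : (linMat A - 1).det = 0 :=
  Matrix.exists_mulVec_eq_zero_iff.1 ⟨u, hu, by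
    rw [Matrix.sub_mulVec, linMat_mulVec, hA, Matrix.one_mulVec, sub_self]⟩

theorem exists_smul_of_lineality_ne_top {S : Submodule ℝ (Fin 2 → ℝ)} (hS : S ≠ ⊤)
    {e : Fin 2 → ℝ} (he : e ∈ S) (he0 : e ≠ 0) {v : Fin 2 → ℝ} (hv : v ∈ S) :
    ∃ t : ℝ, v = t • e := by
  have h1 := Submodule.finrank_lt hS
  rw [Module.finrank_fin_fun] at h1
  obtain ⟨⟨x, hx⟩, h2⟩ := finrank_le_one_iff.1 (Nat.lt_succ_iff.1 h1)
  obtain ⟨s, hs⟩ := h2 ⟨e, he⟩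
  obtain ⟨t, ht⟩ := h2 ⟨v, hv⟩
  simp only [Subtype.ext_iff, Submodule.coe_smul] at hs ht
  have hs0 : s ≠ 0 := by
    rintro rfl
    rw [zero_smul] at hs
    exact he0 hs.symm
  exact ⟨t / s, by rw [← hs, ← ht, smul_smul, div_mul_cancel₀ _ hs0]⟩

theorem ConvexPair.commutator_linMat_eq_one (h : ConvexPair univ α β K c c')
    (hT : lineality (periodGroup α β) ≠ ⊤) {e : Fin 2 → ℝ}
    (he : e ∈ lineality (periodGroup α β)) (he0 : e ≠ 0)
    {A B : (Fin 2 → ℝ) ≃ᵃ[ℝ] (Fin 2 → ℝ)} {a b a' b' : ℝ}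
    (hA : IsSym univ α β A a b) (hB : IsSym univ α β B a' b') :
    linMat (A * B * A⁻¹ * B⁻¹) = 1 := by
  have hC := hA.commutator hB
  obtain ⟨s, hs⟩ := exists_smul_of_lineality_ne_top hT he he0 (hA.linear_mem_lineality.2 he)
  obtain ⟨t, ht⟩ := exists_smul_of_lineality_ne_top hT he he0 (hB.linear_mem_lineality.2 he)
  have hs0 : s ≠ 0 := by
    rintro rfl
    rw [zero_smul] at hs
    exact he0 (by simpa using hs)
  have ht0 : t ≠ 0 := by
    rintro rfl
    rw [zero_smul] at ht
    exact he0 (by simpa using ht)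
  have h1 : (A * B * A⁻¹ * B⁻¹).linear (B.linear (A.linear e)) = A.linear (B.linear e) := by
    rw [← affineEquiv_linear_mul, ← affineEquiv_linear_mul, ← affineEquiv_linear_mul]
    congr 2
    group
  rw [hs, ht, map_smul, map_smul, map_smul, hs, ht, map_smul, smul_smul, smul_smul,
    mul_comm t s] at h1
  have h2 : (A * B * A⁻¹ * B⁻¹).linear e = e := smul_right_injective _ (mul_ne_zero hs0 ht0) h1
  have h3 := det_linMat_sub_one_eq_zero he0 h2
  have hdet := det_linMat_commutator A B
  rw [det_sub_one, hdet] at h3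
  exact h.linMat_eq_one hC hdet (by linarith)

theorem ConvexPair.trace_sq_lt_or (h : ConvexPair univ α β K c c')
    {A : (Fin 2 → ℝ) ≃ᵃ[ℝ] (Fin 2 → ℝ)} (hA : IsSym univ α β A 1 1)
    (hdet : (linMat A).det = 1) (hne : linMat A ≠ 1) :
    (linMat A).trace ^ 2 < 4 ∨ linMat A = -1 := by
  have ht : (linMat A).trace < 2 := by
    by_contra! hcon
    exact hne (h.linMat_eq_one hA hdet hcon)
  by_cases hlt : (linMat A).trace ^ 2 < 4
  · exact Or.inl hlt
  right
  have hA2 := hA.mul hA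
  rw [one_mul] at hA2
  have h1 := h.linMat_eq_one hA2 (by rw [linMat_mul, Matrix.det_mul, hdet, one_mul]) (by
    rw [linMat_mul, Matrix.trace_fin_two, Matrix.mul_apply, Matrix.mul_apply, Fin.sum_univ_two,
      Fin.sum_univ_two]
    rw [Matrix.trace_fin_two] at hlt
    rw [Matrix.det_fin_two] at hdet
    nlinarith)
  rw [linMat_mul] at h1
  have e := fun i j => congrFun (congrFun h1 i) j
  simp only [Matrix.mul_apply, Fin.sum_univ_two] at e
  have e00 := e 0 0
  have e01 := e 0 1
  have e10 := e 1 0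
  have e11 := e 1 1
  simp only [Matrix.one_apply_eq, ne_eq, zero_ne_one, one_ne_zero, not_false_eq_true,
    Matrix.one_apply_ne] at e00 e01 e10 e11
  rw [Matrix.trace_fin_two] at ht hlt
  rw [Matrix.det_fin_two] at hdet
  generalize linMat A = M at *
  have t0 : M 0 0 + M 1 1 ≠ 0 := by
    intro h0
    rw [h0] at hlt
    norm_num at hlt
  have b0 : M 0 1 = 0 := by
    have : (M 0 0 + M 1 1) * M 0 1 = 0 := by linear_combination e01
    exact (mul_eq_zero.1 this).resolve_left t0
  have c0 : M 1 0 = 0 := by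
    have : (M 0 0 + M 1 1) * M 1 0 = 0 := by linear_combination e10
    exact (mul_eq_zero.1 this).resolve_left t0
  rw [b0] at e00 e11 hdet
  have ad : M 0 0 = M 1 1 := by
    apply mul_left_cancel₀ t0
    linear_combination e00 - e11
  have h3 : M 0 0 = -1 := by
    have : (M 0 0 - 1) * (M 0 0 + 1) = 0 := by linear_combination e00
    rcases mul_eq_zero.1 this with h4 | h4 <;> linarith
  ext i j
  fin_cases i <;> fin_cases j <;> simp [b0, c0, h3, ← ad]

theorem ConvexPair.periods_eq_top (h : ConvexPair univ α β K c c') :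
    lineality (periodGroup α β) = ⊤ := by
  by_contra hT
  obtain ⟨H, a, b, hH, -, hHc⟩ := h.exists_contraction (mem_univ 0) (ε := 1 / 2) (by norm_num)
  have hHdet : (linMat H - 1).det ≠ 0 := by
    intro h0
    obtain ⟨u, hu0, hu⟩ := Matrix.exists_mulVec_eq_zero_iff.2 h0
    rw [Matrix.sub_mulVec, linMat_mulVec, Matrix.one_mulVec, sub_eq_zero] at hu
    have := hHc u
    rw [hu] at this
    linarith [norm_pos_iff.2 hu0]
  by_cases hall : ∀ (B : (Fin 2 → ℝ) ≃ᵃ[ℝ] (Fin 2 → ℝ)) (a b : ℝ), IsSym univ α β B a b →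
      linMat (H * B * H⁻¹ * B⁻¹) = 1
  · obtain ⟨w₀, hw, -⟩ := exists_unique_fixed hHdet
    refine hT (h.lineality_eq_top (w₀ := w₀) fun B a' b' hB => ?_)
    have h1 := h.mem_lineality ((hH.commutator hB).sub_mem_periodGroup
      (linear_eq_of_linMat_eq_one (hall B a' b' hB)) (B w₀))
    have h2 : (H * B * H⁻¹ * B⁻¹) (B w₀) = H (B w₀) := by
      have e : H⁻¹ w₀ = w₀ := by
        nth_rewrite 1 [← hw]; exact H.symm_apply_apply w₀
      have e' : B⁻¹ (B w₀) = w₀ := B.symm_apply_apply w₀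
      simp only [AffineEquiv.coe_mul, Function.comp, e', e]
    rw [h2] at h1
    apply mem_of_contraction_sub_mem _ H.linear (fun v => hH.linear_mem_lineality) hHc
    have h3 := affineEquiv_add H w₀ (B w₀ - w₀)
    rw [add_sub_cancel, hw] at h3
    rw [h3] at h1
    convert h1 using 1
    abel
  push Not at hall
  obtain ⟨B, a', b', hB, hne⟩ := hall
  have hbot : ∀ v ∈ lineality (periodGroup α β), v = 0 := by
    intro v hv
    by_contra hv0
    exact hne (h.commutator_linMat_eq_one hT hv hv0 hH hB)
  have htriv : ∀ X : (Fin 2 → ℝ) ≃ᵃ[ℝ] (Fin 2 → ℝ), IsSym univ α β X 1 1 → linMat X = 1 →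
      ∀ w, X w = w := by
    intro X hX h1 w
    exact sub_eq_zero.1
      (hbot _ (h.mem_lineality (hX.sub_mem_periodGroup (linear_eq_of_linMat_eq_one h1) w)))
  have hC := hH.commutator hB
  have hdet := det_linMat_commutator H B
  generalize H * B * H⁻¹ * B⁻¹ = C at hne hC hdet
  have hfix : (linMat C - 1).det ≠ 0 := by
    intro h0
    rw [det_sub_one, hdet] at h0
    exact hne (h.linMat_eq_one hC hdet (by linarith))
  obtain ⟨w₀, hw, huniq⟩ := exists_unique_fixed hfix
  refine hT (h.lineality_eq_top (w₀ := w₀) fun g s t hg => ?_)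
  have hD := hC.conj hg
  have hDdet : (linMat (g * C * g⁻¹)).det = 1 := by
    rw [linMat_mul, linMat_mul, Matrix.det_mul, Matrix.det_mul, hdet, mul_one, ← Matrix.det_mul,
      linMat_mul_inv, Matrix.det_one]
  have hinv : g⁻¹ (g w₀) = w₀ := g.symm_apply_apply w₀
  have hgg : ∀ w, g (g⁻¹ w) = w := fun w => g.apply_symm_apply w
  have hgD : ∀ w, (g * C * g⁻¹) w = g (C (g⁻¹ w)) := fun w => rfl
  generalize g * C * g⁻¹ = D at hD hDdet hgD
  have hE := hC.commutator hD
  have hEdet := det_linMat_commutator C D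
  have hE1 : linMat (C * D * C⁻¹ * D⁻¹) = 1 := by
    apply h.linMat_eq_one hE hEdet
    rw [linMat_mul, linMat_mul, linMat_mul, linMat_inv, linMat_inv]
    rcases h.trace_sq_lt_or hC hdet hne with hlt | hneg
    · exact two_le_trace_commutator hdet hDdet hlt
    · have e : (-1 : Matrix (Fin 2) (Fin 2) ℝ)⁻¹ = -1 := Matrix.inv_eq_right_inv (by simp)
      rw [hneg, e, neg_one_mul, mul_neg, mul_one, neg_neg,
        Matrix.mul_nonsing_inv _ (by rw [hDdet]; exact isUnit_one), Matrix.trace_one]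
      norm_num
  have hcomm : C (D w₀) = D (C w₀) := by
    have h1 := htriv _ hE hE1 (D (C w₀))
    have e1 : D⁻¹ (D (C w₀)) = C w₀ := D.symm_apply_apply _
    have e2 : C⁻¹ (C w₀) = w₀ := C.symm_apply_apply _
    simpa only [AffineEquiv.coe_mul, Function.comp, e1, e2] using h1
  rw [hw] at hcomm
  have h1 : D w₀ = w₀ := huniq _ hcomm
  rw [hgD] at h1
  have h2 : C (g⁻¹ w₀) = g⁻¹ w₀ := by
    have : g⁻¹ (g (C (g⁻¹ w₀))) = C (g⁻¹ w₀) := g.symm_apply_apply _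
    rw [← this, h1]
  have h3 := huniq _ h2
  have h4 : g w₀ = w₀ := by
    nth_rewrite 1 [← h3]; exact hgg w₀
  rw [h4, sub_self]
  exact Submodule.zero_mem _

end FixedPoint

section Quadratic

theorem exists_quadratic {φ : (Fin 2 → ℝ) → ℝ} (hc : Continuous φ)
    (hφ : ∀ w v u, secondDiff φ (w + v) u = secondDiff φ w u) :
    ∃ a b c d e f : ℝ, ∀ v, φ v = (a * v 0 ^ 2 + 2 * b * (v 0 * v 1) + c * v 1 ^ 2) +
      (d * v 0 + e * v 1 + f) := by
  have hmid : ∀ x y, φ x + φ y = 2 * φ ((1 / 2 : ℝ) • (x + y)) +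
      secondDiff φ 0 ((1 / 2 : ℝ) • (x - y)) := by
    intro x y
    have h1 := hφ 0 ((1 / 2 : ℝ) • (x + y)) ((1 / 2 : ℝ) • (x - y))
    rw [← h1, zero_add]
    unfold secondDiff
    rw [show (1 / 2 : ℝ) • (x + y) + (1 / 2 : ℝ) • (x - y) = x by module,
      show (1 / 2 : ℝ) • (x + y) - (1 / 2 : ℝ) • (x - y) = y by module]
    ring
  set B : (Fin 2 → ℝ) → (Fin 2 → ℝ) → ℝ := fun u v => φ (u + v) - φ u - φ v + φ 0 with hB
  have hadd : ∀ u v w, B u (v + w) = B u v + B u w := by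
    intro u v w
    have h1 := hmid (u + v) (u + w)
    have h2 := hmid v w
    have h3 := hmid (u + (v + w)) u
    have h4 := hmid (v + w) 0
    rw [show (1 / 2 : ℝ) • (u + v + (u + w)) = u + (1 / 2 : ℝ) • (v + w) by module,
      show u + v - (u + w) = v - w by abel] at h1
    rw [show (1 / 2 : ℝ) • (u + (v + w) + u) = u + (1 / 2 : ℝ) • (v + w) by module,
      show u + (v + w) - u = v + w by abel] at h3
    rw [add_zero, sub_zero] at h4
    simp only [hB]
    linarith
  have hcont : ∀ u, Continuous (B u) := by
    intro u; simp only [hB]; fun_prop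
  have hsmul : ∀ u v (t : ℝ), B u (t • v) = t * B u v := fun u v t =>
    map_real_smul (AddMonoidHom.mk' (B u) (hadd u)) (hcont u) t v
  have hsymm : ∀ u v, B u v = B v u := by
    intro u v; simp only [hB]; rw [add_comm u v]; ring
  set ψ : (Fin 2 → ℝ) → ℝ := fun v => φ v - φ 0 - 1 / 2 * B v v with hψ
  have hψadd : ∀ u v, ψ (u + v) = ψ u + ψ v := by
    intro u v
    have h1 : B (u + v) (u + v) = B u u + 2 * B u v + B v v := by
      rw [hadd, hsymm (u + v), hsymm (u + v), hadd, hadd, hsymm v u]; ring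
    simp only [hψ]
    rw [h1]
    simp only [hB]
    ring
  have hψc : Continuous ψ := by
    simp only [hψ, hB]; fun_prop
  have hψsmul : ∀ v (t : ℝ), ψ (t • v) = t * ψ v := fun v t =>
    map_real_smul (AddMonoidHom.mk' ψ hψadd) hψc t v
  have hdec : ∀ v : Fin 2 → ℝ, v = v 0 • ![1, 0] + v 1 • ![0, 1] := by
    intro v; ext i; fin_cases i <;> simp
  refine ⟨1 / 2 * B ![1, 0] ![1, 0], 1 / 2 * B ![1, 0] ![0, 1], 1 / 2 * B ![0, 1] ![0, 1],
    ψ ![1, 0], ψ ![0, 1], φ 0, fun v => ?_⟩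
  have h1 : φ v = 1 / 2 * B v v + ψ v + φ 0 := by simp only [hψ]; ring
  have h2 : ψ v = v 0 * ψ ![1, 0] + v 1 * ψ ![0, 1] := by
    conv_lhs => rw [hdec v]
    rw [hψadd, hψsmul, hψsmul]
  have h3 : ∀ u, B u v = v 0 * B u ![1, 0] + v 1 * B u ![0, 1] := by
    intro u
    conv_lhs => rw [hdec v]
    rw [hadd, hsmul, hsmul]
  rw [h1, h2, h3 v, hsymm v, hsymm v, h3, h3, hsymm ![0, 1] ![1, 0]]
  ring

theorem secondDiff_quadratic {φ : (Fin 2 → ℝ) → ℝ} {a b c d e f : ℝ}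
    (hφ : ∀ v, φ v = (a * v 0 ^ 2 + 2 * b * (v 0 * v 1) + c * v 1 ^ 2) +
      (d * v 0 + e * v 1 + f)) (w u : Fin 2 → ℝ) :
    secondDiff φ w u = 2 * (a * u 0 ^ 2 + 2 * b * (u 0 * u 1) + c * u 1 ^ 2) := by
  simp only [secondDiff, hφ, Pi.add_apply, Pi.sub_apply]
  ring

theorem coeff_nonneg_of_forall_nonneg {a b c : ℝ}
    (h : ∀ x y : ℝ, 0 ≤ a * x ^ 2 + 2 * b * (x * y) + c * y ^ 2) :
    0 ≤ a ∧ 0 ≤ c ∧ b ^ 2 ≤ a * c := by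
  have ha : 0 ≤ a := by simpa using h 1 0
  have hc : 0 ≤ c := by simpa using h 0 1
  refine ⟨ha, hc, ?_⟩
  rcases ha.eq_or_lt with h0 | hpos
  · have h1 := h (-(b * (c + 1))) (b ^ 2)
    have h2 : b ^ 4 * (c + 2) ≤ 0 := by
      rw [← h0] at h1; nlinarith
    have h3 : b ^ 4 = 0 := by
      have : 0 ≤ b ^ 4 := by positivity
      nlinarith
    have h4 : b = 0 := by simpa using h3
    rw [h4, ← h0]; simp
  · have h1 := h (-b) a
    have h2 : 0 ≤ a * (a * c - b ^ 2) := by linarith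
    nlinarith [nonneg_of_mul_nonneg_right h2 hpos]

theorem eq_zero_of_mixed_eq_zero {a b c a' b' c' : ℝ} (ha : 0 ≤ a) (hc : 0 ≤ c)
    (hdet : b ^ 2 < a * c) (ha' : 0 ≤ a') (hc' : 0 ≤ c') (hdet' : a' * c' - b' ^ 2 = 0)
    (hmix : a * c' + c * a' - 2 * b * b' = 0) : a' = 0 ∧ b' = 0 ∧ c' = 0 := by
  have hac : 0 < a * c := lt_of_le_of_lt (sq_nonneg b) hdet
  have ha0 : 0 < a := ha.lt_of_ne (by rintro rfl; simp at hac)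
  have hc0 : 0 < c := hc.lt_of_ne (by rintro rfl; simp at hac)
  have h1 : (a * c - b ^ 2) * (a' * c') ≤ 0 := by
    have h2 : (a * c' + c * a') ^ 2 = 4 * b ^ 2 * (a' * c') := by
      linear_combination (a * c' + c * a' + 2 * b * b') * hmix - 4 * b ^ 2 * hdet'
    nlinarith [sq_nonneg (a * c' - c * a')]
  have h3 : a' * c' = 0 := by
    have := mul_nonneg ha' hc'
    nlinarith
  have hb : b' = 0 := by
    have : b' ^ 2 = 0 := by linarith
    simpa using this
  rw [hb] at hmix
  have h4 : 0 ≤ a * c' := by positivity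
  have h5 : 0 ≤ c * a' := by positivity
  have h6 : a * c' = 0 := by linarith
  have h7 : c * a' = 0 := by linarith
  exact ⟨(mul_eq_zero.1 h7).resolve_left hc0.ne', hb, (mul_eq_zero.1 h6).resolve_left ha0.ne'⟩

theorem exists_sq_of_det_eq_zero {a b c : ℝ} (ha : 0 ≤ a) (hc : 0 ≤ c) (h : a * c - b ^ 2 = 0) :
    ∃ x y : ℝ, a = x ^ 2 ∧ b = x * y ∧ c = y ^ 2 := by
  rcases ha.eq_or_lt with h0 | hpos
  · refine ⟨0, √c, by simp [← h0], ?_, (Real.sq_sqrt hc).symm⟩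
    rw [← h0] at h
    have : b ^ 2 = 0 := by linarith
    simpa using this
  · have hs : √a ≠ 0 := (Real.sqrt_pos.2 hpos).ne'
    refine ⟨√a, b / √a, (Real.sq_sqrt ha).symm, by field_simp, ?_⟩
    rw [div_pow, Real.sq_sqrt ha, eq_div_iff hpos.ne']
    linarith

theorem exists_sum_sq_of_det_pos {a b c : ℝ} (ha : 0 ≤ a) (h : b ^ 2 < a * c) :
    ∃ x y y' : ℝ, x * y' ≠ 0 ∧ a = x ^ 2 ∧ b = x * y ∧ c = y ^ 2 + y' ^ 2 := by
  have hac : 0 < a * c := lt_of_le_of_lt (sq_nonneg b) h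
  have ha0 : 0 < a := ha.lt_of_ne (by rintro rfl; simp at hac)
  have hs : √a ≠ 0 := (Real.sqrt_pos.2 ha0).ne'
  have hpos : 0 < c - b ^ 2 / a := by
    rw [sub_pos, div_lt_iff₀ ha0]; linarith
  refine ⟨√a, b / √a, √(c - b ^ 2 / a), mul_ne_zero hs (Real.sqrt_pos.2 hpos).ne',
    (Real.sq_sqrt ha).symm, by field_simp, ?_⟩
  rw [div_pow, Real.sq_sqrt ha, Real.sq_sqrt hpos.le]
  ring

theorem pencil_trichotomy {a b c a' b' c' m n k l s t : ℝ} (hs : 0 < s) (ht : 0 < t) (hst : s ≠ t)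
    (hD : m * l - n * k ≠ 0)
    (ha : a * m ^ 2 + 2 * b * (m * k) + c * k ^ 2 = s * a)
    (hb : a * (m * n) + b * (m * l + n * k) + c * (k * l) = s * b)
    (hc : a * n ^ 2 + 2 * b * (n * l) + c * l ^ 2 = s * c)
    (ha' : a' * m ^ 2 + 2 * b' * (m * k) + c' * k ^ 2 = t * a')
    (hb' : a' * (m * n) + b' * (m * l + n * k) + c' * (k * l) = t * b')
    (hc' : a' * n ^ 2 + 2 * b' * (n * l) + c' * l ^ 2 = t * c') :
    (a' * c' - b' ^ 2 = 0 ∧ a * c' + c * a' - 2 * b * b' = 0) ∨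
      (a * c - b ^ 2 = 0 ∧ a * c' + c * a' - 2 * b * b' = 0) ∨
      (a * c - b ^ 2 = 0 ∧ a' * c' - b' ^ 2 = 0) := by
  have hD2 : 0 < (m * l - n * k) ^ 2 := by positivity
  set δ := (m * l - n * k) ^ 2 with hδ
  have e0 : (s ^ 2 - δ) * (a * c - b ^ 2) = 0 := by
    have : (s * a) * (s * c) - (s * b) ^ 2 = δ * (a * c - b ^ 2) := by
      rw [← ha, ← hb, ← hc, hδ]; ring
    linear_combination this
  have e1 : (s * t - δ) * (a * c' + c * a' - 2 * b * b') = 0 := by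
    have : (s * a) * (t * c') + (s * c) * (t * a') - 2 * (s * b) * (t * b') =
        δ * (a * c' + c * a' - 2 * b * b') := by
      rw [← ha, ← hb, ← hc, ← ha', ← hb', ← hc', hδ]; ring
    linear_combination this
  have e2 : (t ^ 2 - δ) * (a' * c' - b' ^ 2) = 0 := by
    have : (t * a') * (t * c') - (t * b') ^ 2 = δ * (a' * c' - b' ^ 2) := by
      rw [← ha', ← hb', ← hc', hδ]; ring
    linear_combination this
  have hst' : s - t ≠ 0 := sub_ne_zero.2 hst
  rcases mul_eq_zero.1 e0 with h0 | h0
  · left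
    constructor
    · refine (mul_eq_zero.1 e2).resolve_left fun h2 => ?_
      have : (s - t) * (s + t) = 0 := by linear_combination h0 - h2
      exact mul_ne_zero hst' (by positivity) this
    · refine (mul_eq_zero.1 e1).resolve_left fun h1 => ?_
      have : (s - t) * s = 0 := by linear_combination h0 - h1
      exact mul_ne_zero hst' hs.ne' this
  · right
    rcases mul_eq_zero.1 e1 with h1 | h1
    · right
      refine ⟨h0, (mul_eq_zero.1 e2).resolve_left fun h2 => ?_⟩
      have : (s - t) * t = 0 := by linear_combination h1 - h2
      exact mul_ne_zero hst' ht.ne' this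
    · exact Or.inl ⟨h0, h1⟩

/-- The pair is, up to affine functions, a positive definite form and zero. -/
def IsParaboloid (α β : (Fin 2 → ℝ) → ℝ) : Prop :=
  ∃ x y x' y' d e f d' e' f' : ℝ, x * y' - x' * y ≠ 0 ∧
    (∀ v, α v = (x * v 0 + y * v 1) ^ 2 + (x' * v 0 + y' * v 1) ^ 2 +
      (d * v 0 + e * v 1 + f)) ∧ ∀ v, β v = d' * v 0 + e' * v 1 + f'

/-- The pair is, up to affine functions, given by the squares of two coordinates. -/
def IsParabolaPair (α β : (Fin 2 → ℝ) → ℝ) : Prop :=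
  ∃ x y x' y' d e f d' e' f' : ℝ, x * y' - x' * y ≠ 0 ∧
    (∀ v, α v = (x * v 0 + y * v 1) ^ 2 + (d * v 0 + e * v 1 + f)) ∧
    ∀ v, β v = (x' * v 0 + y' * v 1) ^ 2 + (d' * v 0 + e' * v 1 + f')

theorem isParaboloid_of_mixed_eq_zero {α β : (Fin 2 → ℝ) → ℝ} {a b c a' b' c' d e f d' e' f' : ℝ}
    (hα : ∀ v, α v = (a * v 0 ^ 2 + 2 * b * (v 0 * v 1) + c * v 1 ^ 2) +
      (d * v 0 + e * v 1 + f))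
    (hβ : ∀ v, β v = (a' * v 0 ^ 2 + 2 * b' * (v 0 * v 1) + c' * v 1 ^ 2) +
      (d' * v 0 + e' * v 1 + f'))
    (ha : 0 ≤ a) (hc : 0 ≤ c)
    (hdet : b ^ 2 < a * c) (ha' : 0 ≤ a') (hc' : 0 ≤ c') (hdet' : a' * c' - b' ^ 2 = 0)
    (hmix : a * c' + c * a' - 2 * b * b' = 0) : IsParaboloid α β := by
  obtain ⟨x, y, y', hne, rfl, rfl, rfl⟩ := exists_sum_sq_of_det_pos ha hdet
  obtain ⟨rfl, rfl, rfl⟩ := eq_zero_of_mixed_eq_zero ha hc hdet ha' hc' hdet' hmix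
  refine ⟨x, y, 0, y', d, e, f, d', e', f', by simpa using hne, fun v => ?_, fun v => ?_⟩
  · rw [hα]; ring
  · rw [hβ]; ring

variable {α β : (Fin 2 → ℝ) → ℝ} {K : Set (Fin 2 → ℝ)} {c c' : ℝ}

theorem ConvexPair.exists_unbalanced (h : ConvexPair univ α β K c c') :
    ∃ (A : (Fin 2 → ℝ) ≃ᵃ[ℝ] (Fin 2 → ℝ)) (s t : ℝ), IsSym univ α β A s t ∧ s ≠ t := by
  have hc := h.pos
  obtain ⟨A, s, t, hA, -, hs, ht⟩ := h.cocompact 0 (mem_univ _) 1 ((|c'| + 1) / c) one_pos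
    (by positivity)
  refine ⟨A, s, t, hA, ?_⟩
  rintro rfl
  have h1 : c * ((|c'| + 1) / c) ≤ s * ((|c'| + 1) / c) := by
    gcongr; simpa using hs.1
  rw [mul_div_cancel₀ _ hc.ne'] at h1
  linarith [ht.2, le_abs_self c']

theorem midAffine_of_form_eq_zero {φ : (Fin 2 → ℝ) → ℝ} {a b c d e f : ℝ}
    (hφ : ∀ v, φ v = (a * v 0 ^ 2 + 2 * b * (v 0 * v 1) + c * v 1 ^ 2) +
      (d * v 0 + e * v 1 + f)) {u : Fin 2 → ℝ}
    (hu : a * u 0 ^ 2 + 2 * b * (u 0 * u 1) + c * u 1 ^ 2 = 0) : MidAffine univ φ 0 u := by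
  intro s t _ _
  simp only [hφ, Pi.add_apply, Pi.smul_apply, Pi.zero_apply, smul_eq_mul]
  linear_combination ((s - t) ^ 2 / 2) * hu

theorem ConvexPair.normal_form (h : ConvexPair univ α β K c c') :
    IsParaboloid α β ∨ IsParaboloid β α ∨ IsParabolaPair α β := by
  have hT := h.periods_eq_top
  have hper : ∀ w v u, secondDiff α (w + v) u = secondDiff α w u ∧
      secondDiff β (w + v) u = secondDiff β w u := by
    intro w v u
    have hv : v ∈ lineality (periodGroup α β) := by rw [hT]; exact Submodule.mem_top
    exact mem_periodGroup.1 (mem_of_mem_lineality hv) w u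
  obtain ⟨a₁, b₁, c₁, d₁, e₁, f₁, hα⟩ := exists_quadratic h.continuous_left
    fun w v u => (hper w v u).1
  obtain ⟨a₂, b₂, c₂, d₂, e₂, f₂, hβ⟩ := exists_quadratic h.continuous_right
    fun w v u => (hper w v u).2
  have hp₁ : ∀ x y : ℝ, 0 ≤ a₁ * x ^ 2 + 2 * b₁ * (x * y) + c₁ * y ^ 2 := by
    intro x y
    have := secondDiff_nonneg h.convex_left 0 ![x, y]
    rw [secondDiff_quadratic hα] at this
    simpa using this
  have hp₂ : ∀ x y : ℝ, 0 ≤ a₂ * x ^ 2 + 2 * b₂ * (x * y) + c₂ * y ^ 2 := by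
    intro x y
    have := secondDiff_nonneg h.convex_right 0 ![x, y]
    rw [secondDiff_quadratic hβ] at this
    simpa using this
  obtain ⟨ha₁, hc₁, hd₁⟩ := coeff_nonneg_of_forall_nonneg hp₁
  obtain ⟨ha₂, hc₂, hd₂⟩ := coeff_nonneg_of_forall_nonneg hp₂
  have hdef : ∀ x y : ℝ, a₁ * x ^ 2 + 2 * b₁ * (x * y) + c₁ * y ^ 2 = 0 →
      a₂ * x ^ 2 + 2 * b₂ * (x * y) + c₂ * y ^ 2 = 0 → x = 0 ∧ y = 0 := by
    intro x y h1 h2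
    by_contra hne
    refine h.not_midAffine (mem_univ 0) (u := ![x, y]) ?_
      (midAffine_of_form_eq_zero hα (by simpa using h1))
      (midAffine_of_form_eq_zero hβ (by simpa using h2))
    intro h0
    exact hne ⟨by simpa using congrFun h0 0, by simpa using congrFun h0 1⟩
  have hsum : (b₁ + b₂) ^ 2 < (a₁ + a₂) * (c₁ + c₂) := by
    have hzero : ∀ x y : ℝ, (a₁ + a₂) * x ^ 2 + 2 * (b₁ + b₂) * (x * y) + (c₁ + c₂) * y ^ 2 = 0 →
        x = 0 ∧ y = 0 := by
      intro x y hxy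
      have h1 := hp₁ x y
      have h2 := hp₂ x y
      exact hdef x y (by linarith) (by linarith)
    obtain ⟨-, -, hle⟩ := coeff_nonneg_of_forall_nonneg (a := a₁ + a₂) (b := b₁ + b₂)
      (c := c₁ + c₂) (fun x y => by linarith [hp₁ x y, hp₂ x y])
    refine hle.lt_of_ne fun heq => ?_
    obtain ⟨h1, h2⟩ := hzero (-(b₁ + b₂)) (a₁ + a₂) (by linear_combination -(a₁ + a₂) * heq)
    have := (hzero 1 0 (by linear_combination h2)).1
    norm_num at this
  obtain ⟨A, s, t, hA, hst⟩ := h.exists_unbalanced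
  have hform₁ : ∀ x y : ℝ, a₁ * (linMat A 0 0 * x + linMat A 0 1 * y) ^ 2 +
      2 * b₁ * ((linMat A 0 0 * x + linMat A 0 1 * y) * (linMat A 1 0 * x + linMat A 1 1 * y)) +
      c₁ * (linMat A 1 0 * x + linMat A 1 1 * y) ^ 2 =
      s * (a₁ * x ^ 2 + 2 * b₁ * (x * y) + c₁ * y ^ 2) := by
    intro x y
    have := (hA.secondDiff_eq 0 ![x, y]).1
    rw [secondDiff_quadratic hα, secondDiff_quadratic hα, ← linMat_mulVec] at this
    simp [Matrix.mulVec, dotProduct, Fin.sum_univ_two] at this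
    linarith
  have hform₂ : ∀ x y : ℝ, a₂ * (linMat A 0 0 * x + linMat A 0 1 * y) ^ 2 +
      2 * b₂ * ((linMat A 0 0 * x + linMat A 0 1 * y) * (linMat A 1 0 * x + linMat A 1 1 * y)) +
      c₂ * (linMat A 1 0 * x + linMat A 1 1 * y) ^ 2 =
      t * (a₂ * x ^ 2 + 2 * b₂ * (x * y) + c₂ * y ^ 2) := by
    intro x y
    have := (hA.secondDiff_eq 0 ![x, y]).2
    rw [secondDiff_quadratic hβ, secondDiff_quadratic hβ, ← linMat_mulVec] at this
    simp [Matrix.mulVec, dotProduct, Fin.sum_univ_two] at this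
    linarith
  have hD := det_linMat_ne_zero A
  rw [Matrix.det_fin_two] at hD
  have htri := pencil_trichotomy (a := a₁) (b := b₁) (c := c₁) (a' := a₂) (b' := b₂) (c' := c₂)
    hA.left_pos hA.right_pos hst hD
    (by linear_combination hform₁ 1 0)
    (by linear_combination (hform₁ 1 1 - hform₁ 1 0 - hform₁ 0 1) / 2)
    (by linear_combination hform₁ 0 1)
    (by linear_combination hform₂ 1 0)
    (by linear_combination (hform₂ 1 1 - hform₂ 1 0 - hform₂ 0 1) / 2)
    (by linear_combination hform₂ 0 1)
  rcases htri with ⟨h2, hm⟩ | ⟨h1, hm⟩ | ⟨h1, h2⟩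
  · exact Or.inl (isParaboloid_of_mixed_eq_zero hα hβ ha₁ hc₁ (by linarith) ha₂ hc₂ h2 hm)
  · exact Or.inr (Or.inl (isParaboloid_of_mixed_eq_zero hβ hα ha₂ hc₂ (by linarith) ha₁ hc₁ h1
      (by linarith)))
  · obtain ⟨x, y, rfl, rfl, rfl⟩ := exists_sq_of_det_eq_zero ha₁ hc₁ h1
    obtain ⟨x', y', rfl, rfl, rfl⟩ := exists_sq_of_det_eq_zero ha₂ hc₂ h2
    refine Or.inr (Or.inr ⟨x, y, x', y', d₁, e₁, f₁, d₂, e₂, f₂, ?_, fun v => ?_, fun v => ?_⟩)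
    · intro h0
      have : (x * y' - x' * y) ^ 2 = 0 := by rw [h0]; norm_num
      nlinarith
    · rw [hα]; ring
    · rw [hβ]; ring

end Quadratic

section RecessionCone

variable {E : Type*} [NormedAddCommGroup E] [NormedSpace ℝ E]

/-- The recession (asymptotic) cone of a set. -/
def recCone (Ω : Set E) : Set E := {u | ∀ x ∈ Ω, ∀ t : ℝ, 0 ≤ t → x + t • u ∈ Ω}

variable {Ω : Set E}

theorem mem_recCone_of_tendsto (ho : IsOpen Ω) (hc : Convex ℝ Ω) {ι : Type*} {l : Filter ι}
    [l.NeBot] {z : ι → E} {τ : ι → ℝ} {d : E} (hz : ∀ᶠ i in l, z i ∈ Ω)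
    (hτ : Tendsto τ l atTop) (hd : Tendsto (fun i => (τ i)⁻¹ • z i) l (𝓝 d)) :
    d ∈ recCone Ω := by
  intro x hx t ht
  have hcl : ∀ t : ℝ, 0 ≤ t → x + t • d ∈ closure Ω := by
    intro t ht
    have hlim : Tendsto (fun i => (1 - t * (τ i)⁻¹) • x + t • (τ i)⁻¹ • z i) l
        (𝓝 ((1 - t * 0) • x + t • d)) :=
      ((tendsto_const_nhds.sub (tendsto_const_nhds.mul hτ.inv_tendsto_atTop)).smul_const x).add
        (hd.const_smul t)
    rw [mul_zero, sub_zero, one_smul] at hlim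
    refine mem_closure_of_tendsto hlim ?_
    filter_upwards [hz, hτ.eventually_ge_atTop t, hτ.eventually_gt_atTop 0] with i h1 h2 h3
    rw [smul_smul]
    refine hc hx h1 ?_ (by positivity) (by ring)
    rw [sub_nonneg, ← div_eq_mul_inv]
    exact (div_le_one h3).2 h2
  exact mem_of_extend_mem_closure ho hc hx one_pos (hcl _ (by positivity))

theorem add_mem_recCone {u v : E} (hu : u ∈ recCone Ω) (hv : v ∈ recCone Ω) :
    u + v ∈ recCone Ω := fun x hx t ht => by
  rw [smul_add, ← add_assoc]
  exact hv _ (hu x hx t ht) t ht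

theorem smul_mem_recCone {u : E} (hu : u ∈ recCone Ω) {s : ℝ} (hs : 0 ≤ s) :
    s • u ∈ recCone Ω := fun x hx t ht => by
  rw [smul_smul]
  exact hu x hx _ (by positivity)

theorem isClosed_recCone (ho : IsOpen Ω) (hc : Convex ℝ Ω) (hne : Ω.Nonempty) :
    IsClosed (recCone Ω) := by
  obtain ⟨x, hx⟩ := hne
  refine isClosed_of_closure_subset fun d hd => ?_
  obtain ⟨u, hu, hlim⟩ := mem_closure_iff_seq_limit.1 hd
  have hτ : Tendsto (fun n : ℕ => (n : ℝ) + 1) atTop atTop :=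
    tendsto_atTop_add_const_right _ _ tendsto_natCast_atTop_atTop
  refine mem_recCone_of_tendsto ho hc (z := fun n : ℕ => x + ((n : ℝ) + 1) • u n)
    (Eventually.of_forall fun n => hu n x hx _ (by positivity)) hτ ?_
  have h1 : Tendsto (fun n : ℕ => ((n : ℝ) + 1)⁻¹ • x + u n) atTop (𝓝 ((0 : ℝ) • x + d)) :=
    (hτ.inv_tendsto_atTop.smul_const x).add hlim
  rw [zero_smul, zero_add] at h1
  refine h1.congr fun n => ?_
  rw [smul_add, smul_smul, inv_mul_cancel₀ (by positivity), one_smul]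

theorem eq_zero_of_mem_recCone (hne : Ω.Nonempty)
    (hline : ¬ ∃ x ∈ Ω, ∃ v : E, v ≠ 0 ∧ ∀ t : ℝ, x + t • v ∈ Ω) {u : E}
    (hu : u ∈ recCone Ω) (hu' : -u ∈ recCone Ω) : u = 0 := by
  obtain ⟨x, hx⟩ := hne
  by_contra h0
  refine hline ⟨x, hx, u, h0, fun t => ?_⟩
  rcases le_total 0 t with ht | ht
  · exact hu x hx t ht
  · have := hu' x hx (-t) (by linarith)
    rwa [smul_neg, neg_smul, neg_neg] at this

theorem exists_forall_add_smul_notMem (ho : IsOpen Ω) (hc : Convex ℝ Ω) {K : Set E}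
    (hK : IsCompact K) {d : E} (hd : d ∉ recCone Ω) :
    ∃ R : ℝ, ∀ y ∈ K, ∀ s, R ≤ s → y + s • d ∉ Ω := by
  by_contra! hcon
  choose y hy s hs hys using fun n : ℕ => hcon ((n : ℝ) + 1)
  have hτ : Tendsto s atTop atTop := tendsto_atTop_mono hs
    (tendsto_atTop_add_const_right _ _ tendsto_natCast_atTop_atTop)
  refine hd (mem_recCone_of_tendsto ho hc (Eventually.of_forall hys) hτ ?_)
  have h1 : Tendsto (fun n => (s n)⁻¹ • y n) atTop (𝓝 0) := by
    obtain ⟨M, hM⟩ := hK.isBounded.exists_norm_le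
    refine hτ.inv_tendsto_atTop.zero_smul_isBoundedUnder_le ?_
    exact isBoundedUnder_of ⟨M, fun n => hM _ (hy n)⟩
  have h2 : Tendsto (fun n => (s n)⁻¹ • y n + d) atTop (𝓝 (0 + d)) := h1.add_const d
  rw [zero_add] at h2
  refine h2.congr fun n => ?_
  have : 0 < s n := lt_of_lt_of_le (by positivity) (hs n)
  rw [smul_add, smul_smul, inv_mul_cancel₀ this.ne', one_smul]

theorem mem_recCone_image {F : Type*} [NormedAddCommGroup F] [NormedSpace ℝ F]
    (Φ : E ≃ₗ[ℝ] F) {u : F} : u ∈ recCone (Φ '' Ω) ↔ Φ.symm u ∈ recCone Ω := by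
  simp only [recCone, mem_ofPred_eq, forall_mem_image]
  refine forall₂_congr fun x _ => forall₂_congr fun t _ => ?_
  have : Φ x + t • u = Φ (x + t • Φ.symm u) := by simp
  rw [this, Φ.injective.mem_set_image]

theorem linear_mem_recCone {g : E ≃ᵃ[ℝ] E} (hg : ∀ y, g y ∈ Ω ↔ y ∈ Ω) {u : E}
    (hu : u ∈ recCone Ω) : g.linear u ∈ recCone Ω := fun x hx t ht => by
  obtain ⟨y, rfl⟩ := g.surjective x
  rw [← map_smul, ← affineEquiv_add, hg]
  exact hu y ((hg y).1 hx) t ht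

theorem exists_extremal_shift {C : Set E} (hcl : IsClosed C)
    (hsmul : ∀ u ∈ C, ∀ s : ℝ, 0 ≤ s → s • u ∈ C)
    {c d : E} (hc : -c ∉ C) (hd : d ∈ C) :
    ∃ s : ℝ, 0 ≤ s ∧ d - s • c ∈ C ∧ ∀ r : ℝ, 0 < r → d - s • c - r • c ∉ C := by
  set S : Set ℝ := {s | d - s • c ∈ C} with hS
  have hScl : IsClosed S := hcl.preimage (by fun_prop)
  have h0 : (0 : ℝ) ∈ S := by simpa [hS] using hd
  have hbdd : BddAbove S := by
    by_contra hb
    rw [not_bddAbove_iff] at hb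
    choose s hs hsn using fun n : ℕ => hb (n + 1)
    refine hc (hcl.mem_of_tendsto (b := atTop) (f := fun n => (s n)⁻¹ • (d - s n • c)) ?_
      (Eventually.of_forall fun n => ?_))
    · have hτ : Tendsto s atTop atTop := tendsto_atTop_mono (fun n => (hsn n).le)
        (tendsto_atTop_add_const_right _ _ tendsto_natCast_atTop_atTop)
      have h1 : Tendsto (fun n => (s n)⁻¹ • d - c) atTop (𝓝 ((0 : ℝ) • d - c)) :=
        (hτ.inv_tendsto_atTop.smul_const d).sub_const c
      rw [zero_smul, zero_sub] at h1
      refine h1.congr fun n => ?_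
      have : 0 < s n := lt_trans (by positivity) (hsn n)
      rw [smul_sub, smul_smul, inv_mul_cancel₀ this.ne', one_smul]
    · have : 0 < s n := lt_trans (by positivity) (hsn n)
      exact hsmul _ (hs n) _ (by positivity)
  refine ⟨sSup S, le_csSup hbdd h0, hScl.csSup_mem ⟨0, h0⟩ hbdd, fun r hr hmem => ?_⟩
  have : sSup S + r ∈ S := by
    rw [hS, mem_ofPred_eq, add_smul, ← sub_sub]
    exact hmem
  linarith [le_csSup hbdd this]

/-- A closed pointed convex cone spanning a plane is generated by two independent vectors. -/
theorem exists_generators {C : Set E} (hcl : IsClosed C)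
    (hadd : ∀ u ∈ C, ∀ v ∈ C, u + v ∈ C) (hsmul : ∀ u ∈ C, ∀ s : ℝ, 0 ≤ s → s • u ∈ C)
    (hpt : ∀ u ∈ C, -u ∈ C → u = 0) (hdim : Module.finrank ℝ (Submodule.span ℝ C) = 2) :
    ∃ e₁ e₂ : E, e₁ ∈ C ∧ e₂ ∈ C ∧ LinearIndependent ℝ ![e₁, e₂] ∧
      ∀ u ∈ C, ∃ s t : ℝ, 0 ≤ s ∧ 0 ≤ t ∧ u = s • e₁ + t • e₂ := by
  obtain ⟨b, hbC, hspan, hlin⟩ := exists_linearIndependent ℝ C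
  have hcard : b.ncard = 2 := by
    rw [← hdim, ← hspan, Set.ncard_def, ← Set.toENat_cardinalMk]
    rw [Module.finrank, rank_span_set hlin]
    rfl
  obtain ⟨c₁, c₂, hne, rfl⟩ := Set.ncard_eq_two.1 hcard
  have hc₁ : c₁ ∈ C := hbC (by simp)
  have hc₂ : c₂ ∈ C := hbC (by simp)
  have hli : LinearIndependent ℝ ![c₁, c₂] := by
    rw [LinearIndependent.pair_iff]
    exact (LinearIndepOn.pair_iff id hne).1 hlin
  have hc₁0 : c₁ ≠ 0 := hli.ne_zero 0
  obtain ⟨s₁, hs₁, hm₁, hx₁⟩ := exists_extremal_shift hcl hsmul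
    (fun h => hc₁0 (hpt _ hc₁ h)) hc₂
  set e₂ := c₂ - s₁ • c₁ with he₂
  rw [LinearIndependent.pair_iff] at hli
  have he₂0 : e₂ ≠ 0 := fun h => by
    have := (hli (-s₁) 1 (by rw [← h, he₂]; module)).2
    norm_num at this
  obtain ⟨s₂, hs₂, hm₂, hx₂⟩ := exists_extremal_shift hcl hsmul
    (fun h => he₂0 (hpt _ hm₁ h)) hc₁
  set e₁ := c₁ - s₂ • e₂ with he₁
  have hind : ∀ s t : ℝ, s • e₁ + t • e₂ = 0 → s = 0 ∧ t = 0 := by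
    intro s t hst
    obtain ⟨h1, h2⟩ := hli (s - (t - s * s₂) * s₁) (t - s * s₂)
      (by rw [← hst, he₁, he₂]; module)
    have hs : s = 0 := by rw [h2] at h1; linarith
    exact ⟨hs, by rw [hs] at h2; linarith⟩
  refine ⟨e₁, e₂, hm₂, hm₁, LinearIndependent.pair_iff.2 hind, fun u hu => ?_⟩
  have hus : u ∈ Submodule.span ℝ {c₁, c₂} := by rw [hspan]; exact Submodule.subset_span hu
  obtain ⟨x, y, rfl⟩ := Submodule.mem_span_pair.1 hus
  obtain ⟨s, t, hst⟩ : ∃ s t : ℝ, x • c₁ + y • c₂ = s • e₁ + t • e₂ :=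
    ⟨x + y * s₁, y + (x + y * s₁) * s₂, by rw [he₁, he₂]; module⟩
  rw [hst] at hu ⊢
  have hpos : ¬ (s ≤ 0 ∧ t ≤ 0) ∨ (s = 0 ∧ t = 0) := by
    by_contra! hcon
    obtain ⟨⟨h1, h2⟩, h3⟩ := hcon
    have hneg : -(s • e₁ + t • e₂) ∈ C := by
      have := hadd _ (hsmul _ hm₂ (-s) (by linarith)) _ (hsmul _ hm₁ (-t) (by linarith))
      convert this using 1
      module
    obtain ⟨h4, h5⟩ := hind s t (hpt _ hu hneg)
    exact h3 h4 h5
  refine ⟨s, t, ?_, ?_, rfl⟩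
  · by_contra! hs
    have ht : 0 < t := by
      rcases hpos with h | h
      · by_contra! ht; exact h ⟨hs.le, ht⟩
      · linarith [h.1]
    have hden : 0 < t + -s * s₂ := by nlinarith
    refine hx₁ (-s / (t + -s * s₂)) (by apply div_pos <;> linarith) ?_
    have := hsmul _ hu (t + -s * s₂)⁻¹ (by positivity)
    convert this using 1
    calc e₂ - (-s / (t + -s * s₂)) • c₁
        = (t + -s * s₂)⁻¹ • ((t + -s * s₂) • e₂) - (-s / (t + -s * s₂)) • c₁ := by
          rw [smul_smul, inv_mul_cancel₀ hden.ne', one_smul]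
      _ = _ := by rw [he₁, div_eq_inv_mul]; module
  · by_contra! ht
    have hs : 0 < s := by
      rcases hpos with h | h
      · by_contra! hs; exact h ⟨hs, ht.le⟩
      · linarith [h.2]
    refine hx₂ (-t / s) (by apply div_pos <;> linarith) ?_
    have := hsmul _ hu s⁻¹ (by positivity)
    convert this using 1
    rw [smul_add, smul_smul, smul_smul, inv_mul_cancel₀ hs.ne', one_smul]
    rw [neg_div, div_eq_inv_mul]
    module

end RecessionCone

section Fibred

variable {W : Type*} [NormedAddCommGroup W] [NormedSpace ℝ W]

/-- The infimum of `f` on the fibre of `Ω` over `w`. -/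
def bottom (Ω : Set (W × ℝ × ℝ)) (f : W × ℝ × ℝ →L[ℝ] ℝ) (w : W) : ℝ :=
  sInf (f '' {x ∈ Ω | x.1 = w})

/-- A convex domain fibred over `W` whose recession cone is the quadrant of the fibre, with a
cocompact family of symmetries preserving the sides of the quadrant. -/
structure QuadrantDomain (Ω K : Set (W × ℝ × ℝ)) : Prop where
  isOpen : IsOpen Ω
  convex : Convex ℝ Ω
  nonempty : Ω.Nonempty
  mem_recCone : ∀ u, u ∈ recCone Ω ↔ u.1 = 0 ∧ 0 ≤ u.2.1 ∧ 0 ≤ u.2.2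
  isCompact : IsCompact K
  subset : K ⊆ Ω
  cocompact : ∀ x ∈ Ω, ∃ (A : W ≃ᵃ[ℝ] W) (a b : ℝ) (m m' : W →ᵃ[ℝ] ℝ), 0 < a ∧ 0 < b ∧
    (∀ y : W × ℝ × ℝ,
      ((A y.1, a * y.2.1 + m y.1, b * y.2.2 + m' y.1) : W × ℝ × ℝ) ∈ Ω ↔ y ∈ Ω) ∧
    ((A x.1, a * x.2.1 + m x.1, b * x.2.2 + m' x.1) : W × ℝ × ℝ) ∈ K

variable {Ω K : Set (W × ℝ × ℝ)}

theorem QuadrantDomain.add_mem (h : QuadrantDomain Ω K) {w : W} {v₁ v₂ s t : ℝ}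
    (hx : (w, v₁, v₂) ∈ Ω) (hs : 0 ≤ s) (ht : 0 ≤ t) : (w, v₁ + s, v₂ + t) ∈ Ω := by
  have := (h.mem_recCone (0, s, t)).2 ⟨rfl, hs, ht⟩ _ hx 1 zero_le_one
  simpa using this

theorem tendsto_natCast_add_one_atTop : Tendsto (fun n : ℕ => (n : ℝ) + 1) atTop atTop :=
  tendsto_atTop_add_const_right _ _ tendsto_natCast_atTop_atTop

theorem QuadrantDomain.exists_fiber_bounded (h : QuadrantDomain Ω K) :
    ∃ (w : W) (R : ℝ), (∃ v, (w, v) ∈ Ω) ∧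
      ∀ v₁ v₂, (w, v₁, v₂) ∈ Ω → R ≤ v₁ ∧ R ≤ v₂ := by
  obtain ⟨⟨w₀, x₁, x₂⟩, hx⟩ := h.nonempty
  have hmem : ∀ n : ℕ, (w₀, x₁ + ((n : ℝ) + 1), x₂ + ((n : ℝ) + 1)) ∈ Ω := fun n =>
    h.add_mem hx (by positivity) (by positivity)
  choose A a b m m' ha hb hiff hK using fun n : ℕ => h.cocompact _ (hmem n)
  obtain ⟨R₁, hR₁⟩ := exists_forall_add_smul_notMem h.isOpen h.convex h.isCompact
    (d := ((0, -1, 0) : W × ℝ × ℝ)) (by rw [h.mem_recCone]; norm_num)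
  obtain ⟨R₂, hR₂⟩ := exists_forall_add_smul_notMem h.isOpen h.convex h.isCompact
    (d := ((0, 0, -1) : W × ℝ × ℝ)) (by rw [h.mem_recCone]; norm_num)
  have hna : ∀ n : ℕ, a n * ((n : ℝ) + 1) ≤ R₁ := by
    intro n
    by_contra! hlt
    refine hR₁ _ (hK n) _ hlt.le ?_
    have := (hiff n (w₀, x₁, x₂ + ((n : ℝ) + 1))).2
      (by simpa using h.add_mem hx le_rfl (by positivity))
    convert this using 1
    ext <;> simp
    ring
  have hnb : ∀ n : ℕ, b n * ((n : ℝ) + 1) ≤ R₂ := by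
    intro n
    by_contra! hlt
    refine hR₂ _ (hK n) _ hlt.le ?_
    have := (hiff n (w₀, x₁ + ((n : ℝ) + 1), x₂)).2
      (by simpa using h.add_mem hx (by positivity) le_rfl)
    convert this using 1
    ext <;> simp
    ring
  set y : ℕ → W × ℝ × ℝ := fun n => (A n w₀, a n * (x₁ + ((n : ℝ) + 1)) + m n w₀,
    b n * (x₂ + ((n : ℝ) + 1)) + m' n w₀) with hy
  obtain ⟨⟨⟨w, y₁, y₂⟩, p, q⟩, hlK, φ, hφ, hlim⟩ :=
    (h.isCompact.prod (isCompact_Icc.prod isCompact_Icc)).tendsto_subseq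
    (x := fun n => (y n, a n * ((n : ℝ) + 1), b n * ((n : ℝ) + 1)))
    (s := K ×ˢ Icc 0 R₁ ×ˢ Icc 0 R₂) fun n =>
      ⟨hK n, ⟨mul_nonneg (ha n).le (by positivity), hna n⟩,
        ⟨mul_nonneg (hb n).le (by positivity), hnb n⟩⟩
  have hyl : Tendsto (fun k => y (φ k)) atTop (𝓝 (w, y₁, y₂)) :=
    (continuous_fst.tendsto _).comp hlim
  have hpl : Tendsto (fun k => a (φ k) * ((φ k : ℝ) + 1)) atTop (𝓝 p) :=
    ((continuous_fst.comp continuous_snd).tendsto _).comp hlim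
  have hql : Tendsto (fun k => b (φ k) * ((φ k : ℝ) + 1)) atTop (𝓝 q) :=
    ((continuous_snd.comp continuous_snd).tendsto _).comp hlim
  have hτ : Tendsto (fun k => (φ k : ℝ) + 1) atTop atTop :=
    tendsto_natCast_add_one_atTop.comp hφ.tendsto_atTop
  have hτ0 : ∀ k, (0 : ℝ) < (φ k : ℝ) + 1 := fun k => by positivity
  have hyΩ : ((w, y₁, y₂) : W × ℝ × ℝ) ∈ Ω := h.subset hlK.1
  have hpull : ∀ s t : ℝ, (w, y₁ + s, y₂ + t) ∈ Ω → ∀ᶠ k in atTop,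
      ((w₀, x₁ + ((φ k : ℝ) + 1) + s / a (φ k), x₂ + ((φ k : ℝ) + 1) + t / b (φ k)) :
        W × ℝ × ℝ) ∈ Ω := by
    intro s t hst
    have h1 : Tendsto (fun k => y (φ k) + (0, s, t)) atTop (𝓝 ((w, y₁, y₂) + (0, s, t))) :=
      hyl.add_const _
    have h2 := h1.eventually (h.isOpen.mem_nhds (by simpa using hst))
    filter_upwards [h2] with k hk
    rw [← hiff (φ k)]
    replace hk : y (φ k) + (0, s, t) ∈ Ω := hk
    convert hk using 1
    have h3 := (ha (φ k)).ne'
    have h4 := (hb (φ k)).ne'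
    ext <;> simp [hy] <;> field_simp <;> ring
  have hw₀ : Tendsto (fun k => ((φ k : ℝ) + 1)⁻¹ • w₀) atTop (𝓝 0) := by
    simpa using hτ.inv_tendsto_atTop.smul_const w₀
  have hxi : ∀ x : ℝ, Tendsto (fun k => ((φ k : ℝ) + 1)⁻¹ * x) atTop (𝓝 0) := fun x => by
    simpa using hτ.inv_tendsto_atTop.mul_const x
  have hball : ∃ ε > 0, ((w, y₁ + -ε, y₂) : W × ℝ × ℝ) ∈ Ω ∧
      ((w, y₁, y₂ + -ε) : W × ℝ × ℝ) ∈ Ω := by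
    have h1 : Tendsto (fun ε : ℝ => ((w, y₁ + -ε, y₂) : W × ℝ × ℝ)) (𝓝[>] 0) (𝓝 (w, y₁, y₂)) := by
      have : Continuous (fun ε : ℝ => ((w, y₁ + -ε, y₂) : W × ℝ × ℝ)) := by fun_prop
      simpa using (this.tendsto 0).mono_left nhdsWithin_le_nhds
    have h2 : Tendsto (fun ε : ℝ => ((w, y₁, y₂ + -ε) : W × ℝ × ℝ)) (𝓝[>] 0) (𝓝 (w, y₁, y₂)) := by
      have : Continuous (fun ε : ℝ => ((w, y₁, y₂ + -ε) : W × ℝ × ℝ)) := by fun_prop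
      simpa using (this.tendsto 0).mono_left nhdsWithin_le_nhds
    have h3 := h.isOpen.mem_nhds hyΩ
    obtain ⟨ε, ⟨h4, h5⟩, h6⟩ := (((h1.eventually h3).and (h2.eventually h3)).and
      self_mem_nhdsWithin).exists
    exact ⟨ε, h6, h4, h5⟩
  obtain ⟨ε, hε, hε₁, hε₂⟩ := hball
  have hinv : ∀ c : ℕ → ℝ, (∀ n, 0 < c n) →
      Tendsto (fun k => c (φ k) * ((φ k : ℝ) + 1)) atTop (𝓝 0) →
      Tendsto (fun k => (c (φ k))⁻¹) atTop atTop ∧ Tendsto (fun k => c (φ k)) atTop (𝓝 0) := by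
    intro c hc hlim
    have h0 : Tendsto (fun k => c (φ k)) atTop (𝓝 0) :=
      squeeze_zero (fun k => (hc _).le) (fun k => by
        have := hc (φ k)
        nlinarith [(Nat.cast_nonneg (φ k) : (0 : ℝ) ≤ φ k)]) hlim
    refine ⟨?_, h0⟩
    exact Tendsto.inv_tendsto_nhdsGT_zero (tendsto_nhdsWithin_iff.2
      ⟨h0, Eventually.of_forall fun k => hc _⟩)
  have hp0 : 0 < p := by
    refine hlK.2.1.1.lt_of_ne' fun hp => ?_
    simp only at hp
    rw [hp] at hpl
    obtain ⟨h1, h2⟩ := hinv a ha hpl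
    have h3 : ((0, -ε, 0) : W × ℝ × ℝ) ∈ recCone Ω := by
      refine mem_recCone_of_tendsto h.isOpen h.convex (hpull (-ε) 0 (by simpa using hε₁)) h1 ?_
      have h4 : Tendsto (fun k => ((a (φ k) • w₀, a (φ k) * x₁ + a (φ k) * ((φ k : ℝ) + 1) + -ε,
          a (φ k) * x₂ + a (φ k) * ((φ k : ℝ) + 1)) : W × ℝ × ℝ)) atTop
          (𝓝 ((0 : ℝ) • w₀, 0 * x₁ + 0 + -ε, 0 * x₂ + 0)) :=
        (h2.smul_const _).prodMk_nhds ((((h2.mul_const _).add hpl).add_const _).prodMk_nhds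
          ((h2.mul_const _).add hpl))
      simp only [zero_smul, zero_mul, zero_add, add_zero] at h4
      refine h4.congr fun k => ?_
      have h3 := (ha (φ k)).ne'
      ext <;> simp <;> field_simp
    have := ((h.mem_recCone _).1 h3).2.1
    simp only at this
    linarith
  have hq0 : 0 < q := by
    refine hlK.2.2.1.lt_of_ne' fun hq => ?_
    simp only at hq
    rw [hq] at hql
    obtain ⟨h1, h2⟩ := hinv b hb hql
    have h3 : ((0, 0, -ε) : W × ℝ × ℝ) ∈ recCone Ω := by
      refine mem_recCone_of_tendsto h.isOpen h.convex (hpull 0 (-ε) (by simpa using hε₂)) h1 ?_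
      have h4 : Tendsto (fun k => ((b (φ k) • w₀, b (φ k) * x₁ + b (φ k) * ((φ k : ℝ) + 1),
          b (φ k) * x₂ + b (φ k) * ((φ k : ℝ) + 1) + -ε) : W × ℝ × ℝ)) atTop
          (𝓝 ((0 : ℝ) • w₀, 0 * x₁ + 0, 0 * x₂ + 0 + -ε)) :=
        (h2.smul_const _).prodMk_nhds (((h2.mul_const _).add hql).prodMk_nhds
          (((h2.mul_const _).add hql).add_const _))
      simp only [zero_smul, zero_mul, zero_add, add_zero] at h4
      refine h4.congr fun k => ?_
      have h3 := (hb (φ k)).ne'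
      ext <;> simp <;> field_simp
    have := ((h.mem_recCone _).1 h3).2.2
    simp only at this
    linarith
  have hlow : ∀ s t : ℝ, (w, y₁ + s, y₂ + t) ∈ Ω → -p ≤ s ∧ -q ≤ t := by
    intro s t hst
    have h3 : ((0, 1 + s * p⁻¹, 1 + t * q⁻¹) : W × ℝ × ℝ) ∈ recCone Ω := by
      refine mem_recCone_of_tendsto h.isOpen h.convex (hpull s t hst) hτ ?_
      have h4 : Tendsto (fun k => ((((φ k : ℝ) + 1)⁻¹ • w₀,
          ((φ k : ℝ) + 1)⁻¹ * x₁ + (1 + s * (a (φ k) * ((φ k : ℝ) + 1))⁻¹),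
          ((φ k : ℝ) + 1)⁻¹ * x₂ + (1 + t * (b (φ k) * ((φ k : ℝ) + 1))⁻¹)) : W × ℝ × ℝ)) atTop
          (𝓝 (0, 0 + (1 + s * p⁻¹), 0 + (1 + t * q⁻¹))) :=
        hw₀.prodMk_nhds (((hxi _).add (((hpl.inv₀ hp0.ne').const_mul _).const_add _)).prodMk_nhds
          ((hxi _).add (((hql.inv₀ hq0.ne').const_mul _).const_add _)))
      rw [zero_add, zero_add] at h4
      refine h4.congr fun k => ?_
      have h5 := (ha (φ k)).ne'
      have h6 := (hb (φ k)).ne'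
      have h7 := (hτ0 k).ne'
      ext <;> simp <;> field_simp <;> ring
    have h4 := (h.mem_recCone _).1 h3
    simp only at h4
    obtain ⟨-, h5, h6⟩ := h4
    rw [← div_eq_mul_inv, ← neg_le_iff_add_nonneg', le_div_iff₀ hp0] at h5
    rw [← div_eq_mul_inv, ← neg_le_iff_add_nonneg', le_div_iff₀ hq0] at h6
    exact ⟨by linarith, by linarith⟩
  refine ⟨w, min (y₁ - p) (y₂ - q), ⟨_, hyΩ⟩, fun v₁ v₂ hv => ?_⟩
  have := hlow (v₁ - y₁) (v₂ - y₂) (by simpa using hv)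
  exact ⟨(min_le_left _ _).trans (by linarith), (min_le_right _ _).trans (by linarith)⟩

end Fibred

section Bottoms

variable {W : Type*} [NormedAddCommGroup W] [NormedSpace ℝ W] {Ω K : Set (W × ℝ × ℝ)}

/-- The first fibre coordinate. -/
def fiberLeft (W : Type*) [NormedAddCommGroup W] [NormedSpace ℝ W] : W × ℝ × ℝ →L[ℝ] ℝ :=
  (ContinuousLinearMap.fst ℝ ℝ ℝ).comp (ContinuousLinearMap.snd ℝ W (ℝ × ℝ))

/-- The second fibre coordinate. -/
def fiberRight (W : Type*) [NormedAddCommGroup W] [NormedSpace ℝ W] : W × ℝ × ℝ →L[ℝ] ℝ :=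
  (ContinuousLinearMap.snd ℝ ℝ ℝ).comp (ContinuousLinearMap.snd ℝ W (ℝ × ℝ))

@[simp] theorem fiberLeft_apply (x : W × ℝ × ℝ) : fiberLeft W x = x.2.1 := rfl

@[simp] theorem fiberRight_apply (x : W × ℝ × ℝ) : fiberRight W x = x.2.2 := rfl

theorem bddBelow_fiber (ho : IsOpen Ω) (hc : Convex ℝ Ω) {f : W × ℝ × ℝ →L[ℝ] ℝ} {w₀ : W}
    (hw₀ : w₀ ∈ Prod.fst '' Ω) {R : ℝ} (hR : ∀ x ∈ Ω, x.1 = w₀ → R ≤ f x) {w : W}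
    (hw : w ∈ Prod.fst '' Ω) :
    BddBelow (f '' {x ∈ Ω | x.1 = w}) := by
  have hUo : IsOpen (Prod.fst '' Ω) := isOpenMap_fst _ ho
  have hcont : Continuous fun t : ℝ => w₀ + t • (w₀ - w) := by fun_prop
  have h1 : Tendsto (fun t : ℝ => w₀ + t • (w₀ - w)) (𝓝[>] 0) (𝓝 w₀) := by
    simpa using (hcont.tendsto 0).mono_left nhdsWithin_le_nhds
  obtain ⟨t, h2, ht⟩ := ((h1.eventually (hUo.mem_nhds hw₀)).and self_mem_nhdsWithin).exists
  obtain ⟨x', hx', hx'w⟩ := h2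
  have ht : 0 < t := ht
  refine ⟨((1 + t) * R - f x') / t, ?_⟩
  rintro _ ⟨x, ⟨hx, rfl⟩, rfl⟩
  have hmem := hc hx hx' (a := t / (1 + t)) (b := 1 / (1 + t)) (by positivity) (by positivity)
    (by field_simp; ring)
  have h3 := hR _ hmem (by
    rw [Prod.fst_add, Prod.smul_fst, Prod.smul_fst, hx'w]
    have h4 : w₀ = ((1 + t) / (1 + t)) • w₀ := by rw [div_self (by positivity), one_smul]
    conv_rhs => rw [h4]
    simp only [div_eq_mul_inv]
    module)
  rw [map_add, map_smul, map_smul, smul_eq_mul, smul_eq_mul] at h3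
  rw [div_le_iff₀ ht]
  have h5 : (1 + t) * (t / (1 + t) * f x + 1 / (1 + t) * f x') = t * f x + f x' := by
    field_simp
  nlinarith [mul_le_mul_of_nonneg_left h3 (by positivity : 0 ≤ 1 + t)]

theorem isGLB_bottom {f : W × ℝ × ℝ →L[ℝ] ℝ}
    (hb : ∀ w ∈ Prod.fst '' Ω, BddBelow (f '' {x ∈ Ω | x.1 = w})) {w : W}
    (hw : w ∈ Prod.fst '' Ω) : IsGLB (f '' {x ∈ Ω | x.1 = w}) (bottom Ω f w) := by
  obtain ⟨x, hx, rfl⟩ := id hw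
  exact isGLB_csInf ⟨_, x, ⟨hx, rfl⟩, rfl⟩ (hb _ hw)

theorem bottom_lt (ho : IsOpen Ω) {f : W × ℝ × ℝ →L[ℝ] ℝ}
    (hb : ∀ w ∈ Prod.fst '' Ω, BddBelow (f '' {x ∈ Ω | x.1 = w})) {e : W × ℝ × ℝ}
    (he : e.1 = 0) (hfe : 0 < f e) {x : W × ℝ × ℝ} (hx : x ∈ Ω) : bottom Ω f x.1 < f x := by
  have hcont : Continuous fun t : ℝ => x - t • e := by fun_prop
  have h1 : Tendsto (fun t : ℝ => x - t • e) (𝓝[>] 0) (𝓝 x) := by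
    simpa using (hcont.tendsto 0).mono_left nhdsWithin_le_nhds
  obtain ⟨t, h2, ht⟩ := ((h1.eventually (ho.mem_nhds hx)).and self_mem_nhdsWithin).exists
  have ht : 0 < t := ht
  have h3 := (isGLB_bottom hb ⟨x, hx, rfl⟩).1 ⟨_, ⟨h2, by simp [he]⟩, rfl⟩
  rw [map_sub, map_smul, smul_eq_mul] at h3
  nlinarith [mul_pos ht hfe]

theorem exists_lt_bottom_add {f : W × ℝ × ℝ →L[ℝ] ℝ}
    (hb : ∀ w ∈ Prod.fst '' Ω, BddBelow (f '' {x ∈ Ω | x.1 = w})) {w : W}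
    (hw : w ∈ Prod.fst '' Ω) {ε : ℝ} (hε : 0 < ε) :
    ∃ x ∈ Ω, x.1 = w ∧ f x < bottom Ω f w + ε := by
  obtain ⟨_, ⟨x, ⟨hx, hxw⟩, rfl⟩, -, hlt⟩ :=
    (isGLB_bottom hb hw).exists_between (lt_add_of_pos_right _ hε)
  exact ⟨x, hx, hxw, hlt⟩

theorem convexOn_bottom (hc : Convex ℝ Ω) {f : W × ℝ × ℝ →L[ℝ] ℝ}
    (hb : ∀ w ∈ Prod.fst '' Ω, BddBelow (f '' {x ∈ Ω | x.1 = w})) :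
    ConvexOn ℝ (Prod.fst '' Ω) (bottom Ω f) := by
  have hcv : Convex ℝ (Prod.fst '' Ω) := hc.linear_image (LinearMap.fst ℝ W (ℝ × ℝ))
  refine ⟨hcv, fun w hw w' hw' s t hs ht hst => le_of_forall_pos_le_add fun ε hε => ?_⟩
  obtain ⟨x, hx, rfl, h1⟩ := exists_lt_bottom_add hb hw hε
  obtain ⟨x', hx', rfl, h2⟩ := exists_lt_bottom_add hb hw' hε
  have h3 := (isGLB_bottom hb (hcv hw hw' hs ht hst)).1 ⟨_, ⟨hc hx hx' hs ht hst, rfl⟩, rfl⟩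
  rw [map_add, map_smul, map_smul] at h3
  simp only [smul_eq_mul] at h3 ⊢
  have h4 : ε = s * ε + t * ε := by rw [← add_mul, hst, one_mul]
  nlinarith [mul_le_mul_of_nonneg_left h1.le hs, mul_le_mul_of_nonneg_left h2.le ht]

theorem bottom_map {f : W × ℝ × ℝ →L[ℝ] ℝ}
    (hb : ∀ w ∈ Prod.fst '' Ω, BddBelow (f '' {x ∈ Ω | x.1 = w})) {A : W ≃ᵃ[ℝ] W} {a : ℝ}
    (ha : 0 < a) {m : W →ᵃ[ℝ] ℝ} {g : W × ℝ × ℝ → W × ℝ × ℝ} (hg : ∀ y, g y ∈ Ω ↔ y ∈ Ω)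
    (hsurj : Function.Surjective g) (hfst : ∀ y, (g y).1 = A y.1)
    (hf : ∀ y, f (g y) = a * f y + m y.1) {w : W} (hw : w ∈ Prod.fst '' Ω) :
    bottom Ω f (A w) = a * bottom Ω f w + m w := by
  have hw' : A w ∈ Prod.fst '' Ω := by
    obtain ⟨x, hx, rfl⟩ := hw
    exact ⟨g x, (hg x).2 hx, hfst x⟩
  apply le_antisymm
  · refine le_of_forall_pos_le_add fun ε hε => ?_
    obtain ⟨x, hx, rfl, h1⟩ := exists_lt_bottom_add hb hw (div_pos hε ha)
    have h2 := (isGLB_bottom hb hw').1 ⟨_, ⟨(hg x).2 hx, hfst x⟩, rfl⟩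
    rw [hf] at h2
    have h3 : a * (ε / a) = ε := by field_simp
    nlinarith [mul_lt_mul_of_pos_left h1 ha]
  · refine le_of_forall_pos_le_add fun ε hε => ?_
    obtain ⟨x, hx, hxw, h1⟩ := exists_lt_bottom_add hb hw' hε
    obtain ⟨y, rfl⟩ := hsurj x
    rw [hfst, A.injective.eq_iff] at hxw
    subst hxw
    have h2 := (isGLB_bottom hb hw).1 ⟨_, ⟨(hg y).1 hx, rfl⟩, rfl⟩
    rw [hf] at h1
    nlinarith [mul_le_mul_of_nonneg_left h2 ha.le]

/-- Action of a symmetry of a fibred domain preserving the sides of the quadrant. -/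
def fiberMap (A : W ≃ᵃ[ℝ] W) (a b : ℝ) (m m' : W →ᵃ[ℝ] ℝ) (y : W × ℝ × ℝ) : W × ℝ × ℝ :=
  (A y.1, a * y.2.1 + m y.1, b * y.2.2 + m' y.1)

theorem fiberMap_surjective (A : W ≃ᵃ[ℝ] W) {a b : ℝ} (ha : a ≠ 0) (hb : b ≠ 0)
    (m m' : W →ᵃ[ℝ] ℝ) : Function.Surjective (fiberMap A a b m m') := by
  rintro ⟨w, s, t⟩
  refine ⟨(A.symm w, (s - m (A.symm w)) / a, (t - m' (A.symm w)) / b), ?_⟩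
  simp only [fiberMap, AffineEquiv.apply_symm_apply]
  ext <;> simp <;> field_simp <;> ring

variable [FiniteDimensional ℝ W]

/-- A quadrant domain is the region above a convex pair. -/
theorem QuadrantDomain.exists_convexPair (h : QuadrantDomain Ω K) :
    ∃ (U : Set W) (α β : W → ℝ) (K' : Set W) (c c' : ℝ), ConvexPair U α β K' c c' ∧
      ∀ x, x ∈ Ω ↔ x.1 ∈ U ∧ α x.1 < x.2.1 ∧ β x.1 < x.2.2 := by
  obtain ⟨w₀, R, ⟨v₀, hv₀⟩, hR⟩ := h.exists_fiber_bounded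
  set U : Set W := Prod.fst '' Ω with hU
  have hUo : IsOpen U := isOpenMap_fst _ h.isOpen
  have hw₀ : w₀ ∈ U := ⟨_, hv₀, rfl⟩
  have hbl : ∀ w ∈ U, BddBelow (fiberLeft W '' {x ∈ Ω | x.1 = w}) := fun w hw =>
    bddBelow_fiber h.isOpen h.convex hw₀ (R := R)
      (by rintro ⟨_, v₁, v₂⟩ hx rfl; exact (hR _ _ hx).1) hw
  have hbr : ∀ w ∈ U, BddBelow (fiberRight W '' {x ∈ Ω | x.1 = w}) := fun w hw =>
    bddBelow_fiber h.isOpen h.convex hw₀ (R := R)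
      (by rintro ⟨_, v₁, v₂⟩ hx rfl; exact (hR _ _ hx).2) hw
  set α := bottom Ω (fiberLeft W) with hα
  set β := bottom Ω (fiberRight W) with hβ
  have hαlt : ∀ x ∈ Ω, α x.1 < x.2.1 := fun x hx =>
    bottom_lt h.isOpen hbl (e := (0, 1, 0)) rfl (by simp) hx
  have hβlt : ∀ x ∈ Ω, β x.1 < x.2.2 := fun x hx =>
    bottom_lt h.isOpen hbr (e := (0, 0, 1)) rfl (by simp) hx
  have hαc : ConvexOn ℝ U α := convexOn_bottom h.convex hbl
  have hβc : ConvexOn ℝ U β := convexOn_bottom h.convex hbr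
  have hαcont : ContinuousOn (fun x : W × ℝ × ℝ => x.2.1 - α x.1) Ω :=
    (continuous_fst.comp continuous_snd).continuousOn.sub
      ((hαc.continuousOn hUo).comp continuous_fst.continuousOn fun x hx => ⟨x, hx, rfl⟩)
  have hβcont : ContinuousOn (fun x : W × ℝ × ℝ => x.2.2 - β x.1) Ω :=
    (continuous_snd.comp continuous_snd).continuousOn.sub
      ((hβc.continuousOn hUo).comp continuous_fst.continuousOn fun x hx => ⟨x, hx, rfl⟩)
  have hαmap : ∀ (A : W ≃ᵃ[ℝ] W) (a b : ℝ) (m m' : W →ᵃ[ℝ] ℝ), 0 < a → 0 < b →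
      (∀ y, fiberMap A a b m m' y ∈ Ω ↔ y ∈ Ω) → ∀ w ∈ U, α (A w) = a * α w + m w :=
    fun A a b m m' ha hb hg w hw => bottom_map hbl ha hg
      (fiberMap_surjective A ha.ne' hb.ne' m m') (fun _ => rfl) (fun _ => rfl) hw
  have hβmap : ∀ (A : W ≃ᵃ[ℝ] W) (a b : ℝ) (m m' : W →ᵃ[ℝ] ℝ), 0 < a → 0 < b →
      (∀ y, fiberMap A a b m m' y ∈ Ω ↔ y ∈ Ω) → ∀ w ∈ U, β (A w) = b * β w + m' w :=
    fun A a b m m' ha hb hg w hw => bottom_map hbr hb hg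
      (fiberMap_surjective A ha.ne' hb.ne' m m') (fun _ => rfl) (fun _ => rfl) hw
  have hKne : K.Nonempty := by
    obtain ⟨A, a, b, m, m', -, -, -, hK⟩ := h.cocompact _ hv₀
    exact ⟨_, hK⟩
  obtain ⟨x₁, hx₁, hmin₁⟩ := h.isCompact.exists_isMinOn hKne (hαcont.mono h.subset)
  obtain ⟨x₂, hx₂, hmin₂⟩ := h.isCompact.exists_isMinOn hKne (hβcont.mono h.subset)
  obtain ⟨x₃, hx₃, hmax₁⟩ := h.isCompact.exists_isMaxOn hKne (hαcont.mono h.subset)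
  obtain ⟨x₄, hx₄, hmax₂⟩ := h.isCompact.exists_isMaxOn hKne (hβcont.mono h.subset)
  simp only [isMinOn_iff, isMaxOn_iff] at hmin₁ hmin₂ hmax₁ hmax₂
  set c := min (x₁.2.1 - α x₁.1) (x₂.2.2 - β x₂.1) with hc
  set c' := max (x₃.2.1 - α x₃.1) (x₄.2.2 - β x₄.1) with hc'
  have hcpos : 0 < c := lt_min (sub_pos.2 (hαlt _ (h.subset hx₁))) (sub_pos.2 (hβlt _ (h.subset hx₂)))
  have hKα : ∀ x ∈ K, x.2.1 - α x.1 ∈ Icc c c' := fun x hx =>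
    ⟨(min_le_left _ _).trans (hmin₁ x hx), (hmax₁ x hx).trans (le_max_left _ _)⟩
  have hKβ : ∀ x ∈ K, x.2.2 - β x.1 ∈ Icc c c' := fun x hx =>
    ⟨(min_le_right _ _).trans (hmin₂ x hx), (hmax₂ x hx).trans (le_max_right _ _)⟩
  have hc'pos : 0 < c' := by
    obtain ⟨x, hx⟩ := hKne
    exact hcpos.trans_le ((hKα x hx).1.trans (hKα x hx).2)
  -- pushing points towards the bottom by a uniform proportion
  obtain ⟨δ, hδ0, hδ1, hδ⟩ : ∃ δ : ℝ, 0 < δ ∧ δ < 1 ∧ ∀ x ∈ K,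
      ((x.1, x.2.1 - δ * (x.2.1 - α x.1), x.2.2 - δ * (x.2.2 - β x.1)) : W × ℝ × ℝ) ∈ Ω := by
    obtain ⟨ρ, hρ, hsub⟩ := h.isCompact.exists_cthickening_subset_open h.isOpen h.subset
    refine ⟨min (1 / 2) (ρ / c'), by positivity, (min_le_left _ _).trans_lt (by norm_num),
      fun x hx => hsub ?_⟩
    refine Metric.mem_cthickening_of_dist_le _ x _ _ hx ?_
    have hle : ∀ s ∈ Icc c c', |min (1 / 2) (ρ / c') * s| ≤ ρ := by
      intro s hs
      have hs0 : 0 < s := hcpos.trans_le hs.1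
      rw [abs_of_nonneg (by positivity)]
      calc min (1 / 2) (ρ / c') * s ≤ (ρ / c') * c' :=
            mul_le_mul (min_le_right _ _) hs.2 hs0.le (by positivity)
        _ = ρ := by field_simp
    rw [Prod.dist_eq, Prod.dist_eq]
    simp only [dist_self, Real.dist_eq, sub_sub_cancel_left, abs_neg]
    exact max_le hρ.le (max_le (hle _ (hKα x hx)) (hle _ (hKβ x hx)))
  have hpush : ∀ x ∈ Ω,
      ((x.1, x.2.1 - δ * (x.2.1 - α x.1), x.2.2 - δ * (x.2.2 - β x.1)) : W × ℝ × ℝ) ∈ Ω := by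
    intro x hx
    obtain ⟨A, a, b, m, m', ha, hb, hg, hK⟩ := h.cocompact x hx
    rw [← hg]
    have h1 := hδ _ hK
    have hxU : x.1 ∈ U := ⟨x, hx, rfl⟩
    simp only [hαmap A a b m m' ha hb hg _ hxU, hβmap A a b m m' ha hb hg _ hxU] at h1
    convert h1 using 3 <;> ring
  have hiter : ∀ x ∈ Ω, ∀ n : ℕ, ((x.1, α x.1 + (1 - δ) ^ n * (x.2.1 - α x.1),
      β x.1 + (1 - δ) ^ n * (x.2.2 - β x.1)) : W × ℝ × ℝ) ∈ Ω := by
    intro x hx n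
    induction n with
    | zero => simpa using hx
    | succ n ih =>
      have := hpush _ ih
      simp only at this
      convert this using 3 <;> ring
  have hΩ : ∀ x, x ∈ Ω ↔ x.1 ∈ U ∧ α x.1 < x.2.1 ∧ β x.1 < x.2.2 := by
    rintro ⟨w, v₁, v₂⟩
    refine ⟨fun hx => ⟨⟨_, hx, rfl⟩, hαlt _ hx, hβlt _ hx⟩, ?_⟩
    rintro ⟨⟨⟨w', z₁, z₂⟩, hx, hw⟩, h1, h2⟩
    obtain rfl : w' = w := hw
    simp only at h1 h2
    have hpow : Tendsto (fun n : ℕ => (1 - δ) ^ n) atTop (𝓝 0) :=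
      tendsto_pow_atTop_nhds_zero_of_lt_one (by linarith) (by linarith)
    have hp1 : ∀ s p : ℝ, Tendsto (fun n : ℕ => s + (1 - δ) ^ n * p) atTop (𝓝 s) := by
      intro s p
      simpa using (hpow.mul_const p).const_add s
    obtain ⟨n, h3, h4⟩ := (((hp1 _ (z₁ - α w')).eventually (eventually_lt_nhds h1)).and
      ((hp1 _ (z₂ - β w')).eventually (eventually_lt_nhds h2))).exists
    have := h.add_mem (hiter _ hx n) (sub_nonneg.2 h3.le) (sub_nonneg.2 h4.le)
    simpa using this
  refine ⟨U, α, β, Prod.fst '' K, c, c', ⟨hUo, ⟨w₀, hw₀⟩, hαc, hβc, ?_,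
    h.isCompact.image continuous_fst, image_mono h.subset, hcpos, ?_⟩, hΩ⟩
  · intro C
    by_contra! hcon
    choose w hwU hwn hle using fun n : ℕ => hcon ((n : ℝ) + 1)
    have hpos : ∀ n, 0 < ‖w n‖ := fun n => lt_of_lt_of_le (by positivity) (hwn n)
    obtain ⟨u, hu, φ, hφ, hlim⟩ := (isCompact_sphere (0 : W) 1).tendsto_subseq
      (x := fun n => ‖w n‖⁻¹ • w n) fun n => by
        rw [mem_sphere_zero_iff_norm]
        exact norm_inv_norm_smul (norm_pos_iff.1 (hpos n))
    have hτ : Tendsto (fun k => ‖w (φ k)‖) atTop atTop :=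
      (tendsto_atTop_mono hwn tendsto_natCast_add_one_atTop).comp hφ.tendsto_atTop
    have hmem : ((u, C, C) : W × ℝ × ℝ) ∈ recCone Ω := by
      refine mem_recCone_of_tendsto h.isOpen h.convex
        (z := fun k => (w (φ k), C * ‖w (φ k)‖ + 1, C * ‖w (φ k)‖ + 1))
        (Eventually.of_forall fun k => (hΩ _).2 ⟨hwU _, ?_, ?_⟩) hτ ?_
      · exact ((le_max_left _ _).trans (hle _)).trans_lt (lt_add_one _)
      · exact ((le_max_right _ _).trans (hle _)).trans_lt (lt_add_one _)
      · have h1 : Tendsto (fun k => C + ‖w (φ k)‖⁻¹) atTop (𝓝 C) := by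
          simpa using hτ.inv_tendsto_atTop.const_add C
        refine (hlim.prodMk_nhds (h1.prodMk_nhds h1)).congr fun k => ?_
        have := (hpos (φ k)).ne'
        ext <;> simp <;> field_simp
    have hu0 := ((h.mem_recCone _).1 hmem).1
    simp only at hu0
    simp [hu0] at hu
  · intro w hw p q hp hq
    have hx : ((w, α w + p, β w + q) : W × ℝ × ℝ) ∈ Ω := (hΩ _).2 ⟨hw, by simpa, by simpa⟩
    obtain ⟨A, a, b, m, m', ha, hb, hg, hK⟩ := h.cocompact _ hx
    have hAα := hαmap A a b m m' ha hb hg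
    have hAβ := hβmap A a b m m' ha hb hg
    refine ⟨A, a, b, ⟨ha, hb, fun w => ⟨?_, ?_⟩, ⟨m, hAα⟩, ⟨m', hAβ⟩⟩, ⟨_, hK, rfl⟩, ?_, ?_⟩
    · rintro ⟨x, hx, hxw⟩
      obtain ⟨y, rfl⟩ := fiberMap_surjective A ha.ne' hb.ne' m m' x
      exact ⟨y, (hg y).1 hx, A.injective hxw⟩
    · rintro ⟨x, hx, rfl⟩
      exact ⟨_, (hg x).2 hx, rfl⟩
    · have := hKα _ hK
      simp only [hAα _ hw] at this
      convert this using 1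
      ring
    · have := hKβ _ hK
      simp only [hAβ _ hw] at this
      convert this using 1
      ring

end Bottoms

section Normalization

variable {W : Type*} [NormedAddCommGroup W] [NormedSpace ℝ W] {Ω K : Set (W × ℝ × ℝ)}

theorem affineEquiv_fiber (g : (W × ℝ × ℝ) ≃ᵃ[ℝ] (W × ℝ × ℝ)) (w : W) (s t : ℝ) :
    g (w, s, t) = g (w, 0, 0) + (s • g.linear (0, 1, 0) + t • g.linear (0, 0, 1)) := by
  rw [← map_smul, ← map_smul, ← map_add, ← affineEquiv_add]
  simp

theorem exists_eq_fiberMap {g : (W × ℝ × ℝ) ≃ᵃ[ℝ] (W × ℝ × ℝ)} {a b : ℝ} (ha : a ≠ 0)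
    (hb : b ≠ 0) (h₁ : g.linear (0, 1, 0) = (0, a, 0)) (h₂ : g.linear (0, 0, 1) = (0, 0, b)) :
    ∃ (A : W ≃ᵃ[ℝ] W) (m m' : W →ᵃ[ℝ] ℝ), ∀ y, g y = fiberMap A a b m m' y := by
  set G : W →ᵃ[ℝ] W × ℝ × ℝ :=
    g.toAffineMap.comp (LinearMap.inl ℝ W (ℝ × ℝ)).toAffineMap with hG
  have hGw : ∀ w, G w = g (w, 0, 0) := fun w => rfl
  set A₀ : W →ᵃ[ℝ] W := (LinearMap.fst ℝ W (ℝ × ℝ)).toAffineMap.comp G with hA₀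
  have hA₀w : ∀ w, A₀ w = (g (w, 0, 0)).1 := fun w => rfl
  have hexp : ∀ w s t, g (w, s, t) = ((g (w, 0, 0)).1, a * s + (g (w, 0, 0)).2.1,
      b * t + (g (w, 0, 0)).2.2) := by
    intro w s t
    rw [affineEquiv_fiber g w s t, h₁, h₂]
    ext <;> simp <;> ring
  have hbij : Function.Bijective A₀ := by
    constructor
    · intro w w' hww
      rw [hA₀w, hA₀w] at hww
      have : g (w, 0, 0) = g (w', ((g (w, 0, 0)).2.1 - (g (w', 0, 0)).2.1) / a,
          ((g (w, 0, 0)).2.2 - (g (w', 0, 0)).2.2) / b) := by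
        rw [hexp w' _ _, ← hww]
        ext <;> simp <;> field_simp <;> ring
      exact congrArg Prod.fst (g.injective this)
    · intro w'
      obtain ⟨⟨w, s, t⟩, hw⟩ := g.surjective (w', 0, 0)
      refine ⟨w, ?_⟩
      rw [hexp] at hw
      rw [hA₀w]
      exact congrArg Prod.fst hw
  refine ⟨AffineEquiv.ofBijective hbij,
    ((LinearMap.fst ℝ ℝ ℝ).comp (LinearMap.snd ℝ W (ℝ × ℝ))).toAffineMap.comp G,
    ((LinearMap.snd ℝ ℝ ℝ).comp (LinearMap.snd ℝ W (ℝ × ℝ))).toAffineMap.comp G, ?_⟩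
  rintro ⟨w, s, t⟩
  rw [hexp]
  rfl

/-- A linear automorphism of the quadrant preserves or exchanges its sides. -/
theorem linear_quadrant (hrec : ∀ u, u ∈ recCone Ω ↔ u.1 = 0 ∧ 0 ≤ u.2.1 ∧ 0 ≤ u.2.2)
    {g : (W × ℝ × ℝ) ≃ᵃ[ℝ] (W × ℝ × ℝ)} (hg : ∀ y, g y ∈ Ω ↔ y ∈ Ω) :
    ∃ a b : ℝ, 0 < a ∧ 0 < b ∧
      ((g.linear (0, 1, 0) = (0, a, 0) ∧ g.linear (0, 0, 1) = (0, 0, b)) ∨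
        (g.linear (0, 1, 0) = (0, 0, a) ∧ g.linear (0, 0, 1) = (0, b, 0))) := by
  have hg' : ∀ y, g.symm y ∈ Ω ↔ y ∈ Ω := fun y => by
    rw [← hg, AffineEquiv.apply_symm_apply]
  have hm₁ : ((0, 1, 0) : W × ℝ × ℝ) ∈ recCone Ω := by rw [hrec]; norm_num
  have hm₂ : ((0, 0, 1) : W × ℝ × ℝ) ∈ recCone Ω := by rw [hrec]; norm_num
  have hform : ∀ u ∈ recCone Ω, ∃ s t : ℝ, 0 ≤ s ∧ 0 ≤ t ∧ u = (0, s, t) := by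
    rintro ⟨w, s, t⟩ hu
    obtain ⟨h1, h2, h3⟩ := (hrec _).1 hu
    exact ⟨s, t, h2, h3, by rw [← h1]⟩
  obtain ⟨p, q, hp, hq, h₁⟩ := hform _ (linear_mem_recCone hg hm₁)
  obtain ⟨r, s, hr, hs, h₂⟩ := hform _ (linear_mem_recCone hg hm₂)
  obtain ⟨p', q', hp', hq', h₁'⟩ := hform _ (linear_mem_recCone hg' hm₁)
  obtain ⟨r', s', hr', hs', h₂'⟩ := hform _ (linear_mem_recCone hg' hm₂)
  have hexp : ∀ x y : ℝ, ((0, x, y) : W × ℝ × ℝ) = x • (0, 1, 0) + y • (0, 0, 1) := by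
    intro x y; simp
  have hinv : ∀ u, g.symm.linear (g.linear u) = u := fun u => g.linear.symm_apply_apply u
  have e₁ := hinv (0, 1, 0)
  rw [h₁, hexp p q, map_add, map_smul, map_smul, h₁', h₂'] at e₁
  have e₂ := hinv (0, 0, 1)
  rw [h₂, hexp r s, map_add, map_smul, map_smul, h₁', h₂'] at e₂
  simp only [Prod.smul_mk, Prod.mk_add_mk, smul_eq_mul, Prod.mk.injEq] at e₁ e₂
  obtain ⟨-, e11, e12⟩ := e₁
  obtain ⟨-, e21, e22⟩ := e₂
  have hpq' : p * q' = 0 := by nlinarith [mul_nonneg hp hq', mul_nonneg hq hs']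
  have hqs' : q * s' = 0 := by nlinarith [mul_nonneg hp hq', mul_nonneg hq hs']
  have hrp' : r * p' = 0 := by nlinarith [mul_nonneg hr hp', mul_nonneg hs hr']
  have hsr' : s * r' = 0 := by nlinarith [mul_nonneg hr hp', mul_nonneg hs hr']
  rcases hp.eq_or_lt with hp0 | hp0
  · subst hp0
    rw [zero_mul, zero_add] at e11
    have hq0 : q ≠ 0 := by rintro rfl; simp at e11
    have hr'0 : r' ≠ 0 := by rintro rfl; simp at e11
    have hs0 : s = 0 := (mul_eq_zero.1 hsr').resolve_right hr'0
    subst hs0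
    have hr0 : r ≠ 0 := by rintro rfl; simp at e22
    exact ⟨q, r, hq.lt_of_ne' hq0, hr.lt_of_ne' hr0, Or.inr ⟨h₁, h₂⟩⟩
  · have hq'0 : q' = 0 := (mul_eq_zero.1 hpq').resolve_left hp0.ne'
    rw [hq'0, mul_zero, zero_add] at e22
    have hs0 : s ≠ 0 := by rintro rfl; simp at e22
    have hs'0 : s' ≠ 0 := by rintro rfl; simp at e22
    have hq0 : q = 0 := (mul_eq_zero.1 hqs').resolve_right hs'0
    subst hq0
    rw [zero_mul, add_zero] at e11
    have hp'0 : p' ≠ 0 := by rintro rfl; simp at e11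
    have hr0 : r = 0 := (mul_eq_zero.1 hrp').resolve_right hp'0
    subst hr0
    exact ⟨p, s, hp0, hs.lt_of_ne' hs0, Or.inl ⟨h₁, h₂⟩⟩

theorem exists_quadrantDomain [FiniteDimensional ℝ W] (ho : IsOpen Ω) (hc : Convex ℝ Ω)
    (hne : Ω.Nonempty) (hrec : ∀ u, u ∈ recCone Ω ↔ u.1 = 0 ∧ 0 ≤ u.2.1 ∧ 0 ≤ u.2.2)
    (hK : IsCompact K) (hKΩ : K ⊆ Ω)
    (hcov : ∀ x ∈ Ω, ∃ g : (W × ℝ × ℝ) ≃ᵃ[ℝ] (W × ℝ × ℝ), (∀ y, g y ∈ Ω ↔ y ∈ Ω) ∧ g x ∈ K) :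
    ∃ K', QuadrantDomain Ω K' := by
  have key : ∀ K' : Set (W × ℝ × ℝ), IsCompact K' → K' ⊆ Ω →
      (∀ x ∈ Ω, ∃ (g : (W × ℝ × ℝ) ≃ᵃ[ℝ] (W × ℝ × ℝ)) (a b : ℝ), (∀ y, g y ∈ Ω ↔ y ∈ Ω) ∧
        g x ∈ K' ∧ 0 < a ∧ 0 < b ∧ g.linear (0, 1, 0) = (0, a, 0) ∧
        g.linear (0, 0, 1) = (0, 0, b)) → QuadrantDomain Ω K' := by
    intro K' hK' hK'Ω hcov'
    refine ⟨ho, hc, hne, hrec, hK', hK'Ω, fun x hx => ?_⟩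
    obtain ⟨g, a, b, hg, hgx, ha, hb, h₁, h₂⟩ := hcov' x hx
    obtain ⟨A, m, m', hA⟩ := exists_eq_fiberMap ha.ne' hb.ne' h₁ h₂
    refine ⟨A, a, b, m, m', ha, hb, fun y => ?_, ?_⟩
    · rw [← hg y, hA]; rfl
    · rw [hA] at hgx; exact hgx
  by_cases hsw : ∃ (g : (W × ℝ × ℝ) ≃ᵃ[ℝ] (W × ℝ × ℝ)) (a b : ℝ), (∀ y, g y ∈ Ω ↔ y ∈ Ω) ∧
      0 < a ∧ 0 < b ∧ g.linear (0, 1, 0) = (0, 0, a) ∧ g.linear (0, 0, 1) = (0, b, 0)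
  · obtain ⟨σ, a, b, hσ, ha, hb, hσ₁, hσ₂⟩ := hsw
    refine ⟨K ∪ σ '' K, key _ (hK.union (hK.image σ.continuous_of_finiteDimensional)) ?_ ?_⟩
    · rintro x (hx | ⟨x, hx, rfl⟩)
      · exact hKΩ hx
      · exact (hσ x).2 (hKΩ hx)
    · intro x hx
      obtain ⟨g, hg, hgx⟩ := hcov x hx
      obtain ⟨p, q, hp, hq, ⟨h₁, h₂⟩ | ⟨h₁, h₂⟩⟩ := linear_quadrant hrec hg
      · exact ⟨g, p, q, hg, Or.inl hgx, hp, hq, h₁, h₂⟩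
      · refine ⟨g.trans σ, p * b, q * a, fun y => ?_, Or.inr ⟨_, hgx, rfl⟩, by positivity,
          by positivity, ?_, ?_⟩
        · rw [AffineEquiv.trans_apply, hσ, hg]
        · have e : ((0, 0, p) : W × ℝ × ℝ) = p • (0, 0, 1) := by simp
          change σ.linear (g.linear _) = _
          rw [h₁, e, map_smul, hσ₂]
          simp
        · have e : ((0, q, 0) : W × ℝ × ℝ) = q • (0, 1, 0) := by simp
          change σ.linear (g.linear _) = _
          rw [h₂, e, map_smul, hσ₁]
          simp
  · refine ⟨K, key K hK hKΩ fun x hx => ?_⟩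
    obtain ⟨g, hg, hgx⟩ := hcov x hx
    obtain ⟨p, q, hp, hq, ⟨h₁, h₂⟩ | ⟨h₁, h₂⟩⟩ := linear_quadrant hrec hg
    · exact ⟨g, p, q, hg, hgx, hp, hq, h₁, h₂⟩
    · exact absurd ⟨g, p, q, hg, hp, hq, h₁, h₂⟩ hsw

end Normalization

section Domain

/-- An affine automorphism given by a matrix in affine form, as an affine equivalence. -/
theorem exists_affineEquiv_of_isAffineForm {n : ℕ} {g : GL (Fin (n + 1)) ℝ}
    (hg : IsAffineForm n g) : ∃ e : (Fin n → ℝ) ≃ᵃ[ℝ] (Fin n → ℝ), ∀ x, e x = affAct n g x := by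
  set L : (Fin n → ℝ) →ₗ[ℝ] (Fin n → ℝ) :=
    Matrix.toLin' (Matrix.of fun i j : Fin n => g.val i.castSucc j.castSucc) with hL
  have hLx : ∀ x i, L x i = ∑ j : Fin n, g.val i.castSucc j.castSucc * x j := by
    intro x i
    simp [hL, Matrix.mulVec, dotProduct]
  have hker : LinearMap.ker L = ⊥ := by
    rw [LinearMap.ker_eq_bot']
    intro x hx
    have h1 : g.val *ᵥ Fin.snoc (α := fun _ => ℝ) x 0 = 0 := by
      ext i
      simp only [Matrix.mulVec, dotProduct, Fin.sum_univ_castSucc, Fin.snoc_castSucc,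
        Fin.snoc_last, mul_zero, add_zero, Pi.zero_apply]
      refine Fin.lastCases ?_ (fun i => ?_) i
      · simp [hg.1]
      · rw [← hLx, hx]; rfl
    have h2 : (Fin.snoc (α := fun _ => ℝ) x 0 : Fin (n + 1) → ℝ) = 0 := by
      have h3 := congrArg (fun v => (g⁻¹).val *ᵥ v) h1
      simp only [Matrix.mulVec_mulVec, Matrix.mulVec_zero] at h3
      rwa [← Units.val_mul, inv_mul_cancel, Units.val_one, Matrix.one_mulVec] at h3
    ext i
    simpa using congrFun h2 i.castSucc
  set Le : (Fin n → ℝ) ≃ₗ[ℝ] (Fin n → ℝ) :=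
    LinearEquiv.ofInjectiveEndo L (LinearMap.ker_eq_bot.1 hker) with hLe
  refine ⟨Le.toAffineEquiv.trans
    (AffineEquiv.constVAdd ℝ (Fin n → ℝ) fun i => g.val i.castSucc (Fin.last n)), fun x => ?_⟩
  ext i
  have : Le x = L x := rfl
  simp only [AffineEquiv.trans_apply, LinearEquiv.coe_toAffineEquiv,
    AffineEquiv.constVAdd_apply, vadd_eq_add, Pi.add_apply, this, hLx, affAct]
  ring

theorem exists_affineEquiv_of_mem_autSet {n : ℕ} {Ω : Set (Fin n → ℝ)}
    {g : GL (Fin (n + 1)) ℝ} (hg : g ∈ AutSet n Ω) :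
    ∃ e : (Fin n → ℝ) ≃ᵃ[ℝ] (Fin n → ℝ), (∀ x, e x = affAct n g x) ∧ ∀ x, e x ∈ Ω ↔ x ∈ Ω := by
  obtain ⟨e, he⟩ := exists_affineEquiv_of_isAffineForm hg.1
  refine ⟨e, he, fun x => ?_⟩
  have h1 : e '' Ω = Ω := by
    rw [show (e : (Fin n → ℝ) → (Fin n → ℝ)) = affAct n g from funext he]
    exact hg.2
  conv_lhs => rw [← h1]
  exact e.injective.mem_set_image

theorem exists_adapted_linearEquiv {e₁ e₂ : Fin 4 → ℝ} (h : LinearIndependent ℝ ![e₁, e₂]) :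
    ∃ Φ : (Fin 4 → ℝ) ≃ₗ[ℝ] (Fin 2 → ℝ) × ℝ × ℝ,
      ∀ s t : ℝ, Φ.symm (0, s, t) = s • e₁ + t • e₂ := by
  set S := Submodule.span ℝ (Set.range ![e₁, e₂]) with hS
  obtain ⟨T, hT⟩ := Submodule.exists_isCompl S
  have hS2 : Module.finrank ℝ S = 2 := by simpa using finrank_span_eq_card h
  have hT2 : Module.finrank ℝ T = Module.finrank ℝ (Fin 2 → ℝ) := by
    have := Submodule.finrank_add_eq_of_isCompl hT
    simp only [Module.finrank_fin_fun] at this ⊢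
    omega
  let τ : T ≃ₗ[ℝ] (Fin 2 → ℝ) := LinearEquiv.ofFinrankEq _ _ hT2
  let Ψ : (Fin 2 → ℝ) × ℝ × ℝ →ₗ[ℝ] (Fin 4 → ℝ) :=
    LinearMap.coprod (T.subtype ∘ₗ τ.symm.toLinearMap)
      (LinearMap.coprod (LinearMap.toSpanSingleton ℝ _ e₁) (LinearMap.toSpanSingleton ℝ _ e₂))
  have hΨ : ∀ w s t, Ψ (w, s, t) = (τ.symm w : Fin 4 → ℝ) + (s • e₁ + t • e₂) := by
    intro w s t; simp [Ψ]
  have hinj : Function.Injective Ψ := by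
    rw [← LinearMap.ker_eq_bot, LinearMap.ker_eq_bot']
    rintro ⟨w, s, t⟩ hw
    rw [hΨ] at hw
    have hmemS : s • e₁ + t • e₂ ∈ S := S.add_mem
      (S.smul_mem _ (Submodule.subset_span ⟨0, rfl⟩))
      (S.smul_mem _ (Submodule.subset_span ⟨1, rfl⟩))
    have hmemT : s • e₁ + t • e₂ ∈ T := by
      rw [eq_neg_of_add_eq_zero_right hw]
      exact T.neg_mem (τ.symm w).2
    have h0 : s • e₁ + t • e₂ = 0 := Submodule.disjoint_def.1 hT.disjoint _ hmemS hmemT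
    obtain ⟨hs, ht⟩ := LinearIndependent.pair_iff.1 h s t h0
    rw [h0, add_zero] at hw
    have hw0 : w = 0 := by simpa using hw
    rw [hw0, hs, ht]
    rfl
  refine ⟨(Ψ.linearEquivOfInjective hinj (by simp)).symm, fun s t => ?_⟩
  rw [LinearEquiv.symm_symm, LinearMap.linearEquivOfInjective_apply, hΨ]
  simp

/-- Straightening coordinates for a pair of quadratic graphs. -/
theorem exists_straightening {x y x' y' : ℝ} (d e f d' e' f' : ℝ) (hdet : x * y' - x' * y ≠ 0) :
    ∃ F : ((Fin 2 → ℝ) × ℝ × ℝ) ≃ᵃ[ℝ] (Fin 4 → ℝ), ∀ v, F v =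
      ![x * v.1 0 + y * v.1 1, x' * v.1 0 + y' * v.1 1,
        v.2.1 - (d * v.1 0 + e * v.1 1 + f), v.2.2 - (d' * v.1 0 + e' * v.1 1 + f')] := by
  let L : ((Fin 2 → ℝ) × ℝ × ℝ) →ₗ[ℝ] (Fin 4 → ℝ) :=
    { toFun := fun v => ![x * v.1 0 + y * v.1 1, x' * v.1 0 + y' * v.1 1,
        v.2.1 - (d * v.1 0 + e * v.1 1), v.2.2 - (d' * v.1 0 + e' * v.1 1)]
      map_add' := fun u v => by
        ext i; fin_cases i <;> simp <;> ring
      map_smul' := fun c v => by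
        ext i; fin_cases i <;> simp <;> ring }
  have hLv : ∀ v, L v = ![x * v.1 0 + y * v.1 1, x' * v.1 0 + y' * v.1 1,
        v.2.1 - (d * v.1 0 + e * v.1 1), v.2.2 - (d' * v.1 0 + e' * v.1 1)] := fun v => rfl
  have hinj : Function.Injective L := by
    rw [← LinearMap.ker_eq_bot, LinearMap.ker_eq_bot']
    rintro ⟨w, s, t⟩ hw
    rw [hLv] at hw
    have h0 : x * w 0 + y * w 1 = 0 := by simpa using congrFun hw 0
    have h1 : x' * w 0 + y' * w 1 = 0 := by simpa using congrFun hw 1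
    have h2 : s - (d * w 0 + e * w 1) = 0 := by simpa using congrFun hw 2
    have h3 : t - (d' * w 0 + e' * w 1) = 0 := by simpa using congrFun hw 3
    have hw0 : w 0 = 0 := (mul_eq_zero.1 (by linear_combination y' * h0 - y * h1 :
      (x * y' - x' * y) * w 0 = 0)).resolve_left hdet
    have hw1 : w 1 = 0 := (mul_eq_zero.1 (by linear_combination x * h1 - x' * h0 :
      (x * y' - x' * y) * w 1 = 0)).resolve_left hdet
    rw [hw0, hw1] at h2 h3
    have hw : w = 0 := by ext i; fin_cases i <;> simp [hw0, hw1]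
    ext i <;> simp_all
  refine ⟨(L.linearEquivOfInjective hinj (by simp)).toAffineEquiv.trans
    (AffineEquiv.constVAdd ℝ (Fin 4 → ℝ) ![0, 0, -f, -f']), fun v => ?_⟩
  rw [AffineEquiv.trans_apply, LinearEquiv.coe_toAffineEquiv,
    LinearMap.linearEquivOfInjective_apply, hLv, AffineEquiv.constVAdd_apply, vadd_eq_add]
  ext i
  fin_cases i <;> simp <;> ring

theorem affinelyEquivalent_of_forall_iff {n : ℕ} {Ω Ω' : Set (Fin n → ℝ)}
    (e : (Fin n → ℝ) ≃ᵃ[ℝ] (Fin n → ℝ)) (h : ∀ x, e x ∈ Ω' ↔ x ∈ Ω) :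
    AffinelyEquivalent n Ω Ω' := by
  refine ⟨e, Subset.antisymm ?_ fun z hz => ?_⟩
  · rintro _ ⟨x, hx, rfl⟩
    exact (h x).2 hx
  · obtain ⟨x, rfl⟩ := e.surjective z
    exact ⟨x, (h x).1 hz, rfl⟩

/-- A properly convex quasi-homogeneous domain with two-dimensional asymptotic cone is linearly
equivalent to the region above a convex pair. -/
theorem exists_convexPair_of_asympCone {Ω : Set (Fin 4 → ℝ)}
    (h1 : IsProperlyConvexDomain 4 Ω) (h2 : IsQuasiHomogeneous 4 Ω)
    (hAC : Module.finrank ℝ (Submodule.span ℝ (asympCone 4 Ω)) = 2) :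
    ∃ (Φ : (Fin 4 → ℝ) ≃ₗ[ℝ] (Fin 2 → ℝ) × ℝ × ℝ) (U : Set (Fin 2 → ℝ))
      (α β : (Fin 2 → ℝ) → ℝ) (K : Set (Fin 2 → ℝ)) (c c' : ℝ), ConvexPair U α β K c c' ∧
      ∀ x, x ∈ Ω ↔ (Φ x).1 ∈ U ∧ α (Φ x).1 < (Φ x).2.1 ∧ β (Φ x).1 < (Φ x).2.2 := by
  obtain ⟨⟨hne, ho, hc⟩, hline⟩ := h1
  obtain ⟨K, hK, hKΩ, hcov⟩ := h2
  have hC : asympCone 4 Ω = recCone Ω := rfl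
  rw [hC] at hAC
  obtain ⟨e₁, e₂, he₁, he₂, hli, hgen⟩ := exists_generators (isClosed_recCone ho hc hne)
    (fun u hu v hv => add_mem_recCone hu hv) (fun u hu s hs => smul_mem_recCone hu hs)
    (fun u hu hu' => eq_zero_of_mem_recCone hne hline hu hu') hAC
  obtain ⟨Φ, hΦ⟩ := exists_adapted_linearEquiv hli
  have hrec : ∀ u, u ∈ recCone (Φ '' Ω) ↔ u.1 = 0 ∧ 0 ≤ u.2.1 ∧ 0 ≤ u.2.2 := by
    intro u
    rw [mem_recCone_image]
    constructor
    · intro hu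
      obtain ⟨s, t, hs, ht, hst⟩ := hgen _ hu
      rw [← hΦ, Φ.symm.injective.eq_iff] at hst
      rw [hst]
      exact ⟨rfl, hs, ht⟩
    · obtain ⟨w, s, t⟩ := u
      rintro ⟨hw, hs, ht⟩
      obtain rfl : w = 0 := hw
      rw [hΦ]
      exact add_mem_recCone (smul_mem_recCone he₁ hs) (smul_mem_recCone he₂ ht)
  obtain ⟨K', hQ⟩ := exists_quadrantDomain (Ω := Φ '' Ω) (K := Φ '' K)
    (Φ.toContinuousLinearEquiv.toHomeomorph.isOpenMap _ ho) (hc.linear_image Φ.toLinearMap)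
    (hne.image _) hrec (hK.image Φ.toContinuousLinearEquiv.continuous) (image_mono hKΩ) (by
      rintro _ ⟨x, hx, rfl⟩
      rw [← hcov] at hx
      simp only [mem_iUnion] at hx
      obtain ⟨g, hg, z, hz, rfl⟩ := hx
      obtain ⟨e, he, heΩ⟩ := exists_affineEquiv_of_mem_autSet hg
      refine ⟨Φ.symm.toAffineEquiv.trans (e.symm.trans Φ.toAffineEquiv), fun y => ?_, ?_⟩
      · obtain ⟨y, rfl⟩ := Φ.surjective y
        simp only [AffineEquiv.trans_apply, LinearEquiv.coe_toAffineEquiv,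
          LinearEquiv.symm_apply_apply, Φ.injective.mem_set_image]
        rw [← heΩ, AffineEquiv.apply_symm_apply]
      · refine ⟨z, hz, ?_⟩
        simp only [AffineEquiv.trans_apply, LinearEquiv.coe_toAffineEquiv,
          LinearEquiv.symm_apply_apply, ← he, AffineEquiv.symm_apply_apply])
  obtain ⟨U, α, β, K'', c, c', hP, hiff⟩ := hQ.exists_convexPair
  refine ⟨Φ, U, α, β, K'', c, c', hP, fun x => ?_⟩
  rw [← hiff, Φ.injective.mem_set_image]

end Domain

/-- classification of properly convex quasi-homogeneous affine domains
in ℝ⁴ with 2-dimensional asymptotic cone. -/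
theorem dim4_asympCone_two (Ω : Set (Fin 4 → ℝ))
    (h1 : IsProperlyConvexDomain 4 Ω) (h2 : IsQuasiHomogeneous 4 Ω)
    (hAC : Module.finrank ℝ (Submodule.span ℝ (asympCone 4 Ω)) = 2) :
    AffinelyEquivalent 4 Ω
        {x : Fin 4 → ℝ | x 0 ^ 2 + x 1 ^ 2 < x 2 ∧ 0 < x 3} ∨
      AffinelyEquivalent 4 Ω
        {x : Fin 4 → ℝ | x 0 ^ 2 < x 1 ∧ x 2 ^ 2 < x 3} := by
  obtain ⟨Φ, U, α, β, K, c, c', hP, hΩ⟩ := exists_convexPair_of_asympCone h1 h2 hAC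
  obtain rfl := hP.eq_univ
  simp only [mem_univ, true_and] at hΩ
  rcases hP.normal_form with hpar | hpar | hpar
  · obtain ⟨x, y, x', y', d, e, f, d', e', f', hdet, hα, hβ⟩ := hpar
    obtain ⟨F, hF⟩ := exists_straightening d e f d' e' f' hdet
    refine Or.inl (affinelyEquivalent_of_forall_iff (Φ.toAffineEquiv.trans F) fun z => ?_)
    rw [hΩ, AffineEquiv.trans_apply, LinearEquiv.coe_toAffineEquiv, hF, hα, hβ]
    simp [lt_sub_iff_add_lt]
  · obtain ⟨x, y, x', y', d, e, f, d', e', f', hdet, hβ, hα⟩ := hpar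
    obtain ⟨F, hF⟩ := exists_straightening d' e' f' d e f hdet
    refine Or.inl (affinelyEquivalent_of_forall_iff (Φ.toAffineEquiv.trans (F.trans
      (LinearEquiv.funCongrLeft ℝ ℝ (Equiv.swap (2 : Fin 4) 3)).toAffineEquiv)) fun z => ?_)
    rw [hΩ, AffineEquiv.trans_apply, AffineEquiv.trans_apply, LinearEquiv.coe_toAffineEquiv,
      LinearEquiv.coe_toAffineEquiv, hF, hα, hβ]
    simp [lt_sub_iff_add_lt, LinearEquiv.funCongrLeft_apply, LinearMap.funLeft_apply,
      Equiv.swap_apply_def, and_comm]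
  · obtain ⟨x, y, x', y', d, e, f, d', e', f', hdet, hα, hβ⟩ := hpar
    obtain ⟨F, hF⟩ := exists_straightening d e f d' e' f' hdet
    refine Or.inr (affinelyEquivalent_of_forall_iff (Φ.toAffineEquiv.trans (F.trans
      (LinearEquiv.funCongrLeft ℝ ℝ (Equiv.swap (1 : Fin 4) 2)).toAffineEquiv)) fun z => ?_)
    rw [hΩ, AffineEquiv.trans_apply, AffineEquiv.trans_apply, LinearEquiv.coe_toAffineEquiv,
      LinearEquiv.coe_toAffineEquiv, hF, hα, hβ]
    simp [lt_sub_iff_add_lt, LinearEquiv.funCongrLeft_apply, LinearMap.funLeft_apply,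
      Equiv.swap_apply_def]
end
end

section
/- Let Ω be a properly convex quasi-homogeneous affine domain in ℝ⁴ whose asymptotic cone AC(Ω) is 4-dimensional (its linear span has dimension 4). Then Ω is a cone: there exists v ∈ ℝ⁴ such that v + t•(x − v) ∈ Ω for all x ∈ Ω and all t > 0. -/
open Matrix Set Filter Topology Pointwise

noncomputable section

section AsymptoticCone

variable {E : Type*} [NormedAddCommGroup E] [NormedSpace ℝ E] {Ω : Set E}

/-- Translations along the asymptotic cone preserve an open convex set. -/
theorem Convex.add_smul_mem_of_mem_asymptoticCone (hconv : Convex ℝ Ω) (hopen : IsOpen Ω)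
    {x u : E} (hx : x ∈ Ω) (hu : u ∈ asymptoticCone ℝ Ω) {t : ℝ} (ht : 0 ≤ t) :
    x + t • u ∈ Ω := by
  have h := hconv.smul_vadd_mem_of_mem_nhds_of_mem_asymptoticCone ht (hopen.mem_nhds hx) hu
  rwa [vadd_eq_add, add_comm] at h

theorem mem_asymptoticCone_of_forall_add_smul_mem_closure {x u : E}
    (h : ∀ t : ℝ, 0 < t → x + t • u ∈ closure Ω) : u ∈ asymptoticCone ℝ Ω := by
  rw [← asymptoticCone_closure, mem_asymptoticCone_iff]
  refine tendsto_id.atTop_smul_const_tendsto_asymptoticNhds u |>.asymptoticNhds_vadd_const x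
    |>.frequently (Eventually.frequently ?_)
  filter_upwards [eventually_gt_atTop 0] with t ht
  simpa [add_comm] using h t ht

theorem Convex.add_smul_mem_of_le (hconv : Convex ℝ Ω) {x u : E} (hx : x ∈ Ω) {s t : ℝ}
    (hs : 0 < s) (hst : s ≤ t) (h : x + t • u ∈ Ω) : x + s • u ∈ Ω := by
  have ht : 0 < t := hs.trans_le hst
  have := hconv.add_smul_mem hx h (t := s / t) ⟨by positivity, (div_le_one ht).2 hst⟩
  rwa [smul_smul, div_mul_cancel₀ _ ht.ne'] at this

variable [FiniteDimensional ℝ E]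

theorem Convex.isBounded_setOf_add_mem_sub_mem (hconv : Convex ℝ Ω) (hopen : IsOpen Ω) {p : E}
    (hp : p ∈ Ω) (hline : ∀ v : E, (∀ t : ℝ, p + t • v ∈ Ω) → v = 0) :
    Bornology.IsBounded {w : E | p + w ∈ Ω ∧ p - w ∈ Ω} := by
  by_contra hb
  obtain ⟨v, hv, hvS⟩ := not_bounded_iff_exists_ne_zero_mem_asymptoticCone.1 hb
  set S : Set E := {w : E | p + w ∈ Ω ∧ p - w ∈ Ω}
  have hSopen : IsOpen S :=
    (hopen.preimage (by fun_prop : Continuous fun w : E => p + w)).inter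
      (hopen.preimage (by fun_prop : Continuous fun w : E => p - w))
  have hSconv : Convex ℝ S := by
    intro a ha b hb c d hc hd hcd
    obtain rfl : c = 1 - d := by linarith
    constructor
    · convert hconv ha.1 hb.1 hc hd hcd using 1
      module
    · convert hconv ha.2 hb.2 hc hd hcd using 1
      module
  have h0 : (0 : E) ∈ S := by simpa [S] using hp
  have hray : ∀ t : ℝ, 0 ≤ t → t • v ∈ S := fun t ht => by
    simpa using hSconv.add_smul_mem_of_mem_asymptoticCone hSopen h0 hvS ht
  refine hv (hline v fun t => ?_)
  rcases le_total 0 t with ht | ht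
  · exact (hray t ht).1
  · simpa using (hray (-t) (by linarith)).2

/-- The symmetric parts of a properly convex open set about the points of a bounded set are
uniformly bounded. -/
theorem Convex.exists_norm_le_of_add_mem_of_sub_mem (hconv : Convex ℝ Ω) (hopen : IsOpen Ω)
    (hline : ∀ p ∈ Ω, ∀ v : E, (∀ t : ℝ, p + t • v ∈ Ω) → v = 0) {K : Set E}
    (hK : Bornology.IsBounded K) :
    ∃ R : ℝ, ∀ k ∈ K, ∀ w : E, k + w ∈ Ω → k - w ∈ Ω → ‖w‖ ≤ R := by
  rcases Ω.eq_empty_or_nonempty with rfl | ⟨p, hp⟩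
  · exact ⟨0, fun _ _ _ h => h.elim⟩
  obtain ⟨R, hR⟩ := (hconv.isBounded_setOf_add_mem_sub_mem hopen hp (hline p hp)).exists_norm_le
  obtain ⟨r, hr, hball⟩ := Metric.isOpen_iff.1 hopen p hp
  obtain ⟨D, hDpos, hD⟩ := hK.exists_pos_norm_le
  have hden : 0 < D + ‖p‖ + 1 := by positivity
  set ε : ℝ := r / (D + ‖p‖ + 1) with hε
  have hεpos : 0 < ε := by positivity
  refine ⟨(1 + ε) / ε * R, fun k hk w hw hw' => ?_⟩
  have hq : p + ε • (p - k) ∈ Ω := by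
    apply hball
    rw [Metric.mem_ball, dist_eq_norm, add_sub_cancel_left, norm_smul, Real.norm_of_nonneg hεpos.le,
      hε, div_mul_eq_mul_div, div_lt_iff₀ hden]
    have := norm_sub_le p k
    have := hD k hk
    gcongr
    linarith
  have hsum : 1 / (1 + ε) + ε / (1 + ε) = 1 := by field_simp
  have key : ∀ u : E, k + u ∈ Ω → p + (ε / (1 + ε)) • u ∈ Ω := fun u hu => by
    convert hconv hq hu (by positivity : 0 ≤ 1 / (1 + ε)) (by positivity : 0 ≤ ε / (1 + ε)) hsum
      using 1
    match_scalars <;> field_simp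
    ring
  have hbound := hR ((ε / (1 + ε)) • w)
    ⟨key w hw, by simpa [sub_eq_add_neg] using key (-w) (by rwa [← sub_eq_add_neg])⟩
  rw [norm_smul, Real.norm_of_nonneg (by positivity)] at hbound
  calc ‖w‖ = (1 + ε) / ε * (ε / (1 + ε) * ‖w‖) := by field_simp
    _ ≤ (1 + ε) / ε * R := by gcongr

end AsymptoticCone

theorem ContinuousLinearMap.opNorm_le_div_of_forall_norm_le {E F : Type*} [NormedAddCommGroup E]
    [NormedSpace ℝ E] [NormedAddCommGroup F] [NormedSpace ℝ F] (A : E →L[ℝ] F) {r R : ℝ}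
    (hr : 0 < r) (h : ∀ w, ‖w‖ ≤ r → ‖A w‖ ≤ R) : ‖A‖ ≤ R / r := by
  have hR : 0 ≤ R := by simpa using h 0 (by simpa using hr.le)
  refine ContinuousLinearMap.opNorm_le_of_unit_norm (by positivity) fun x hx => ?_
  have := h (r • x) (by rw [norm_smul, hx, Real.norm_of_nonneg hr.le, mul_one])
  rw [map_smul, norm_smul, Real.norm_of_nonneg hr.le] at this
  rwa [le_div_iff₀ hr, mul_comm]

theorem Filter.Tendsto.continuousLinearMap_apply {ι E F : Type*} [NormedAddCommGroup E]
    [NormedSpace ℝ E] [NormedAddCommGroup F] [NormedSpace ℝ F] {l : Filter ι} {A : ι → E →L[ℝ] F}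
    {A₀ : E →L[ℝ] F} {u : ι → E} {u₀ : E} (hA : Tendsto A l (𝓝 A₀)) (hu : Tendsto u l (𝓝 u₀)) :
    Tendsto (fun i => A i (u i)) l (𝓝 (A₀ u₀)) :=
  (isBoundedBilinearMap_apply.continuous.tendsto (A₀, u₀)).comp (hA.prodMk_nhds hu)

section Rescaling

variable {E : Type*} [NormedAddCommGroup E] [NormedSpace ℝ E] [FiniteDimensional ℝ E]
  {Ω K : Set E}

/-- Rescaling along a ray: automorphisms of `Ω` taking points `k n ∈ K` to `x + (n + 1) • v`, followed
by the dilation of ratio `1 / (n + 1)` about `x`, have linear parts `A n` which, like their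
inverses `B n`, converge along a subsequence. -/
theorem exists_subseq_tendsto_rescaled (hconv : Convex ℝ Ω) (hopen : IsOpen Ω)
    (hline : ∀ p ∈ Ω, ∀ v : E, (∀ t : ℝ, p + t • v ∈ Ω) → v = 0)
    (hK : IsCompact K) (hKΩ : K ⊆ Ω) {x v : E} (hx : x ∈ Ω)
    (hv : v ∈ interior (asymptoticCone ℝ Ω)) {k : ℕ → E} {A B : ℕ → E →L[ℝ] E}
    (hk : ∀ n, k n ∈ K) (hAB : ∀ n w, A n (B n w) = w)
    (hΩ : ∀ (n : ℕ) z, z ∈ Ω ↔ x + ((n : ℝ) + 1) • (v + A n (z - k n)) ∈ Ω) :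
    ∃ (k₀ : E) (A₀ B₀ : E →L[ℝ] E) (φ : ℕ → ℕ), StrictMono φ ∧
      Tendsto (k ∘ φ) atTop (𝓝 k₀) ∧ Tendsto (A ∘ φ) atTop (𝓝 A₀) ∧
      Tendsto (B ∘ φ) atTop (𝓝 B₀) := by
  have : ProperSpace (E →L[ℝ] E) := FiniteDimensional.proper ℝ _
  obtain ⟨r, hr, hrΩ⟩ := hK.exists_cthickening_subset_open hopen hKΩ
  obtain ⟨ρ, hρ, hρC⟩ := Metric.nhds_basis_closedBall.mem_iff.1 (mem_interior_iff_mem_nhds.1 hv)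
  obtain ⟨R, hR⟩ := hconv.exists_norm_le_of_add_mem_of_sub_mem hopen hline hK.isBounded
  obtain ⟨R', hR'⟩ := hconv.exists_norm_le_of_add_mem_of_sub_mem hopen hline
    (Bornology.isBounded_singleton (x := x + v))
  have hA : ∀ n, ‖A n‖ ≤ R' / r := fun n => by
    refine (A n).opNorm_le_div_of_forall_norm_le hr fun w hw => ?_
    have key : ∀ u : E, ‖u‖ ≤ r → x + v + A n u ∈ Ω := fun u hu => by
      have hmem : k n + u ∈ Ω := hrΩ <| Metric.mem_cthickening_of_dist_le _ (k n) _ _ (hk n) <| by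
        simpa [dist_eq_norm] using hu
      rw [hΩ n, add_sub_cancel_left] at hmem
      have := hconv.add_smul_mem_of_le hx one_pos (by simp) hmem
      rwa [one_smul, ← add_assoc] at this
    refine hR' _ rfl _ (key w hw) ?_
    simpa [sub_eq_add_neg] using key (-w) (by rwa [norm_neg])
  have hB : ∀ n, ‖B n‖ ≤ R / ρ := fun n => by
    refine (B n).opNorm_le_div_of_forall_norm_le hρ fun w hw => ?_
    have key : ∀ u : E, ‖u‖ ≤ ρ → k n + B n u ∈ Ω := fun u hu => by
      rw [hΩ n, add_sub_cancel_left, hAB]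
      refine hconv.add_smul_mem_of_mem_asymptoticCone hopen hx (hρC ?_) (by positivity)
      simpa [dist_eq_norm] using hu
    refine hR _ (hk n) _ (key w hw) ?_
    simpa [sub_eq_add_neg] using key (-w) (by rwa [norm_neg])
  obtain ⟨⟨k₀, A₀, B₀⟩, -, φ, hφ, hlim⟩ :=
    (hK.prod ((isCompact_closedBall (0 : E →L[ℝ] E) (R' / r)).prod
      (isCompact_closedBall (0 : E →L[ℝ] E) (R / ρ)))).tendsto_subseq
      (x := fun n => (k n, A n, B n))
      fun n => ⟨hk n, by simpa using hA n, by simpa using hB n⟩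
  rw [nhds_prod_eq, nhds_prod_eq] at hlim
  exact ⟨k₀, A₀, B₀, φ, hφ, hlim.fst, hlim.snd.fst, hlim.snd.snd⟩

/-- A properly convex open set on which affine automorphisms act with a compact set meeting every
orbit, and whose asymptotic cone has nonempty interior, is a cone. -/
theorem exists_vertex_of_interior_asymptoticCone_nonempty (hconv : Convex ℝ Ω) (hopen : IsOpen Ω)
    (hne : Ω.Nonempty) (hline : ∀ p ∈ Ω, ∀ v : E, (∀ t : ℝ, p + t • v ∈ Ω) → v = 0)
    (hK : IsCompact K) (hKΩ : K ⊆ Ω)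
    (hcov : ∀ y ∈ Ω, ∃ k ∈ K, ∃ L : E ≃L[ℝ] E, ∀ z, z ∈ Ω ↔ y + L (z - k) ∈ Ω)
    (hC : (interior (asymptoticCone ℝ Ω)).Nonempty) :
    ∃ p : E, ∀ z ∈ Ω, ∀ t : ℝ, 0 < t → p + t • (z - p) ∈ Ω := by
  obtain ⟨x, hx⟩ := hne
  obtain ⟨v, hv⟩ := hC
  have hpos : ∀ n : ℕ, (0 : ℝ) < (n : ℝ) + 1 := fun n => by positivity
  choose k hk L hL using fun n : ℕ => hcov (x + ((n : ℝ) + 1) • v)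
    (hconv.add_smul_mem_of_mem_asymptoticCone hopen hx (interior_subset hv) (hpos n).le)
  set A : ℕ → E →L[ℝ] E := fun n => ((n : ℝ) + 1)⁻¹ • (L n : E →L[ℝ] E) with hAdef
  set B : ℕ → E →L[ℝ] E := fun n => ((n : ℝ) + 1) • ((L n).symm : E →L[ℝ] E) with hBdef
  have hAB : ∀ n w, A n (B n w) = w := fun n w => by
    simp [hAdef, hBdef, smul_smul, mul_inv_cancel₀ (hpos n).ne']
  have hBA : ∀ n w, B n (A n w) = w := fun n w => by
    simp [hAdef, hBdef, smul_smul, inv_mul_cancel₀ (hpos n).ne']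
  have hΩ : ∀ (n : ℕ) z, z ∈ Ω ↔ x + ((n : ℝ) + 1) • (v + A n (z - k n)) ∈ Ω := fun n z => by
    rw [hL n z, smul_add, ← add_assoc]
    simp only [hAdef, _root_.smul_apply, smul_smul, mul_inv_cancel₀ (hpos n).ne',
      one_smul, ContinuousLinearEquiv.coe_coe]
  obtain ⟨k₀, A₀, B₀, φ, hφ, hk₀, hA₀, hB₀⟩ :=
    exists_subseq_tendsto_rescaled hconv hopen hline hK hKΩ hx hv hk hAB hΩ
  have hBA₀ : ∀ w, B₀ (A₀ w) = w := fun w => by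
    refine tendsto_nhds_unique (hB₀.continuousLinearMap_apply (hA₀.continuousLinearMap_apply tendsto_const_nhds)) ?_
    simp [hBA]
  have hcone : ∀ z ∈ Ω, v + A₀ (z - k₀) ∈ asymptoticCone ℝ Ω := fun z hz => by
    refine mem_asymptoticCone_of_forall_add_smul_mem_closure (x := x) fun s hs => ?_
    have hlim : Tendsto (fun n => x + s • (v + (A ∘ φ) n (z - (k ∘ φ) n))) atTop
        (𝓝 (x + s • (v + A₀ (z - k₀)))) :=
      tendsto_const_nhds.add <| (tendsto_const_nhds.add <|
        hA₀.continuousLinearMap_apply (tendsto_const_nhds.sub hk₀)).const_smul s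
    refine mem_closure_of_tendsto hlim ?_
    filter_upwards [(tendsto_natCast_atTop_atTop.comp hφ.tendsto_atTop).eventually_ge_atTop s]
      with n hn
    exact hconv.add_smul_mem_of_le hx hs (hn.trans (lt_add_one _).le) ((hΩ (φ n) z).1 hz)
  have hclosure : ∀ w ∈ asymptoticCone ℝ Ω, k₀ + B₀ (w - v) ∈ closure Ω := fun w hw => by
    refine mem_closure_of_tendsto (hk₀.add (hB₀.continuousLinearMap_apply tendsto_const_nhds))
      (Eventually.of_forall fun n => ?_)
    rw [hΩ (φ n)]
    simp only [Function.comp_apply, add_sub_cancel_left, hAB, add_sub_cancel]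
    exact hconv.add_smul_mem_of_mem_asymptoticCone hopen hx hw (hpos _).le
  refine ⟨k₀ - B₀ v, fun z hz t ht => ?_⟩
  set p : E := k₀ - B₀ v with hp
  have hsub : ∀ y ∈ Ω, p + t • (y - p) ∈ closure Ω := fun y hy => by
    convert hclosure _ (smul_mem_asymptoticCone ht.le (hcone y hy)) using 1
    rw [map_sub, map_smul, map_add, hBA₀, hp]
    module
  have himage : AffineMap.homothety p t '' Ω ⊆ interior (closure Ω) := by
    refine interior_maximal ?_ (AffineMap.homothety_isOpenMap p t ht.ne' _ hopen)
    rintro _ ⟨y, hy, rfl⟩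
    simpa [AffineMap.homothety_apply, add_comm] using hsub y hy
  rw [hconv.interior_closure_eq_interior_of_nonempty_interior
    (by rw [hopen.interior_eq]; exact ⟨x, hx⟩), hopen.interior_eq] at himage
  simpa [AffineMap.homothety_apply, add_comm] using himage (mem_image_of_mem _ hz)

end Rescaling

theorem Convex.interior_nonempty_of_span_eq_top {E : Type*} [NormedAddCommGroup E]
    [NormedSpace ℝ E] [FiniteDimensional ℝ E] {C : Set E} (hC : Convex ℝ C) (h0 : (0 : E) ∈ C)
    (hspan : Submodule.span ℝ C = ⊤) : (interior C).Nonempty := by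
  rw [hC.interior_nonempty_iff_affineSpan_eq_top,
    AffineSubspace.affineSpan_eq_top_iff_vectorSpan_eq_top_of_nonempty ℝ E E ⟨0, h0⟩,
    vectorSpan_eq_span_vsub_set_right ℝ h0]
  simpa using hspan

section AffineAction

variable {n : ℕ}

/-- The linear part of the affine action of a matrix. -/
def affLinearPart (n : ℕ) (g : GL (Fin (n + 1)) ℝ) : (Fin n → ℝ) →ₗ[ℝ] (Fin n → ℝ) :=
  Matrix.toLin' (Matrix.of fun i j : Fin n => g.val i.castSucc j.castSucc)

theorem affAct_eq_add_affLinearPart (g : GL (Fin (n + 1)) ℝ) (k z : Fin n → ℝ) :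
    affAct n g z = affAct n g k + affLinearPart n g (z - k) := by
  ext i
  simp only [affAct, affLinearPart, Matrix.toLin'_apply, Pi.add_apply, Matrix.mulVec, dotProduct,
    Matrix.of_apply, Pi.sub_apply, mul_sub, Finset.sum_sub_distrib]
  ring

theorem affLinearPart_injective {g : GL (Fin (n + 1)) ℝ} (hg : IsAffineForm n g) :
    Function.Injective (affLinearPart n g) := by
  rw [← LinearMap.ker_eq_bot, LinearMap.ker_eq_bot']
  intro u hu
  have hzero : g.val *ᵥ (Fin.snoc u 0 : Fin (n + 1) → ℝ) = 0 := by
    ext i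
    refine Fin.lastCases ?_ (fun i => ?_) i
    · simp [Matrix.mulVec, dotProduct, Fin.sum_univ_castSucc, hg.1]
    · simpa [affLinearPart, Matrix.mulVec, dotProduct, Fin.sum_univ_castSucc] using congrFun hu i
  have hsnoc : (Fin.snoc u 0 : Fin (n + 1) → ℝ) = 0 :=
    (Matrix.mulVec_injective_iff_isUnit.2 g.isUnit) (by rw [hzero, Matrix.mulVec_zero])
  ext i
  simpa using congrFun hsnoc i.castSucc

theorem mem_iff_affAct_mem {Ω : Set (Fin n → ℝ)} {g : GL (Fin (n + 1)) ℝ} (hg : g ∈ AutSet n Ω)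
    (z : Fin n → ℝ) : z ∈ Ω ↔ affAct n g z ∈ Ω := by
  refine ⟨fun hz => hg.2 ▸ mem_image_of_mem _ hz, fun hz => ?_⟩
  rw [← hg.2] at hz
  obtain ⟨y, hy, hyz⟩ := hz
  rw [affAct_eq_add_affLinearPart g z y, add_eq_left] at hyz
  rwa [← sub_eq_zero.1 ((map_eq_zero_iff _ (affLinearPart_injective hg.1)).1 hyz)]

/-- A properly convex quasi-homogeneous affine domain whose asymptotic cone has full dimension is
a cone. -/
theorem isCone_of_finrank_span_asympCone {Ω : Set (Fin n → ℝ)} (h1 : IsProperlyConvexDomain n Ω)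
    (h2 : IsQuasiHomogeneous n Ω)
    (hAC : Module.finrank ℝ (Submodule.span ℝ (asympCone n Ω)) = n) : IsCone n Ω := by
  obtain ⟨⟨hne, hopen, hconv⟩, hnoline⟩ := h1
  obtain ⟨K, hK, hKΩ, hcov⟩ := h2
  have hspan : Submodule.span ℝ (asympCone n Ω) = ⊤ :=
    Submodule.eq_top_of_finrank_eq (by rw [hAC, Module.finrank_fin_fun])
  have hsub : asympCone n Ω ⊆ asymptoticCone ℝ Ω := fun u hu =>
    mem_asymptoticCone_of_forall_add_smul_mem_closure fun t ht =>
      subset_closure (hu _ hne.some_mem t ht.le)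
  refine exists_vertex_of_interior_asymptoticCone_nonempty hconv hopen hne ?_ hK hKΩ ?_ ?_
  · intro p hp v hv
    by_contra hv0
    exact hnoline ⟨p, hp, v, hv0, hv⟩
  · intro y hy
    rw [← hcov] at hy
    simp only [mem_iUnion] at hy
    obtain ⟨g, hg, k, hk, rfl⟩ := hy
    refine ⟨k, hk, (LinearEquiv.ofInjectiveEndo _
      (affLinearPart_injective hg.1)).toContinuousLinearEquiv, fun z => ?_⟩
    rw [mem_iff_affAct_mem hg, affAct_eq_add_affLinearPart g k z]
    simp
  · exact hconv.asymptoticCone.interior_nonempty_of_span_eq_top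
      (zero_mem_asymptoticCone.2 hne) (top_unique (hspan ▸ Submodule.span_mono hsub))

end AffineAction

/-- a properly convex quasi-homogeneous affine domain in ℝ⁴ with
4-dimensional asymptotic cone is a cone. -/
theorem dim4_asympCone_four (Ω : Set (Fin 4 → ℝ))
    (h1 : IsProperlyConvexDomain 4 Ω) (h2 : IsQuasiHomogeneous 4 Ω)
    (hAC : Module.finrank ℝ (Submodule.span ℝ (asympCone 4 Ω)) = 4) :
    IsCone 4 Ω := by
  exact isCone_of_finrank_span_asympCone h1 h2 hAC
end
end
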